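/- Let T be a universal theory in a first-order language L that is κ-unique for some uncountable cardinal κ. Then T is categorical in every cardinality greater than the cardinality of the language: for every cardinal μ > max(|L|, ℵ₀), T has a model of cardinality μ and any two models of T of cardinality μ are isomorphic. -/

import Mathlib

open FirstOrder Language Cardinal

universe u

/-- `X` generates the `L`-structure `M`: the substructure generated by `X` is all of `M`. -/
def Generates (L : FirstOrder.Language.{u, u}) (M : Type u) [L.Structure M] (X : Set M) : Prop :=
  Substructure.closure L X = ⊤

/-- `M` is `μ`-generated: it is generated by a set of cardinality `μ`. -/
def IsGenerated (L : FirstOrder.Language.{u, u}) (M : Type u) [L.Structure M]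
    (μ : Cardinal.{u}) : Prop :=
  ∃ X : Set M, #X = μ ∧ Generates L M X

/-- `M` is strictly `μ`-generated: it is `μ`-generated but not `ν`-generated for any `ν < μ`. -/
def StrictlyGenerated (L : FirstOrder.Language.{u, u}) (M : Type u) [L.Structure M]
    (μ : Cardinal.{u}) : Prop :=
  IsGenerated L M μ ∧ ∀ ν < μ, ¬ IsGenerated L M ν

/-- A theory `T` is `κ`-unique: it has a strictly `κ`-generated model, and any two strictly
`κ`-generated models of `T` are isomorphic. -/
def KUnique {L : FirstOrder.Language.{u, u}} (T : L.Theory) (κ : Cardinal.{u}) : Prop :=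
  (∃ (M : Type u) (_ : L.Structure M), M ⊨ T ∧ StrictlyGenerated L M κ) ∧
  (∀ (M N : Type u) (_ : L.Structure M) (_ : L.Structure N),
    M ⊨ T → N ⊨ T → StrictlyGenerated L M κ → StrictlyGenerated L N κ →
      Nonempty (M ≃[L] N))

/-- A sentence is universal if it is of the form `∀ x₁ … ∀ xₙ, φ` with `φ` quantifier-free. -/
def IsUniversalSentence {L : FirstOrder.Language.{u, u}} (φ : L.Sentence) : Prop :=
  ∃ (n : ℕ) (ψ : L.BoundedFormula Empty n), ψ.IsQF ∧ φ = ψ.alls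

/-- A theory is universal if every sentence of it is universal. -/
def IsUniversalTheory {L : FirstOrder.Language.{u, u}} (T : L.Theory) : Prop :=
  ∀ φ ∈ T, IsUniversalSentence φ

namespace UniversalCategoricity

open Set Filter

variable {L : FirstOrder.Language.{u, u}}

/-- Two tuples, possibly in different structures, have the same complete type. -/
def EqT (L : FirstOrder.Language.{u, u}) {M N : Type*} [L.Structure M] [L.Structure N]
    {α : Type*} (v : α → M) (w : α → N) : Prop :=
  ∀ φ : L.Formula α, φ.Realize v ↔ φ.Realize w

section EqT

variable {M N P : Type u} [L.Structure M] [L.Structure N] [L.Structure P]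
variable {α β γ : Type*} {v : α → M} {w : α → N} {x : α → P}

theorem EqT.refl (v : α → M) : EqT L v v := fun _ => Iff.rfl

theorem EqT.symm (h : EqT L v w) : EqT L w v := fun φ => (h φ).symm

theorem EqT.trans (h : EqT L v w) (h' : EqT L w x) : EqT L v x :=
  fun φ => (h φ).trans (h' φ)

theorem EqT.comp (h : EqT L v w) (g : β → α) : EqT L (v ∘ g) (w ∘ g) := fun φ => by
  rw [← Formula.realize_relabel, ← Formula.realize_relabel]; exact h _

theorem realize_subst_formula {φ : L.Formula α} {t : α → L.Term β} {w : β → M} :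
    Formula.Realize (BoundedFormula.subst φ t) w ↔ φ.Realize fun i => (t i).realize w :=
  BoundedFormula.realize_subst

theorem EqT.terms (h : EqT L v w) (t : β → L.Term α) :
    EqT L (fun i => (t i).realize v) (fun i => (t i).realize w) := fun φ => by
  rw [← realize_subst_formula, ← realize_subst_formula]; exact h _

theorem EqT.term_eq (h : EqT L v w) (s t : L.Term α) :
    s.realize v = t.realize v ↔ s.realize w = t.realize w := by
  have := h (s.equal t)
  simpa [Formula.realize_equal] using this

theorem EqT.sentence (h : EqT L v w) (φ : L.Sentence) : M ⊨ φ ↔ N ⊨ φ := by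
  have := h (Formula.relabel Empty.elim φ)
  rw [Formula.realize_relabel, Formula.realize_relabel] at this
  convert this using 1 <;> simp only [Sentence.Realize] <;> congr! 1

theorem EqT.models (h : EqT L v w) {T : L.Theory} (hM : M ⊨ T) : N ⊨ T :=
  ⟨fun φ hφ => (h.sentence φ).1 (hM.realize_of_mem φ hφ)⟩

/-- A formula only depends on finitely many variables. -/
theorem exists_finset_formula (φ : L.Formula α) : ∃ (s : Finset α) (ψ : L.Formula s),
    ∀ (M : Type u) [L.Structure M] (v : α → M), φ.Realize v ↔ ψ.Realize (fun i : s => v i) := by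
  classical
  refine ⟨φ.freeVarFinset, φ.restrictFreeVar id, fun M _ v => ?_⟩
  exact (BoundedFormula.realize_restrictFreeVar (φ := φ) (f := id) (v' := v) (fun _ => rfl)).symm

theorem eqT_of_finset (h : ∀ s : Finset α, EqT L (fun i : s => v i) (fun i : s => w i)) :
    EqT L v w := fun φ => by
  obtain ⟨s, ψ, hψ⟩ := exists_finset_formula φ
  rw [hψ, hψ]; exact h s ψ

theorem exists_terms (X : Set M) (v : α → M) (hX : ∀ m ∈ X, m ∈ range v) (c : β → M)
    (hc : ∀ i, c i ∈ Substructure.closure L X) :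
    ∃ t : β → L.Term α, ∀ i, (t i).realize v = c i := by
  choose s hs using fun m : X => hX m m.2
  choose t ht using fun i => Substructure.mem_closure_iff_exists_term.1 (hc i)
  refine ⟨fun i => (t i).relabel s, fun i => ?_⟩
  rw [Term.realize_relabel, ← ht i]
  congr 1
  funext m
  exact hs m

theorem realize_mem_closure (t : L.Term α) (v : α → M) (X : Set M) (h : ∀ i, v i ∈
    Substructure.closure L X) : t.realize v ∈ Substructure.closure L X :=
  Term.realize_mem t v h

theorem exists_finset_of_mem_closure {X : Set M} {m : M} (hm : m ∈ Substructure.closure L X) :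
    ∃ s : Finset M, ↑s ⊆ X ∧ m ∈ Substructure.closure L (s : Set M) := by
  classical
  obtain ⟨t, ht⟩ := Substructure.mem_closure_iff_exists_term.1 hm
  refine ⟨t.varFinset.image Subtype.val, ?_, ?_⟩
  · intro x hx
    simp only [Finset.coe_image, mem_image] at hx
    obtain ⟨y, -, rfl⟩ := hx
    exact y.2
  · rw [← ht, ← Term.realize_restrictVar' (s := (t.varFinset : Set X)) subset_rfl]
    refine realize_mem_closure _ _ _ fun k => Substructure.subset_closure ?_
    simp only [Finset.coe_image]
    exact ⟨k, k.2, rfl⟩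

theorem exists_finset_index {A : Set M} {S : Set α} {m : M}
    (hm : m ∈ Substructure.closure L (A ∪ v '' S)) :
    ∃ F : Finset α, ↑F ⊆ S ∧ m ∈ Substructure.closure L (A ∪ v '' F) := by
  classical
  obtain ⟨s, hs, hm⟩ := exists_finset_of_mem_closure hm
  have h1 : ∀ x ∈ s, ∃ F : Finset α, ↑F ⊆ S ∧ x ∈ A ∪ v '' F := by
    intro x hx
    rcases hs hx with h | ⟨i, hi, rfl⟩
    · exact ⟨∅, by simp, Or.inl h⟩
    · exact ⟨{i}, by simpa using hi, Or.inr ⟨i, by simp, rfl⟩⟩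
  choose! F hF hF' using h1
  refine ⟨s.biUnion F, ?_, Substructure.closure_mono ?_ hm⟩
  · simp only [Finset.coe_biUnion, iUnion_subset_iff]
    exact hF
  · intro x hx
    refine union_subset_union_right A (image_mono ?_) (hF' x hx)
    exact Finset.subset_biUnion_of_mem F hx

/-- A partial elementary map extends to the generated substructure. -/
theorem EqT.extend (h : EqT L v w) (c : β → M)
    (hc : ∀ i, c i ∈ Substructure.closure L (range v)) :
    ∃ c' : β → N, EqT L (Sum.elim v c) (Sum.elim w c') ∧
      ∀ i, ∀ S : Set α, c i ∈ Substructure.closure L (v '' S) →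
        c' i ∈ Substructure.closure L (w '' S) := by
  obtain ⟨t, ht⟩ := exists_terms (range v) v (fun _ h => h) c hc
  refine ⟨fun i => (t i).realize w, ?_, fun i S hi => ?_⟩
  · have := h.terms (Sum.elim Term.var t)
    convert this using 1 <;> funext i <;> cases i <;> simp [ht]
  · obtain ⟨s, hs⟩ := exists_terms (v '' S) (fun i : S => v i) (by
      rintro _ ⟨i, hi, rfl⟩; exact ⟨⟨i, hi⟩, rfl⟩) (fun _ : Unit => c i) (fun _ => hi)
    have h1 : ((s ()).relabel (Subtype.val : S → α)).realize v = (t i).realize v := by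
      rw [Term.realize_relabel, ht]; exact hs ()
    rw [h.term_eq, Term.realize_relabel] at h1
    change (t i).realize w ∈ _
    rw [← h1]
    exact realize_mem_closure _ _ _ fun j => Substructure.subset_closure ⟨j, j.2, rfl⟩

end EqT

/-- Compactness theorem for formulas with free variables. -/
theorem compactness {α : Type u} [Nonempty α] (Γ : Set (L.Formula α))
    (h : ∀ s : Finset (L.Formula α), ↑s ⊆ Γ →
      ∃ (M : Type u) (_ : L.Structure M) (v : α → M), ∀ φ ∈ s, φ.Realize v) :
    ∃ (M : Type u) (_ : L.Structure M) (v : α → M), ∀ φ ∈ Γ, φ.Realize v := by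
  classical
  have hT : Theory.IsSatisfiable (Formula.equivSentence '' Γ : L[[α]].Theory) := by
    rw [Theory.isSatisfiable_iff_isFinitelySatisfiable]
    intro T0 hT0
    obtain ⟨s, hs, rfl⟩ := Finset.subset_set_image_iff.1 hT0
    obtain ⟨M, _, v, hv⟩ := h s hs
    let _ := constantsOn.structure v
    have : Nonempty M := ‹Nonempty α›.map v
    refine ⟨@Theory.ModelType.of _ _ M _ ?_ _⟩
    refine ⟨fun φ hφ => ?_⟩
    simp only [Finset.coe_image, Set.mem_image] at hφ
    obtain ⟨φ, hφ, rfl⟩ := hφ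
    rw [Formula.realize_equivSentence]
    exact hv φ hφ
  obtain ⟨M⟩ := hT
  let _ := (L.lhomWithConstants α).reduct M
  have : (L.lhomWithConstants α).IsExpansionOn M := LHom.isExpansionOn_reduct _ _
  refine ⟨M, inferInstance, fun a => (L.con a : M), fun φ hφ => ?_⟩
  rw [← Formula.realize_equivSentence]
  exact M.is_model.realize_of_mem _ ⟨φ, hφ, rfl⟩

/-- A limit of a family of valuations along a filter. -/
theorem exists_limit {α : Type u} [Nonempty α] {I : Type*} (l : Filter I) [l.NeBot]
    (M : I → Type u) [∀ i, L.Structure (M i)] (v : ∀ i, α → M i) :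
    ∃ (N : Type u) (_ : L.Structure N) (w : α → N),
      ∀ φ : L.Formula α, (∀ᶠ i in l, φ.Realize (v i)) → φ.Realize w := by
  refine compactness {φ | ∀ᶠ i in l, φ.Realize (v i)} fun s hs => ?_
  have : ∀ᶠ i in l, ∀ φ ∈ s, φ.Realize (v i) :=
    (Filter.eventually_all_finset s).2 fun φ hφ => hs hφ
  obtain ⟨i, hi⟩ := this.exists
  exact ⟨M i, inferInstance, v i, hi⟩

/-- Realization of a finitely satisfiable set of formulas in an elementary extension. -/
theorem exists_elementary_realization {E : Type u} [L.Structure E] {α : Type u} [Nonempty E]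
    (Γ : Set (L.Formula (E ⊕ α)))
    (h : ∀ s : Finset (L.Formula (E ⊕ α)), ↑s ⊆ Γ →
      ∃ v : α → E, ∀ φ ∈ s, φ.Realize (Sum.elim id v)) :
    ∃ (M : Type u) (_ : L.Structure M) (f : E → M) (v : α → M), EqT L id f ∧
      ∀ φ ∈ Γ, φ.Realize (Sum.elim f v) := by
  classical
  obtain ⟨M, _, w, hw⟩ := compactness
    (Γ ∪ {φ | ∃ ψ : L.Formula E, ψ.Realize id ∧ φ = ψ.relabel Sum.inl}) (fun s hs => by
      obtain ⟨v, hv⟩ := h (s.filter (· ∈ Γ)) (fun φ hφ => by simpa using (Finset.mem_filter.1 hφ).2)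
      refine ⟨E, inferInstance, Sum.elim id v, fun φ hφ => ?_⟩
      rcases hs hφ with h1 | ⟨ψ, hψ, rfl⟩
      · exact hv φ (Finset.mem_filter.2 ⟨hφ, h1⟩)
      · rw [Formula.realize_relabel]; exact hψ)
  refine ⟨M, inferInstance, w ∘ Sum.inl, w ∘ Sum.inr, fun φ => ?_, fun φ hφ => ?_⟩
  · constructor
    · intro hφ
      rw [← Formula.realize_relabel]
      exact hw _ (Or.inr ⟨φ, hφ, rfl⟩)
    · intro hφ
      by_contra hn
      have := hw _ (Or.inr ⟨φ.not, by simpa using hn, rfl⟩)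
      rw [Formula.realize_relabel] at this
      simp only [Formula.realize_not] at this
      exact this hφ
  · have := hw φ (Or.inl hφ)
    rwa [Sum.elim_comp_inl_inr]

section Embeddings

variable {M N : Type u} [L.Structure M] [L.Structure N]

theorem EqT.injective {α : Type*} {v : α → M} {w : α → N} (h : EqT L v w)
    (hv : Function.Injective v) : Function.Injective w := fun i j hij => by
  have := (h.term_eq (Term.var i) (Term.var j)).2 (by simpa using hij)
  exact hv (by simpa using this)

/-- A map preserving all formulas as an embedding. -/
def EqT.toEmbedding {f : M → N} (h : EqT L id f) : M ↪[L] N where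
  toFun := f
  inj' := h.injective Function.injective_id
  map_fun' {n} g x := by
    have := h.term_eq (Term.func g fun i => Term.var (x i))
      (Term.var (Structure.funMap g x))
    exact (this.1 (by simp [Term.realize])).symm
  map_rel' {n} r x := by
    have := h (Relations.formula r fun i => Term.var (x i))
    simp only [Formula.realize_rel, Term.realize_var] at this
    exact this.symm

@[simp] theorem EqT.coe_toEmbedding {f : M → N} (h : EqT L id f) : ⇑h.toEmbedding = f := rfl

theorem eqT_embedding_iff_comp {f : M → N} (h : EqT L id f) {α : Type*} (v : α → M) :
    EqT L v (f ∘ v) := h.comp v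

/-- Tuples of the same type generate isomorphic substructures. -/
theorem EqT.exists_equiv {α : Type*} {v : α → M} {w : α → N} (h : EqT L v w) :
    ∃ e : Substructure.closure L (range v) ≃[L] Substructure.closure L (range w),
      ∀ (t : L.Term α) (x : Substructure.closure L (range v)),
        (x : M) = t.realize v → (e x : N) = t.realize w := by
  have hv : ∀ x : Substructure.closure L (range v), ∃ t : L.Term α, t.realize v = x := fun x => by
    obtain ⟨t, ht⟩ := exists_terms (range v) v (fun _ h => h) (fun _ : Unit => (x : M))
      (fun _ => x.2)
    exact ⟨t (), ht ()⟩
  have hw : ∀ x : Substructure.closure L (range w), ∃ t : L.Term α, t.realize w = x := fun x => by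
    obtain ⟨t, ht⟩ := exists_terms (range w) w (fun _ h => h) (fun _ : Unit => (x : N))
      (fun _ => x.2)
    exact ⟨t (), ht ()⟩
  choose tv htv using hv
  choose tw htw using hw
  have mw : ∀ t : L.Term α, t.realize w ∈ Substructure.closure L (range w) := fun t =>
    realize_mem_closure _ _ _ fun i => Substructure.subset_closure ⟨i, rfl⟩
  have mv : ∀ t : L.Term α, t.realize v ∈ Substructure.closure L (range v) := fun t =>
    realize_mem_closure _ _ _ fun i => Substructure.subset_closure ⟨i, rfl⟩
  let F : Substructure.closure L (range v) → Substructure.closure L (range w) :=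
    fun x => ⟨(tv x).realize w, mw _⟩
  have hF : ∀ (t : L.Term α) (x : Substructure.closure L (range v)),
      (x : M) = t.realize v → (F x : N) = t.realize w := fun t x hx =>
    (h.term_eq _ _).1 ((htv x).trans hx)
  refine ⟨⟨⟨F, fun y => ⟨(tw y).realize v, mv _⟩, fun x => ?_, fun y => ?_⟩, ?_, ?_⟩, hF⟩
  · apply Subtype.ext
    rw [← htv x]
    exact (h.term_eq _ _).2 (htw _)
  · apply Subtype.ext
    rw [hF (tw y) _ rfl, htw]
  · intro n f x
    apply Subtype.ext
    have h1 := hF (Term.func f fun i => tv (x i)) (Structure.funMap f x) (by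
      simp [Term.realize, htv]; rfl)
    exact h1
  · intro n r x
    have := h (Relations.formula r fun i => tv (x i))
    simp only [Formula.realize_rel, htv] at this
    exact this.symm

end Embeddings

section Models

variable {T : L.Theory}

theorem models_of_embedding (hT : IsUniversalTheory T) {M N : Type u} [L.Structure M]
    [L.Structure N] (f : M ↪[L] N) (hN : N ⊨ T) : M ⊨ T := by
  refine ⟨fun φ hφ => ?_⟩
  obtain ⟨n, ψ, hψ, rfl⟩ := hT φ hφ
  have := hN.realize_of_mem _ hφ
  refine BoundedFormula.realize_alls.2 ?_
  replace this := BoundedFormula.realize_alls.1 this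
  intro xs
  have h1 := this (f ∘ xs)
  rw [show (default : Empty → N) = f ∘ (default : Empty → M) from Subsingleton.elim _ _] at h1
  exact (hψ.realize_embedding f).1 h1

end Models

/-- The type of the tuple `b` over `C` is the average of the types of the tuples `e ∘ x`,
with respect to the ultrafilter `D`. -/
def Avg (L : FirstOrder.Language.{u, u}) {β M : Type*} [L.Structure M] {ι : Type}
    (e : β → M) (D : Ultrafilter (ι → β)) (C : Set M) (b : ι → M) : Prop :=
  ∀ φ : L.Formula (C ⊕ ι), φ.Realize (Sum.elim (↑) b) ↔
    ∀ᶠ x in (D : Filter (ι → β)), φ.Realize (Sum.elim (↑) (e ∘ x))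

/-- A coheir sequence for the ultrafilter `D`. -/
def DSeq (L : FirstOrder.Language.{u, u}) {β M I : Type*} [L.Structure M] [LinearOrder I]
    {ι : Type} (e : β → M) (D : Ultrafilter (ι → β)) (J : I → ι → M) : Prop :=
  ∀ i, Avg L e D (range e ∪ ⋃ j < i, range (J j)) (J i)

section Avg

variable {β β₀ : Type*} {M N : Type u} [L.Structure M] [L.Structure N] {ι : Type}
  {e : β → M} {D : Ultrafilter (ι → β)} {C C' : Set M} {b : ι → M}

theorem Avg.of_family {γ : Type*} (v : γ → M) (hC : C ⊆ range v)
    (h : ∀ φ : L.Formula (γ ⊕ ι), φ.Realize (Sum.elim v b) ↔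
      ∀ᶠ x in (D : Filter (ι → β)), φ.Realize (Sum.elim v (e ∘ x))) : Avg L e D C b := fun φ => by
  choose s hs using fun c : C => hC c.2
  have key : ∀ y : ι → M, (φ.relabel (Sum.map s id)).Realize (Sum.elim v y) ↔
      φ.Realize (Sum.elim (↑) y) := fun y => by
    rw [Formula.realize_relabel, Sum.elim_comp_map]
    simp only [Function.comp_id]
    rw [show v ∘ s = Subtype.val from funext hs]
  rw [← key, h]
  simp only [key]

theorem Avg.iff (h : Avg L e D C b) {γ : Type*} (c : γ → M)
    (hc : ∀ k, c k ∈ Substructure.closure L C) (φ : L.Formula (γ ⊕ ι)) :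
    φ.Realize (Sum.elim c b) ↔ ∀ᶠ x in (D : Filter (ι → β)), φ.Realize (Sum.elim c (e ∘ x)) := by
  obtain ⟨t, ht⟩ := exists_terms C (fun i : C => (i : M)) (fun m hm => ⟨⟨m, hm⟩, rfl⟩) c hc
  have key : ∀ y : ι → M, Formula.Realize (BoundedFormula.subst φ
      (Sum.elim (fun k => (t k).relabel Sum.inl) (fun i => Term.var (Sum.inr i))))
      (Sum.elim (fun i : C => (i : M)) y) ↔ φ.Realize (Sum.elim c y) := fun y => by
    rw [realize_subst_formula]
    congr! 1
    funext k
    cases k <;> simp [Term.realize_relabel, ← ht]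
  rw [← key, h]
  simp only [key]

theorem Avg.mono (h : Avg L e D C b) (hC : C' ⊆ Substructure.closure L C) : Avg L e D C' b :=
  Avg.of_family (fun i : C' => (i : M)) (fun m hm => ⟨⟨m, hm⟩, rfl⟩)
    fun φ => h.iff _ (fun k => hC k.2) φ

theorem Avg.closure (h : Avg L e D C b) : Avg L e D (Substructure.closure L C : Set M) b :=
  h.mono subset_rfl

theorem Avg.eqT {c : ι → M} (h : Avg L e D C b) (h' : Avg L e D C c) :
    EqT L (Sum.elim (fun i : C => (i : M)) b) (Sum.elim (fun i : C => (i : M)) c) :=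
  fun φ => (h φ).trans (h' φ).symm

theorem Avg.of_eqT {c : ι → M} (h : Avg L e D C b)
    (h' : EqT L (Sum.elim (fun i : C => (i : M)) b) (Sum.elim (fun i : C => (i : M)) c)) :
    Avg L e D C c :=
  fun φ => (h' φ).symm.trans (h φ)

theorem avg_map_left_iff {ρ : β₀ → β} {D₀ : Ultrafilter (ι → β₀)} :
    Avg L (e ∘ ρ) D₀ C b ↔ Avg L e (D₀.map (ρ ∘ ·)) C b := Iff.rfl

end Avg

section DSeq

variable {β β₀ : Type*} {M N : Type u} [L.Structure M] [L.Structure N] {ι : Type}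
  {e : β → M} {e' : β → N} {D : Ultrafilter (ι → β)} {I I' : Type*} [LinearOrder I]
  [LinearOrder I'] {J : I → ι → M} {J' : I → ι → N}

theorem DSeq.comp (h : DSeq L e D J) {π : I' → I} (hπ : StrictMono π) : DSeq L e D (J ∘ π) :=
  fun i => (h (π i)).mono fun m hm => Substructure.subset_closure (by
    rcases hm with hm | hm
    · exact Or.inl hm
    · right
      simp only [mem_iUnion] at hm ⊢
      obtain ⟨j, hj, hm⟩ := hm
      exact ⟨π j, hπ hj, hm⟩)

theorem DSeq.comp_left {ρ : β₀ → β} {D₀ : Ultrafilter (ι → β₀)}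
    (h : DSeq L e (D₀.map (ρ ∘ ·)) J) : DSeq L (e ∘ ρ) D₀ J := fun i =>
  avg_map_left_iff.2 ((h i).mono fun m hm => Substructure.subset_closure (by
    rcases hm with ⟨x, rfl⟩ | hm
    · exact Or.inl ⟨ρ x, rfl⟩
    · exact Or.inr hm))

/-- The decomposition of the variables of a coheir sequence at its last index. -/
theorem mem_base (F : Finset I) (i : I) (hi : ∀ j ∈ F, j < i)
    (k : β ⊕ (F × ι)) : Sum.elim e (fun p : F × ι => J p.1 p.2) k ∈
      Substructure.closure L (range e ∪ ⋃ j < i, range (J j)) := by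
  apply Substructure.subset_closure
  rcases k with k | ⟨j, k⟩
  · exact Or.inl ⟨k, rfl⟩
  · right
    simp only [mem_iUnion]
    exact ⟨j, hi j j.2, k, rfl⟩

/-- Split off the variables of the index `i`. -/
def splitLast (β : Type*) (ι : Type) (F : Finset I) (i : I) :
    β ⊕ (↥(insert i F) × ι) → (β ⊕ (F × ι)) ⊕ ι
  | Sum.inl x => Sum.inl (Sum.inl x)
  | Sum.inr (j, k) => if h : (j : I) ∈ F then Sum.inl (Sum.inr (⟨j, h⟩, k)) else Sum.inr k

theorem elim_comp_splitLast {F : Finset I} {i : I} {P : Type*} (x : β → P)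
    (y : I → ι → P) :
    Sum.elim (Sum.elim x fun p : F × ι => y p.1 p.2) (y i) ∘ splitLast β ι F i =
      Sum.elim x fun p : ↥(insert i F) × ι => y p.1 p.2 := by
  funext k
  rcases k with k | ⟨⟨j, hj⟩, k⟩
  · rfl
  · by_cases h : j ∈ F
    · simp [splitLast, h]
    · have : j = i := by
        rcases Finset.mem_insert.1 hj with h' | h'
        · exact h'
        · exact absurd h' h
      subst this
      simp [splitLast, h]

theorem DSeq.eqT_finset (h : DSeq L e D J) (h' : DSeq L e' D J') (hee : EqT L e e')
    (F : Finset I) : EqT L (Sum.elim e fun p : F × ι => J p.1 p.2)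
      (Sum.elim e' fun p : F × ι => J' p.1 p.2) := by
  induction F using Finset.induction_on_max with
  | empty =>
    have key : ∀ {P : Type u} (x : β → P) (z : ↥(∅ : Finset I) × ι → P),
        Sum.elim x z = x ∘ Sum.elim id (fun p => absurd p.1.2 (Finset.notMem_empty _)) := by
      intro P x z
      funext k
      rcases k with k | k
      · rfl
      · exact absurd k.1.2 (Finset.notMem_empty _)
    rw [key, key]
    exact hee.comp _
  | insert i F hi ih =>
    suffices EqT L (Sum.elim (Sum.elim e fun p : F × ι => J p.1 p.2) (J i))
        (Sum.elim (Sum.elim e' fun p : F × ι => J' p.1 p.2) (J' i)) by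
      have h1 := this.comp (splitLast β ι F i)
      rwa [elim_comp_splitLast, elim_comp_splitLast] at h1
    intro φ
    rw [(h i).iff _ (mem_base F i hi), (h' i).iff _ (mem_base F i hi)]
    refine eventually_congr (Eventually.of_forall fun x => ?_)
    have h1 := ih.comp (Sum.elim id (Sum.inl ∘ x))
    rw [Sum.comp_elim, Sum.comp_elim] at h1
    exact h1 φ

theorem exists_finset_formula_index (φ : L.Formula (β ⊕ (I × ι))) :
    ∃ (F : Finset I) (ψ : L.Formula (β ⊕ (F × ι))), ∀ (P : Type u) [L.Structure P]
      (x : β → P) (y : I → ι → P), φ.Realize (Sum.elim x (Function.uncurry y)) ↔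
        ψ.Realize (Sum.elim x fun p : F × ι => y p.1 p.2) := by
  classical
  obtain ⟨s, ψ, hψ⟩ := exists_finset_formula φ
  have hs : ∀ k : s, ∀ j n, (k : β ⊕ (I × ι)) = Sum.inr (j, n) →
      j ∈ s.biUnion (Sum.elim (fun _ => ∅) fun p => {p.1}) := fun k j n hk =>
    Finset.mem_biUnion.2 ⟨k, k.2, by rw [hk]; simp⟩
  let r : s → β ⊕ (↥(s.biUnion (Sum.elim (fun _ => ∅) fun p => {p.1}) : Finset I) × ι) := fun k =>
    match hk : (k : β ⊕ (I × ι)) with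
    | Sum.inl b => Sum.inl b
    | Sum.inr (j, n) => Sum.inr (⟨j, hs k j n hk⟩, n)
  refine ⟨_, ψ.relabel r, fun P _ x y => ?_⟩
  rw [hψ, Formula.realize_relabel]
  congr! 1
  funext k
  obtain ⟨k, hk⟩ := k
  rcases k with k | ⟨j, n⟩ <;> rfl

theorem DSeq.eqT (h : DSeq L e D J) (h' : DSeq L e' D J') (hee : EqT L e e') :
    EqT L (Sum.elim e (Function.uncurry J)) (Sum.elim e' (Function.uncurry J')) := fun φ => by
  obtain ⟨F, ψ, hψ⟩ := exists_finset_formula_index φ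
  rw [hψ, hψ]
  exact h.eqT_finset h' hee F ψ

/-- A formula true of a coheir sequence is true of elements of the base. -/
theorem DSeq.exists_base (h : DSeq L e D J) {G : Set (ι → β)} (hG : G ∈ D)
    (φ : L.Formula (β ⊕ (I × ι))) (hφ : φ.Realize (Sum.elim e (Function.uncurry J))) :
    ∃ x : I → ι → β, (∀ i, x i ∈ G) ∧
      φ.Realize (Sum.elim e (Function.uncurry fun i => e ∘ x i)) := by
  classical
  suffices key : ∀ (F : Finset I) (ψ : L.Formula (β ⊕ (F × ι))),
      ψ.Realize (Sum.elim e fun p : F × ι => J p.1 p.2) → ∃ x : I → ι → β, (∀ i, x i ∈ G) ∧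
        ψ.Realize (Sum.elim e fun p : F × ι => e (x p.1 p.2)) by
    obtain ⟨F, ψ, hψ⟩ := exists_finset_formula_index φ
    obtain ⟨x, hx, hx'⟩ := key F ψ ((hψ _ _ _).1 hφ)
    exact ⟨x, hx, (hψ _ _ _).2 hx'⟩
  intro F
  induction F using Finset.induction_on_max with
  | empty =>
    intro ψ hψ
    obtain ⟨x, hx⟩ := D.nonempty_of_mem hG
    refine ⟨fun _ => x, fun _ => hx, ?_⟩
    convert hψ using 2
    funext k
    exact absurd k.1.2 (Finset.notMem_empty _)
  | insert i F hi ih =>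
    intro ψ hψ
    rw [← elim_comp_splitLast, ← Formula.realize_relabel, (h i).iff _ (mem_base F i hi)] at hψ
    obtain ⟨x, hx, hxG⟩ := (hψ.and hG).exists
    have h1 : ((ψ.relabel (splitLast β ι F i)).relabel (Sum.elim id (Sum.inl ∘ x))).Realize
        (Sum.elim e fun p : F × ι => J p.1 p.2) := by
      rw [Formula.realize_relabel, Sum.comp_elim]
      exact hx
    obtain ⟨y, hy, hy'⟩ := ih _ h1
    refine ⟨Function.update y i x, fun j => ?_, ?_⟩
    · by_cases hj : j = i
      · subst hj; rw [Function.update_self]; exact hxG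
      · rw [Function.update_of_ne hj]; exact hy j
    · rw [Formula.realize_relabel, Sum.comp_elim, Formula.realize_relabel] at hy'
      convert hy' using 1
      have h2 := elim_comp_splitLast (F := F) (i := i) e
        (fun j : I => fun k : ι => e (Function.update y i x j k))
      rw [← h2]
      congr 2
      · simp only [Function.comp_id]
        congr 1
        funext p
        have : (p.1 : I) ≠ i := (hi _ p.1.2).ne
        simp [this]
      · funext k
        simp

theorem DSeq.notMem_closure {D : Ultrafilter (Unit → β)} {J : I → Unit → M}
    (h : DSeq L e D J) (he : Function.Injective e)
    (hD : ∀ a, ∀ᶠ x in (D : Filter (Unit → β)), x () ≠ a) (i : I) :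
    J i () ∉ Substructure.closure L (range e ∪ (fun k => J k ()) '' {k | k ≠ i}) := by
  classical
  have key : ∀ F : Finset I, (∀ k ∈ F, i < k) → J i () ∉ Substructure.closure L
      (range e ∪ (fun k => J k ()) '' {k | k < i ∨ k ∈ F}) := by
    intro F
    induction F using Finset.induction_on_max with
    | empty =>
      intro _ hmem
      have h1 := (h i).iff (fun _ : Unit => J i ()) (fun _ => by
        refine Substructure.closure_mono (union_subset_union_right _ ?_) hmem
        rintro _ ⟨k, hk, rfl⟩
        simp only [Finset.notMem_empty, or_false, mem_ofPred_eq] at hk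
        simp only [mem_iUnion]
        exact ⟨k, hk, (), rfl⟩) ((Term.var (Sum.inl ())).equal (Term.var (Sum.inr ())))
      simp only [Formula.realize_equal, Term.realize_var, Sum.elim_inl, Sum.elim_inr,
        true_iff, Function.comp_apply] at h1
      obtain ⟨x, hx⟩ := h1.exists
      obtain ⟨y, hy, hy'⟩ := (h1.and (hD (x ()))).exists
      exact hy' (he (hy.symm.trans hx))
    | insert j F hj ih =>
      intro hF hmem
      refine ih (fun k hk => hF k (Finset.mem_insert_of_mem hk)) ?_
      set C := range e ∪ (fun k => J k ()) '' {k | k < i ∨ k ∈ F} with hC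
      have hij : i < j := hF j (Finset.mem_insert_self _ _)
      obtain ⟨t, ht⟩ := exists_terms (L := L) _
        (Sum.elim (fun c : C => (c : M)) (fun _ : Unit => J j ()))
        (by
          rintro m (hm | ⟨k, hk, rfl⟩)
          · exact ⟨Sum.inl ⟨m, Or.inl hm⟩, rfl⟩
          · by_cases hkj : k = j
            · subst hkj
              exact ⟨Sum.inr (), rfl⟩
            · refine ⟨Sum.inl ⟨J k (), Or.inr ⟨k, ?_, rfl⟩⟩, rfl⟩
              simpa [hkj] using hk) (fun _ : Unit => J i ()) (fun _ => hmem)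
      have hsub : ∀ m ∈ C, m ∈ range e ∪ ⋃ k < j, range (J k) := by
        rintro m (hm | ⟨k, hk, rfl⟩)
        · exact Or.inl hm
        · right
          simp only [mem_iUnion]
          refine ⟨k, ?_, (), rfl⟩
          rcases hk with hk | hk
          · exact hk.trans hij
          · exact hj k hk
      have h1 := (h j).iff (Sum.elim (fun c : C => (c : M)) (fun _ : Unit => J i ())) (by
        rintro (k | k)
        · exact Substructure.subset_closure (hsub _ k.2)
        · refine Substructure.subset_closure (Or.inr ?_)
          simp only [mem_iUnion]
          exact ⟨i, hij, (), rfl⟩)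
        ((t ()).relabel (Sum.map Sum.inl id) |>.equal (Term.var (Sum.inl (Sum.inr ()))))
      simp only [Formula.realize_equal, Term.realize_var, Sum.elim_inl, Sum.elim_inr,
        Term.realize_relabel, Sum.elim_comp_map, Function.comp_id, Sum.elim_comp_inl] at h1
      obtain ⟨x, hx⟩ := (h1.1 (ht ())).exists
      rw [← hx]
      refine realize_mem_closure _ _ _ ?_
      rintro (k | k)
      · exact Substructure.subset_closure k.2
      · exact Substructure.subset_closure (Or.inl ⟨_, rfl⟩)
  intro hmem
  obtain ⟨F, hF, hmem⟩ := exists_finset_index hmem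
  refine key (F.filter (i < ·)) (fun k hk => (Finset.mem_filter.1 hk).2)
    (Substructure.closure_mono (union_subset_union_right _ (image_mono fun k hk => ?_)) hmem)
  rcases lt_or_gt_of_ne (hF hk) with h1 | h1
  · exact Or.inl h1
  · exact Or.inr (Finset.mem_filter.2 ⟨hk, h1⟩)

end DSeq

section Existence

variable {E : Type u} [L.Structure E] {ι : Type} {I : Type u} [LinearOrder I]

/-- Iterated averages along a list of indices, the head of the list being outermost. -/
def iterAvg (D : Ultrafilter (ι → E)) (x₀ : ι → E) : List I → Ultrafilter (I → ι → E)
  | [] => pure fun _ => x₀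
  | i :: l => D.bind fun y => (iterAvg D x₀ l).map fun v => Function.update v i y

theorem eventually_iterAvg_cons {D : Ultrafilter (ι → E)} {x₀ : ι → E} {i : I} {l : List I}
    {P : (I → ι → E) → Prop} :
    (∀ᶠ v in (iterAvg D x₀ (i :: l) : Filter (I → ι → E)), P v) ↔
      ∀ᶠ y in (D : Filter (ι → E)), ∀ᶠ v in (iterAvg D x₀ l : Filter (I → ι → E)),
        P (Function.update v i y) := Iff.rfl

theorem eventually_iterAvg_filter {D : Ultrafilter (ι → E)} {x₀ : ι → E} (S : Finset I)
    (l : List I) {P : (I → ι → E) → Prop}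
    (hP : ∀ v v', (∀ i ∈ S, v i = v' i) → (P v ↔ P v')) :
    (∀ᶠ v in (iterAvg D x₀ l : Filter (I → ι → E)), P v) ↔
      ∀ᶠ v in (iterAvg D x₀ (l.filter (· ∈ S)) : Filter (I → ι → E)), P v := by
  induction l generalizing P with
  | nil => rfl
  | cons i l ih =>
    by_cases hi : i ∈ S
    · rw [List.filter_cons_of_pos (by simpa using hi), eventually_iterAvg_cons,
        eventually_iterAvg_cons]
      refine eventually_congr (Eventually.of_forall fun y => ih fun v v' h => hP _ _ ?_)
      intro j hj
      by_cases hji : j = i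
      · subst hji; simp
      · simp [hji, h j hj]
    · rw [List.filter_cons_of_neg (by simpa using hi), eventually_iterAvg_cons, ← ih hP]
      rw [← eventually_const (f := (D : Filter (ι → E)))
        (p := ∀ᶠ v in (iterAvg D x₀ l : Filter (I → ι → E)), P v)]
      refine eventually_congr (Eventually.of_forall fun y =>
        eventually_congr (Eventually.of_forall fun v => hP _ _ ?_))
      intro j hj
      have : j ≠ i := fun h => hi (h ▸ hj)
      simp [this]

theorem eventually_iterAvg_sort {D : Ultrafilter (ι → E)} {x₀ : ι → E} {S S' : Finset I}
    (hS : S ⊆ S') {P : (I → ι → E) → Prop}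
    (hP : ∀ v v', (∀ i ∈ S, v i = v' i) → (P v ↔ P v')) :
    (∀ᶠ v in (iterAvg D x₀ (S'.sort (· ≥ ·)) : Filter (I → ι → E)), P v) ↔
      ∀ᶠ v in (iterAvg D x₀ (S.sort (· ≥ ·)) : Filter (I → ι → E)), P v := by
  rw [eventually_iterAvg_filter S _ hP]
  have : (S'.sort (· ≥ ·)).filter (· ∈ S) = S.sort (· ≥ ·) := by
    have h1 : ((S'.sort (· ≥ ·)).filter (· ∈ S)).toFinset = S := by
      ext i
      simp only [List.mem_toFinset, List.mem_filter, Finset.mem_sort, decide_eq_true_eq]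
      exact ⟨fun h => h.2, fun h => ⟨hS h, h⟩⟩
    have h2 := (List.toFinset_sort (· ≥ ·) (((S'.sort_nodup (· ≥ ·)).filter
      (fun i => decide (i ∈ S))))).2 ((S'.pairwise_sort (· ≥ ·)).filter _)
    rw [← h2, h1]
  rw [this]

theorem exists_dseq (D : Ultrafilter (ι → E)) [Nonempty E] (I : Type u) [LinearOrder I] :
    ∃ (M : Type u) (_ : L.Structure M) (f : E → M) (J : I → ι → M),
      EqT L id f ∧ DSeq L f D J := by
  obtain ⟨x₀, -⟩ := D.nonempty_of_mem univ_mem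
  let U : Finset I → Ultrafilter (I → ι → E) := fun S => iterAvg D x₀ (S.sort (· ≥ ·))
  obtain ⟨M, _, f, v, hf, hv⟩ := exists_elementary_realization (L := L) (E := E) (α := I × ι)
    {φ | ∀ᶠ S in atTop, ∀ᶠ v in (U S : Filter (I → ι → E)),
      φ.Realize (Sum.elim id (Function.uncurry v))} (fun s hs => by
        have h1 : ∀ᶠ S in atTop, ∀ φ ∈ s, ∀ᶠ v in (U S : Filter (I → ι → E)),
            φ.Realize (Sum.elim id (Function.uncurry v)) :=
          (Filter.eventually_all_finset s).2 fun φ hφ => hs hφ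
        obtain ⟨S, hS⟩ := h1.exists
        obtain ⟨v, hv⟩ := ((Filter.eventually_all_finset s).2 hS).exists
        exact ⟨Function.uncurry v, hv⟩)
  have key : ∀ (ψ : L.Formula (E ⊕ (I × ι))) (S : Finset I),
      (∀ v v' : I → ι → E, (∀ i ∈ S, v i = v' i) →
        (ψ.Realize (Sum.elim id (Function.uncurry v)) ↔
          ψ.Realize (Sum.elim id (Function.uncurry v')))) →
      (ψ.Realize (Sum.elim f v) ↔ ∀ᶠ v in (U S : Filter (I → ι → E)),
        ψ.Realize (Sum.elim id (Function.uncurry v))) := by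
    have aux : ∀ (ψ : L.Formula (E ⊕ (I × ι))) (S : Finset I),
      (∀ v v' : I → ι → E, (∀ i ∈ S, v i = v' i) →
        (ψ.Realize (Sum.elim id (Function.uncurry v)) ↔
          ψ.Realize (Sum.elim id (Function.uncurry v')))) →
      (∀ᶠ v in (U S : Filter (I → ι → E)),
        ψ.Realize (Sum.elim id (Function.uncurry v))) → ψ.Realize (Sum.elim f v) := by
      intro ψ S hS h
      refine hv ψ ((eventually_ge_atTop S).mono fun S' hS' => ?_)
      exact (eventually_iterAvg_sort hS' hS).2 h
    intro ψ S hS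
    refine ⟨fun h => ?_, aux ψ S hS⟩
    by_contra hn
    have := aux ψ.not S (fun v v' hvv => by simp [hS v v' hvv])
      (by simpa using Ultrafilter.eventually_not.2 hn)
    exact this h
  refine ⟨M, inferInstance, f, Function.curry v, hf, fun i => ?_⟩
  refine Avg.of_family (Sum.elim f fun p : Iio i × ι => v (p.1, p.2)) ?_ fun φ => ?_
  · rintro m (⟨x, rfl⟩ | hm)
    · exact ⟨Sum.inl x, rfl⟩
    · simp only [mem_iUnion] at hm
      obtain ⟨j, hj, k, rfl⟩ := hm
      exact ⟨Sum.inr (⟨j, hj⟩, k), rfl⟩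
  · let r : (E ⊕ (Iio i × ι)) ⊕ ι → E ⊕ (I × ι) :=
      Sum.elim (Sum.map id fun p => (p.1, p.2)) fun k => Sum.inr (i, k)
    have hr : ∀ {P : Type u} (x : E → P) (w : I → ι → P),
        Sum.elim x (Function.uncurry w) ∘ r =
          Sum.elim (Sum.elim x fun p : Iio i × ι => w p.1 p.2) (w i) := by
      intro P x w
      funext k
      rcases k with (k | k) | k <;> rfl
    obtain ⟨F, ψ, hψ⟩ := exists_finset_formula_index (φ.relabel r)
    have h1 : φ.Realize (Sum.elim (Sum.elim f fun p : Iio i × ι => v (p.1, p.2))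
        (Function.curry v i)) ↔ (φ.relabel r).Realize (Sum.elim f v) := by
      rw [Formula.realize_relabel, ← Function.uncurry_curry v, hr]
      rfl
    set F' := F.filter (· < i)
    have hdep : ∀ v v' : I → ι → E, (∀ j ∈ insert i F', v j = v' j) →
        ((φ.relabel r).Realize (Sum.elim id (Function.uncurry v)) ↔
          (φ.relabel r).Realize (Sum.elim id (Function.uncurry v'))) := by
      intro v v' hvv
      let w : (I → ι → E) → I → ι → E := fun v j => if j ≤ i then v j else x₀
      have hw : ∀ v, (φ.relabel r).Realize (Sum.elim id (Function.uncurry v)) ↔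
          (φ.relabel r).Realize (Sum.elim id (Function.uncurry (w v))) := by
        intro v
        rw [Formula.realize_relabel, Formula.realize_relabel, hr, hr]
        have e1 : (fun p : Iio i × ι => w v p.1 p.2) = fun p : Iio i × ι => v p.1 p.2 := by
          funext p
          have := (mem_Iio.1 p.1.2).le
          simp [w, this]
        have e2 : w v i = v i := by simp [w]
        rw [e1, e2]
      rw [hw, hw v', hψ, hψ]
      congr! 2
      funext p
      simp only [w]
      split_ifs with hle
      · rcases hle.lt_or_eq with hlt | heq
        · rw [hvv p.1 (Finset.mem_insert_of_mem (Finset.mem_filter.2 ⟨p.1.2, hlt⟩))]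
        · rw [heq, hvv i (Finset.mem_insert_self _ _)]
      · rfl
    rw [h1, key _ _ hdep]
    have hsort : (insert i F').sort (· ≥ ·) = i :: F'.sort (· ≥ ·) :=
      Finset.sort_insert (r := (· ≥ ·)) (fun b hb => (Finset.mem_filter.1 hb).2.le)
        (fun h => lt_irrefl _ (Finset.mem_filter.1 h).2)
    simp only [U, hsort]
    rw [eventually_iterAvg_cons]
    refine eventually_congr (Eventually.of_forall fun y => ?_)
    let r' : (E ⊕ (Iio i × ι)) ⊕ ι → E ⊕ (I × ι) :=
      Sum.elim (Sum.map id fun p => (p.1, p.2)) fun k => Sum.inl (y k)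
    have hr' : ∀ {P : Type u} (x : E → P) (w : I → ι → P),
        Sum.elim x (Function.uncurry w) ∘ r' =
          Sum.elim (Sum.elim x fun p : Iio i × ι => w p.1 p.2) (x ∘ y) := by
      intro P x w
      funext k
      rcases k with (k | k) | k <;> rfl
    have hrr : ∀ w : I → ι → E, (φ.relabel r).Realize
        (Sum.elim id (Function.uncurry (Function.update w i y))) ↔
        (φ.relabel r').Realize (Sum.elim id (Function.uncurry w)) := by
      intro w
      rw [Formula.realize_relabel, Formula.realize_relabel, hr, hr']
      have e1 : (fun p : Iio i × ι => Function.update w i y p.1 p.2) =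
          fun p : Iio i × ι => w p.1 p.2 := by
        funext p
        have : (p.1 : I) ≠ i := (mem_Iio.1 p.1.2).ne
        simp [this]
      rw [e1, Function.update_self]
      rfl
    have h2 : φ.Realize (Sum.elim (Sum.elim f fun p : Iio i × ι => v (p.1, p.2)) (f ∘ y)) ↔
        (φ.relabel r').Realize (Sum.elim f v) := by
      rw [Formula.realize_relabel, ← Function.uncurry_curry v, hr']
      rfl
    rw [h2, key _ F']
    · simp only [hrr]
      rfl
    · intro w w' hww
      rw [← hrr, ← hrr]
      refine hdep _ _ fun j hj => ?_
      by_cases hji : j = i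
      · subst hji; simp
      · simp [hji, hww j ((Finset.mem_insert.1 hj).resolve_left hji)]

end Existence

theorem mk_iUnion_finset_lt {W I : Type u} (F : W → Finset I) {κ : Cardinal.{u}} (hκ : ℵ₀ < κ)
    (hW : #W < κ) : #(⋃ w, (F w : Set I)) < κ := by
  refine (mk_iUnion_le _).trans_lt (mul_lt_of_lt hκ.le hW ?_)
  refine lt_of_le_of_lt (ciSup_le' fun w => ?_) hκ
  exact (Cardinal.lt_aleph0_of_finite (F w)).le

theorem strictlyGenerated_of {M : Type u} [L.Structure M] {κ : Cardinal.{u}} (X : Set M)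
    (hX : #X = κ)
    (h : ∀ W : Set M, W ⊆ Substructure.closure L X → #W < κ → ¬ X ⊆ Substructure.closure L W) :
    StrictlyGenerated L (Substructure.closure L X) κ := by
  have hval : ∀ W : Set (Substructure.closure L X),
      (Substructure.closure L W).map (Substructure.subtype _).toHom =
        Substructure.closure L (Subtype.val '' W) := fun W => by
    rw [← Substructure.closure_image]
    rfl
  have himg : Subtype.val '' (Subtype.val ⁻¹' X : Set (Substructure.closure L X)) = X :=
    image_preimage_eq_of_subset fun x hx => ⟨⟨x, Substructure.subset_closure hx⟩, rfl⟩
  constructor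
  · refine ⟨Subtype.val ⁻¹' X, ?_, ?_⟩
    · rw [← hX, ← mk_image_eq (s := Subtype.val ⁻¹' X) Subtype.val_injective, himg]
    · refine eq_top_iff.2 fun x _ => ?_
      have := hval (Subtype.val ⁻¹' X)
      rw [himg] at this
      have hx : (x : M) ∈ (Substructure.closure L (Subtype.val ⁻¹' X)).map
          (Substructure.subtype (Substructure.closure L X)).toHom := by
        rw [this]; exact x.2
      obtain ⟨y, hy, hxy⟩ := Substructure.mem_map.1 hx
      rwa [Subtype.ext (a1 := x) (a2 := y) hxy.symm]
  · rintro ν hν ⟨W, hW, hg⟩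
    refine h (Subtype.val '' W) ?_ ?_ ?_
    · rintro _ ⟨w, -, rfl⟩
      exact w.2
    · rw [mk_image_eq Subtype.val_injective, hW]
      exact hν
    · intro x hx
      have hx' : (⟨x, Substructure.subset_closure hx⟩ : Substructure.closure L X) ∈
        Substructure.closure L W := by
          rw [show Substructure.closure L W = ⊤ from hg]; trivial
      rw [SetLike.mem_coe, ← hval]
      exact Substructure.mem_map.2 ⟨_, hx', rfl⟩

theorem exists_finset_of_mem_closure_union {M : Type u} [L.Structure M] {I : Type*}
    {Z : Set M} {J : I → M} {m : M} (h : m ∈ Substructure.closure L (Z ∪ range J)) :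
    ∃ F : Finset I, m ∈ Substructure.closure L (Z ∪ J '' F) := by
  rw [← image_univ] at h
  obtain ⟨F, -, hF⟩ := exists_finset_index h
  exact ⟨F, hF⟩

theorem DSeq.strictlyGenerated {β M : Type u} [L.Structure M] {I : Type u} [LinearOrder I]
    {e : β → M} {D : Ultrafilter (Unit → β)} {J : I → Unit → M}
    (h : DSeq L e D J) (he : Function.Injective e)
    (hD : ∀ a, ∀ᶠ x in (D : Filter (Unit → β)), x () ≠ a) {κ : Cardinal.{u}} (hκ : ℵ₀ < κ)
    {Z : Set M} (hZ : Z ⊆ range e) (hZκ : #Z ≤ κ) (hI : #I = κ) :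
    StrictlyGenerated L (Substructure.closure L (Z ∪ range fun i => J i ())) κ := by
  have hind := h.notMem_closure he hD
  have hinj : Function.Injective fun i => J i () := fun i j hij => by
    by_contra hne
    exact hind i (Substructure.subset_closure (Or.inr ⟨j, fun h => hne h.symm, hij.symm⟩))
  refine strictlyGenerated_of _ ?_ fun W hW hWκ hX => ?_
  · apply le_antisymm
    · refine (mk_union_le _ _).trans (add_le_of_le hκ.le hZκ ?_)
      exact mk_range_le.trans hI.le
    · rw [← hI, ← mk_range_eq _ hinj]
      exact mk_le_mk_of_subset subset_union_right
  · choose F hF using fun w : W => exists_finset_of_mem_closure_union (hW w.2)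
    have hlt := mk_iUnion_finset_lt F hκ hWκ
    obtain ⟨i, hi⟩ : ∃ i, i ∉ ⋃ w, (F w : Set I) := by
      by_contra! hcon
      rw [eq_univ_of_forall hcon, mk_univ, hI] at hlt
      exact hlt.false
    refine hind i ?_
    have h1 : J i () ∈ Substructure.closure L W := hX (Or.inr ⟨i, rfl⟩)
    refine Substructure.closure_le.2 (fun w hw => ?_) h1
    refine Substructure.closure_mono (union_subset_union hZ ?_) (hF ⟨w, hw⟩)
    refine image_mono fun k hk => ?_
    rintro rfl
    exact hi (mem_iUnion.2 ⟨_, hk⟩)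

theorem EqT.move {α γ ι : Type*} {M : Type u} [L.Structure M] {v w : α → M} (h : EqT L v w)
    {S₀ : Set α} (hS₀ : ∀ i ∈ S₀, v i = w i) (c : γ → M)
    (hc : ∀ k, c k ∈ Substructure.closure L (v '' S₀)) (b : ι → M)
    (hb : ∀ k, b k ∈ Substructure.closure L (range v)) :
    ∃ b' : ι → M, EqT L (Sum.elim c b) (Sum.elim c b') ∧
      ∀ i S, b i ∈ Substructure.closure L (v '' S) →
        b' i ∈ Substructure.closure L (w '' S) := by
  obtain ⟨t, ht⟩ := exists_terms (v '' S₀) (fun i : S₀ => v i)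
    (by rintro _ ⟨i, hi, rfl⟩; exact ⟨⟨i, hi⟩, rfl⟩) c hc
  obtain ⟨b', hb', hb'S⟩ := h.extend b hb
  refine ⟨b', fun φ => ?_, hb'S⟩
  have h1 := hb' (BoundedFormula.subst φ (Sum.elim
    (fun k => (t k).relabel fun j : S₀ => Sum.inl (j : α)) fun i => Term.var (Sum.inr i)))
  rw [realize_subst_formula, realize_subst_formula] at h1
  have e1 : ∀ (x : α → M) (y : ι → M), (∀ i : S₀, x i = v i) →
      (fun i => (Sum.elim (fun k => (t k).relabel fun j : S₀ => Sum.inl (j : α))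
      (fun i => Term.var (Sum.inr i)) i : L.Term (α ⊕ ι)).realize (Sum.elim x y)) =
      Sum.elim c y := fun x y hx => by
    funext i
    rcases i with i | i
    · simp only [Sum.elim_inl, Term.realize_relabel]
      rw [← ht i]
      congr 1
      funext k
      exact hx k
    · simp
  rwa [e1 _ _ fun _ => rfl, e1 _ _ fun i => (hS₀ i i.2).symm] at h1

theorem DSeq.eqT_move {β I : Type*} {M : Type u} [L.Structure M] [LinearOrder I] {ι : Type}
    {e : β → M} {D : Ultrafilter (ι → β)} {J : I → ι → M} (h : DSeq L e D J) {π : I → I}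
    {S : Set I} (hπ : StrictMonoOn π S) :
    EqT L (Sum.elim e (Function.uncurry fun s : S => J s))
      (Sum.elim e (Function.uncurry fun s : S => J (π s))) :=
  (h.comp (π := fun s : S => (s : I)) fun _ _ hst => hst).eqT
    (h.comp (π := fun s : S => π s) fun s t hst => hπ s.2 t.2 hst) (EqT.refl _)

section Blocks

variable {A : Type u} [LinearOrder A]

/-- The block to which an index belongs. -/
def block (i : Aᵒᵈ ×ₗ ℕ) : A := OrderDual.ofDual (ofLex i).1

/-- The position of an index in its block. -/
def posn (i : Aᵒᵈ ×ₗ ℕ) : ℕ := (ofLex i).2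

theorem index_lt_iff {i j : Aᵒᵈ ×ₗ ℕ} :
    i < j ↔ block j < block i ∨ block i = block j ∧ posn i < posn j := by
  rw [Prod.Lex.lt_iff]
  rfl

open Classical in
/-- Move the indices whose block is not in `Y` according to `τ`. -/
noncomputable def moveIndex (Y : Set A) (τ : A → A) (m : ℕ) (F : Finset (Aᵒᵈ ×ₗ ℕ))
    (i : Aᵒᵈ ×ₗ ℕ) : Aᵒᵈ ×ₗ ℕ :=
  if block i ∈ Y then i else
    toLex (OrderDual.toDual (τ (block i)), m + (F.filter (· < i)).card)

theorem strictMonoOn_moveIndex {Y : Set A} {τ : A → A} {m : ℕ} {F : Finset (Aᵒᵈ ×ₗ ℕ)}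
    {S : Set (Aᵒᵈ ×ₗ ℕ)} (h1 : ∀ a ∉ Y, ∀ b ∈ Y, a < b → τ a ≤ b)
    (h2 : ∀ a ∉ Y, ∀ b ∈ Y, b < a → b < τ a) (h3 : ∀ a ∉ Y, ∀ b ∉ Y, a ≤ b → τ a ≤ τ b)
    (hS : ∀ i ∈ S, block i ∈ Y → posn i < m ∨ ∀ a ∉ Y, τ a ≠ block i)
    (hF : ∀ i ∈ S, block i ∉ Y → i ∈ F) : StrictMonoOn (moveIndex Y τ m F) S := by
  classical
  intro i hi j hj hij
  unfold moveIndex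
  have hne : ∀ {a b : A}, a ∉ Y → b ∈ Y → a ≠ b := by
    rintro a _ ha hb rfl
    exact ha hb
  have hij' := index_lt_iff.1 hij
  split_ifs with hiY hjY hjY
  · exact hij
  · have hlt : block j < block i := hij'.resolve_right fun h => hne hjY hiY h.1.symm
    rw [index_lt_iff]
    rcases (h1 _ hjY _ hiY hlt).lt_or_eq with h | h
    · exact Or.inl h
    · refine Or.inr ⟨h.symm, ?_⟩
      rcases hS i hi hiY with h' | h'
      · exact Nat.lt_of_lt_of_le h' (Nat.le_add_right _ _)
      · exact absurd h (h' _ hjY)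
  · have hlt : block j < block i := hij'.resolve_right fun h => hne hiY hjY h.1
    exact index_lt_iff.2 (Or.inl (h2 _ hiY _ hjY hlt))
  · have hle : block j ≤ block i := hij'.elim le_of_lt fun h => h.1.ge
    rw [index_lt_iff]
    rcases (h3 _ hjY _ hiY hle).lt_or_eq with h | h
    · exact Or.inl h
    · refine Or.inr ⟨h.symm, ?_⟩
      refine Nat.add_lt_add_left (Finset.card_lt_card ?_) m
      rw [Finset.ssubset_iff_of_subset fun k hk => ?_]
      · exact ⟨i, Finset.mem_filter.2 ⟨hF i hi hiY, hij⟩, fun h => by simp at h⟩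
      · rw [Finset.mem_filter] at hk ⊢
        exact ⟨hk.1, hk.2.trans hij⟩

variable {β : Type*} {M : Type u} [L.Structure M] {e : β → M} {D : Ultrafilter (Unit → β)}
  {K : Aᵒᵈ ×ₗ ℕ → Unit → M}

/-- The union of the blocks with index in `Y`. -/
def blocks (K : Aᵒᵈ ×ₗ ℕ → Unit → M) (Y : Set A) : Set M :=
  (fun i => K i ()) '' {i | block i ∈ Y}

theorem DSeq.eqT_moveIndex (h : DSeq L e D K) {Y : Set A} {τ : A → A} {m : ℕ}
    {F : Finset (Aᵒᵈ ×ₗ ℕ)} {S : Set (Aᵒᵈ ×ₗ ℕ)} (hFS : ↑F ⊆ S)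
    (hπ : StrictMonoOn (moveIndex Y τ m F) S) {γ ι : Type*} (c : γ → M)
    (hc : ∀ k, c k ∈ Substructure.closure L
      (range e ∪ (fun i => K i ()) '' {i | i ∈ S ∧ block i ∈ Y})) (b : ι → M)
    (hb : ∀ k, b k ∈ Substructure.closure L (range e ∪ (fun i => K i ()) '' F)) :
    ∃ b' : ι → M, EqT L (Sum.elim c b) (Sum.elim c b') ∧
      ∀ k, b' k ∈ Substructure.closure L
        (range e ∪ (fun i => K (moveIndex Y τ m F i) ()) '' F) := by
  have key := (h.eqT_move hπ).move (S₀ := range Sum.inl ∪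
    Sum.inr '' {p : S × Unit | block (p.1 : Aᵒᵈ ×ₗ ℕ) ∈ Y}) ?_ c ?_ b ?_
  · obtain ⟨b', hb', hS⟩ := key
    refine ⟨b', hb', fun k => ?_⟩
    have h1 := hS k (range Sum.inl ∪ Sum.inr '' {p : S × Unit | (p.1 : Aᵒᵈ ×ₗ ℕ) ∈ F}) ?_
    · refine Substructure.closure_mono ?_ h1
      rintro _ ⟨_, ⟨x, rfl⟩ | ⟨⟨s, _⟩, hs, rfl⟩, rfl⟩
      · exact Or.inl ⟨x, rfl⟩
      · exact Or.inr ⟨s, hs, rfl⟩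
    · refine Substructure.closure_mono ?_ (hb k)
      rintro _ (⟨x, rfl⟩ | ⟨i, hi, rfl⟩)
      · exact ⟨Sum.inl x, Or.inl ⟨x, rfl⟩, rfl⟩
      · exact ⟨Sum.inr (⟨i, hFS hi⟩, ()), Or.inr ⟨_, hi, rfl⟩, rfl⟩
  · rintro _ (⟨x, rfl⟩ | ⟨⟨s, u⟩, hs, rfl⟩)
    · rfl
    · have hs' : block (s : Aᵒᵈ ×ₗ ℕ) ∈ Y := hs
      simp [Function.uncurry, moveIndex, hs']
  · intro k
    refine Substructure.closure_mono ?_ (hc k)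
    rintro _ (⟨x, rfl⟩ | ⟨i, hi, rfl⟩)
    · exact ⟨Sum.inl x, Or.inl ⟨x, rfl⟩, rfl⟩
    · exact ⟨Sum.inr (⟨i, hi.1⟩, ()), Or.inr ⟨_, hi.2, rfl⟩, rfl⟩
  · intro k
    refine Substructure.closure_mono ?_ (hb k)
    rintro _ (⟨x, rfl⟩ | ⟨i, hi, rfl⟩)
    · exact ⟨Sum.inl x, rfl⟩
    · exact ⟨Sum.inr (⟨i, hFS hi⟩, ()), rfl⟩

theorem exists_finset_of_forall_mem_closure {I ι : Type*} [Finite ι] {Z : Set M} {J : I → M}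
    {S : Set I} {b : ι → M} (h : ∀ k, b k ∈ Substructure.closure L (Z ∪ J '' S)) :
    ∃ F : Finset I, ↑F ⊆ S ∧ ∀ k, b k ∈ Substructure.closure L (Z ∪ J '' F) := by
  classical
  have := Fintype.ofFinite ι
  choose F hFS hF using fun k => exists_finset_index (h k)
  refine ⟨Finset.univ.biUnion F, ?_, fun k => ?_⟩
  · simpa using hFS
  · refine Substructure.closure_mono (union_subset_union_right _ (image_mono ?_)) (hF k)
    simpa using subset_iUnion (fun k => (F k : Set I)) k

variable [WellFoundedLT A] [OrderTop A]

theorem exists_ceil {Y : Set A} (hY : ⊤ ∈ Y) :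
    ∃ up : A → A, ∀ a, up a ∈ Y ∧ a ≤ up a ∧ ∀ b ∈ Y, a ≤ b → up a ≤ b := by
  have : ∀ a : A, ∃ c, c ∈ Y ∧ a ≤ c ∧ ∀ b ∈ Y, a ≤ b → c ≤ b := fun a => by
    obtain ⟨c, hc, hmin⟩ := (wellFounded_lt (α := A)).has_min {b | b ∈ Y ∧ a ≤ b}
      ⟨⊤, hY, le_top⟩
    exact ⟨c, hc.1, hc.2, fun b hb hab => not_lt.1 (hmin b ⟨hb, hab⟩)⟩
  choose up hup using this
  exact ⟨up, hup⟩

theorem DSeq.exists_finite_blocks (h : DSeq L e D K) {Y : Set A} (hY : ⊤ ∈ Y) {ι : Type*}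
    [Finite ι] (b : ι → M)
    (hb : ∀ k, b k ∈ Substructure.closure L (range e ∪ range fun i => K i ())) :
    ∃ G : Finset A, ↑G ⊆ Y ∧ ∀ {γ : Type u} (c : γ → M)
      (_ : ∀ k, c k ∈ Substructure.closure L (range e ∪ blocks K Y)) (φ : L.Formula (γ ⊕ ι)),
      φ.Realize (Sum.elim c b) → ∃ b' : ι → M,
        (∀ k, b' k ∈ Substructure.closure L (range e ∪ blocks K (G : Set A))) ∧
        φ.Realize (Sum.elim c b') := by
  classical
  obtain ⟨up, hup⟩ := exists_ceil hY
  replace hb : ∀ k, b k ∈ Substructure.closure L (range e ∪ (fun i => K i ()) '' Set.univ) := by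
    simpa only [image_univ] using hb
  obtain ⟨F, -, hF⟩ := exists_finset_of_forall_mem_closure hb
  refine ⟨F.image fun i => up (block i), ?_, fun {γ} c hc φ hφ => ?_⟩
  · intro x hx
    obtain ⟨i, -, rfl⟩ := Finset.mem_image.1 (Finset.mem_coe.1 hx)
    exact (hup _).1
  obtain ⟨s, ψ, hψ⟩ := exists_finset_formula φ
  set c' : ↥(s.preimage Sum.inl Sum.inl_injective.injOn : Finset γ) → M := fun k => c k
  obtain ⟨E, hEY, hE⟩ := exists_finset_of_forall_mem_closure (b := c') fun k => hc k
  obtain ⟨m, hm⟩ : ∃ m, ∀ i ∈ E ∪ F, posn i < m :=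
    ⟨(E ∪ F).sup posn + 1, fun i hi => Nat.lt_succ_of_le (Finset.le_sup hi)⟩
  have hmono : StrictMonoOn (moveIndex Y up m F) (E ∪ F : Finset _) := by
    refine strictMonoOn_moveIndex (fun a _ b hb hab => (hup a).2.2 b hb hab.le)
      (fun a _ b _ hab => hab.trans_le (hup a).2.1)
      (fun a _ b _ hab => (hup a).2.2 _ (hup b).1 (hab.trans (hup b).2.1))
      (fun i hi _ => Or.inl (hm i hi)) fun i hi hiY => ?_
    rcases Finset.mem_union.1 (Finset.mem_coe.1 hi) with hi | hi
    · exact absurd (hEY hi) hiY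
    · exact hi
  have hsub : (E : Set (Aᵒᵈ ×ₗ ℕ)) ⊆ {i | i ∈ ((E ∪ F : Finset _) : Set (Aᵒᵈ ×ₗ ℕ)) ∧
      block i ∈ Y} := fun i hi =>
    ⟨Finset.mem_coe.2 (Finset.mem_union_left _ (Finset.mem_coe.1 hi)), hEY hi⟩
  have hF' : (F : Set (Aᵒᵈ ×ₗ ℕ)) ⊆ ((E ∪ F : Finset _) : Set (Aᵒᵈ ×ₗ ℕ)) := fun i hi =>
    Finset.mem_coe.2 (Finset.mem_union_right _ (Finset.mem_coe.1 hi))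
  obtain ⟨b', hb', hb'F⟩ := h.eqT_moveIndex hF' hmono c' (fun k =>
    Substructure.closure_mono (union_subset_union_right _ (image_mono hsub)) (hE k)) b hF
  refine ⟨b', fun k => ?_, ?_⟩
  · refine Substructure.closure_mono (union_subset_union_right _ ?_) (hb'F k)
    rintro _ ⟨i, hi, rfl⟩
    refine ⟨_, ?_, rfl⟩
    rw [mem_ofPred_eq]
    refine Finset.mem_coe.2 (Finset.mem_image.2 ⟨i, hi, ?_⟩)
    unfold moveIndex
    split_ifs with hiY
    · exact le_antisymm ((hup _).2.2 _ hiY le_rfl) (hup _).2.1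
    · rfl
  · rw [hψ] at hφ ⊢
    have hs : ∀ i : s, ∃ j : ↥(s.preimage Sum.inl Sum.inl_injective.injOn : Finset γ) ⊕ ι,
        (i : γ ⊕ ι) = Sum.map Subtype.val id j := by
      rintro ⟨i | i, hi⟩
      · exact ⟨Sum.inl ⟨i, by simpa using hi⟩, rfl⟩
      · exact ⟨Sum.inr i, rfl⟩
    choose j hj using hs
    have e1 : ∀ x : ι → M, (fun i : s => Sum.elim c x i) = Sum.elim c' x ∘ j := fun x => by
      funext i
      rw [hj i, Function.comp_apply]
      rcases j i with k | k <;> rfl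
    rw [e1] at hφ ⊢
    exact (hb'.comp j ψ).1 hφ

theorem DSeq.exists_blocks (h : DSeq L e D K) {Y : Set A} (hY : ⊤ ∈ Y) (hYc : Y.Countable) :
    ∃ Y' : Set A, Y'.Countable ∧ ∀ {ι : Type} [Finite ι] (b : ι → M),
      (∀ k, b k ∈ Substructure.closure L (range e ∪ range fun i => K i ())) →
      ∃ b' : ι → M, (∀ k, b' k ∈ Substructure.closure L (range e ∪ blocks K Y')) ∧
        EqT L (Sum.elim (fun x : Substructure.closure L (range e ∪ blocks K Y) => (x : M)) b)
          (Sum.elim (fun x => (x : M)) b') := by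
  classical
  obtain ⟨up, hup⟩ := exists_ceil hY
  have : ∀ γ, ∃ a, (∃ a, a ∉ Y ∧ up a = γ) → a ∉ Y ∧ up a = γ := fun γ => by
    by_cases hγ : ∃ a, a ∉ Y ∧ up a = γ
    · exact ⟨hγ.choose, fun _ => hγ.choose_spec⟩
    · exact ⟨γ, fun h => absurd h hγ⟩
  choose lo hlo using this
  replace hlo : ∀ a ∉ Y, lo (up a) ∉ Y ∧ up (lo (up a)) = up a := fun a ha =>
    hlo _ ⟨a, ha, rfl⟩
  refine ⟨Y ∪ lo '' Y, hYc.union (hYc.image _), fun {ι} _ b hb => ?_⟩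
  replace hb : ∀ k, b k ∈ Substructure.closure L (range e ∪ (fun i => K i ()) '' Set.univ) := by
    simpa only [image_univ] using hb
  obtain ⟨F, -, hF⟩ := exists_finset_of_forall_mem_closure hb
  have hmono : StrictMonoOn (moveIndex Y (lo ∘ up) 0 F) ({i | block i ∈ Y} ∪ F) := by
    refine strictMonoOn_moveIndex (fun a ha b hb hab => ?_) (fun a ha b hb hab => ?_)
      (fun a ha b hb hab => ?_) (fun i hi hiY => Or.inr fun a ha hai => ?_) fun i hi hiY => ?_
    · refine le_trans ?_ ((hup a).2.2 b hb hab.le)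
      have := (hup (lo (up a))).2.1
      rwa [(hlo a ha).2] at this
    · refine lt_of_not_ge fun hle => ?_
      have := (hup (lo (up a))).2.2 b hb hle
      rw [(hlo a ha).2] at this
      exact absurd ((hup a).2.1.trans this) (not_le.2 hab)
    · have hle : up a ≤ up b := (hup a).2.2 _ (hup b).1 (hab.trans (hup b).2.1)
      rcases hle.eq_or_lt with heq | hlt
      · simp only [Function.comp_apply, heq, le_refl]
      · refine le_of_not_gt fun hlt' => ?_
        have h1 := (hup (lo (up a))).2.1
        rw [(hlo a ha).2] at h1
        have h2 := (hup (lo (up b))).2.2 _ (hup a).1 (hlt'.le.trans h1)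
        rw [(hlo b hb).2] at h2
        exact absurd hlt (not_lt.2 h2)
    · exact (hlo a ha).1 (by rw [Function.comp_apply] at hai; rwa [hai])
    · exact hi.resolve_left hiY
  obtain ⟨b', hb', hb'F⟩ := h.eqT_moveIndex (subset_union_right) hmono
    (fun x : Substructure.closure L (range e ∪ blocks K Y) => (x : M)) (fun x =>
      Substructure.closure_mono (union_subset_union_right _ (image_mono
        fun i (hi : block i ∈ Y) => show _ ∧ _ from ⟨Or.inl hi, hi⟩)) x.2) b hF
  refine ⟨b', fun k => Substructure.closure_mono (union_subset_union_right _ ?_) (hb'F k), hb'⟩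
  rintro _ ⟨i, hi, rfl⟩
  refine ⟨_, ?_, rfl⟩
  rw [mem_ofPred_eq]
  unfold moveIndex
  split_ifs with hiY
  · exact Or.inl hiY
  · exact Or.inr ⟨_, (hup _).1, rfl⟩

end Blocks

section Transfer

variable {M N : Type u} [L.Structure M] [L.Structure N]

theorem mem_closure_preimage {S : L.Substructure M} {X : Set M} (hX : X ⊆ S) {x : S}
    (hx : (x : M) ∈ Substructure.closure L X) :
    x ∈ Substructure.closure L (Subtype.val ⁻¹' X : Set S) := by
  have himg : Subtype.val '' (Subtype.val ⁻¹' X : Set S) = X :=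
    image_preimage_eq_of_subset fun x hx => ⟨⟨x, hX hx⟩, rfl⟩
  have h1 : (Substructure.closure L (Subtype.val ⁻¹' X : Set S)).map S.subtype.toHom =
      Substructure.closure L X := by
    rw [← Substructure.closure_image]
    exact congrArg _ himg
  rw [← h1] at hx
  obtain ⟨y, hy, hxy⟩ := Substructure.mem_map.1 hx
  rwa [Subtype.ext (a1 := x) (a2 := y) hxy.symm]

theorem embedding_mem_closure {S : L.Substructure M} (p : S ↪[L] N) {X : Set M} (hX : X ⊆ S)
    {x : S} (hx : (x : M) ∈ Substructure.closure L X) {Y : Set N}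
    (hY : ∀ y : S, (y : M) ∈ X → p y ∈ Substructure.closure L Y) :
    p x ∈ Substructure.closure L Y := by
  have h1 : p x ∈ (Substructure.closure L (Subtype.val ⁻¹' X : Set S)).map p.toHom :=
    Substructure.mem_map.2 ⟨x, mem_closure_preimage hX hx, rfl⟩
  rw [← Substructure.closure_image] at h1
  refine Substructure.closure_le.2 ?_ h1
  rintro _ ⟨y, hy, rfl⟩
  exact hY y hy

theorem closure_image_eq {f : M → N} (hf : EqT L id f) (X : Set M) :
    f '' (Substructure.closure L X) = (Substructure.closure L (f '' X) : Set N) := by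
  have := Substructure.closure_image (s := X) hf.toEmbedding.toHom
  have h2 : Substructure.closure L (f '' X) =
    Substructure.map hf.toEmbedding.toHom (Substructure.closure L X) := this
  rw [h2]
  rfl

theorem mem_closure_image_iff {f : M → N} (hf : EqT L id f) {X : Set M} {x : M} :
    f x ∈ Substructure.closure L (f '' X) ↔ x ∈ Substructure.closure L X := by
  rw [← SetLike.mem_coe, ← closure_image_eq hf,
    Function.Injective.mem_set_image (hf.injective Function.injective_id)]
  rfl

variable {β I : Type*} [LinearOrder I] {ι : Type}

theorem DSeq.exists_base_closure {f : M → N} (hf : EqT L id f) {D : Ultrafilter (ι → M)}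
    {J : I → ι → N} (h : DSeq L f D J) {Z : Set M}
    (hD : {x : ι → M | ∀ k, x k ∈ Substructure.closure L Z} ∈ D) {γ ι' : Type*} (c : γ → M)
    (x : ι' → N)
    (hx : ∀ k, x k ∈ Substructure.closure L (f '' Z ∪ range (Function.uncurry J)))
    (φ : L.Formula (γ ⊕ ι')) (hφ : φ.Realize (Sum.elim (f ∘ c) x)) :
    ∃ y : ι' → M, (∀ k, y k ∈ Substructure.closure L Z) ∧ φ.Realize (Sum.elim c y) := by
  obtain ⟨t, ht⟩ := exists_terms _ (Sum.elim (fun z : Z => f z) (Function.uncurry J))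
    (by
      rintro _ (⟨z, hz, rfl⟩ | ⟨i, rfl⟩)
      · exact ⟨Sum.inl ⟨z, hz⟩, rfl⟩
      · exact ⟨Sum.inr i, rfl⟩) x hx
  let s : γ ⊕ ι' → L.Term (M ⊕ (I × ι)) :=
    Sum.elim (fun k => Term.var (Sum.inl (c k))) fun k => (t k).relabel (Sum.map Subtype.val id)
  have key : ∀ (y : I × ι → N), (fun i => (s i).realize (Sum.elim f y)) =
      Sum.elim (f ∘ c) fun k => (t k).realize (Sum.elim (fun z : Z => f z) y) := fun y => by
    funext i
    rcases i with i | i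
    · simp [s]
    · simp only [s, Sum.elim_inr, Term.realize_relabel]
      congr 1
      funext k
      rcases k with k | k <;> rfl
  obtain ⟨z, hz, hz'⟩ := h.exists_base hD (BoundedFormula.subst φ s) (by
    rw [realize_subst_formula, key]
    simpa only [ht] using hφ)
  rw [realize_subst_formula, key] at hz'
  refine ⟨fun k => (t k).realize (Sum.elim (fun z : Z => (z : M)) (Function.uncurry z)),
    fun k => realize_mem_closure _ _ _ ?_, ?_⟩
  · rintro (⟨i, hi⟩ | ⟨i, j⟩)
    · exact Substructure.subset_closure hi
    · exact hz i j
  · refine (hf.comp (Sum.elim c _) φ).2 ?_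
    convert hz' using 1
    rw [Sum.comp_elim]
    congr 1
    funext k
    have := HomClass.realize_term hf.toEmbedding (t := t k)
      (v := Sum.elim (fun z : Z => (z : M)) (Function.uncurry z))
    rw [EqT.coe_toEmbedding] at this
    rw [Function.comp_apply, ← this]
    congr 1
    funext i
    rcases i with i | i <;> rfl

end Transfer

section Reflection

variable {T : L.Theory}

/-- Formulas that are preserved in both directions by embeddings between infinite models. -/
def Absolute (T : L.Theory) {α : Type*} (φ : L.Formula α) : Prop :=
  ∀ (M N : Type u) [L.Structure M] [L.Structure N] [Infinite M] [Infinite N],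
    M ⊨ T → N ⊨ T → ∀ (f : M ↪[L] N) (v : α → M), φ.Realize v ↔ φ.Realize (f ∘ v)

/-- The absolute formulas over `C` true of `b` are satisfied in `A`. -/
def FinSat (T : L.Theory) {M : Type u} [L.Structure M] (A C : Set M) {ι : Type}
    (b : ι → M) : Prop :=
  ∀ φ : L.Formula (C ⊕ ι), Absolute T φ → φ.Realize (Sum.elim (↑) b) →
    ∃ x : ι → M, (∀ i, x i ∈ A) ∧ φ.Realize (Sum.elim (↑) x)

variable {E : Type u} [L.Structure E]

/-- A nonprincipal ultrafilter on the set of unary tuples. -/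
noncomputable def nonprincipal (B : Type*) [Infinite B] : Ultrafilter (Unit → B) :=
  (hyperfilter B).map fun x _ => x

theorem nonprincipal_ne (B : Type*) [Infinite B] (a : B) :
    ∀ᶠ x in (nonprincipal B : Filter (Unit → B)), x () ≠ a := by
  change ∀ᶠ x in (hyperfilter B : Filter B), x ≠ a
  exact (hyperfilter_le_cofinite (Set.finite_singleton a).compl_mem_cofinite)

theorem closure_range_union {M : Type u} [L.Structure M] {Z : Set E}
    {e : Substructure.closure L Z → M} (he : EqT L id e) (B : Set M) :
    Substructure.closure L (range e ∪ B) =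
      Substructure.closure L (e '' (Subtype.val ⁻¹' Z) ∪ B) := by
  apply le_antisymm
  · refine Substructure.closure_le.2 ?_
    rintro x (⟨c, rfl⟩ | hx)
    · refine Substructure.closure_mono subset_union_left ((mem_closure_image_iff he).2 ?_)
      exact mem_closure_preimage Substructure.subset_closure c.2
    · exact Substructure.subset_closure (Or.inr hx)
  · exact Substructure.closure_mono (union_subset_union_left _ (image_subset_range _ _))

theorem exists_strictlyGenerated_blocks {κ : Cardinal.{u}} (hκ : ℵ₀ < κ) {Z : Set E}
    (hZ : #Z ≤ κ) [Infinite (Substructure.closure L Z)] :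
    ∃ (M₁ : Type u) (_ : L.Structure M₁) (e : Substructure.closure L Z → M₁)
      (D₁ : Ultrafilter (Unit → Substructure.closure L Z))
      (K : (WithTop κ.ord.ToType)ᵒᵈ ×ₗ ℕ → Unit → M₁), EqT L id e ∧ DSeq L e D₁ K ∧
      StrictlyGenerated L (Substructure.closure L (range e ∪ range fun i => K i ())) κ := by
  obtain ⟨M₁, _, e, K, he, hK⟩ := exists_dseq (L := L) (nonprincipal (Substructure.closure L Z))
    ((WithTop κ.ord.ToType)ᵒᵈ ×ₗ ℕ)
  refine ⟨M₁, _, e, _, K, he, hK, ?_⟩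
  have hcard : #((WithTop κ.ord.ToType)ᵒᵈ ×ₗ ℕ) = κ := by
    have h1 : #((WithTop κ.ord.ToType)ᵒᵈ ×ₗ ℕ) = #(Option κ.ord.ToType × ℕ) := rfl
    rw [h1, mk_prod, mk_option, mk_ord_toType, lift_uzero, mk_nat, lift_aleph0,
      add_one_eq hκ.le, mul_aleph0_eq hκ.le]
  rw [closure_range_union he]
  refine hK.strictlyGenerated (he.injective Function.injective_id) (nonprincipal_ne _) hκ
    (image_subset_range _ _) ?_ hcard
  exact mk_image_le.trans ((mk_preimage_of_injective _ _ Subtype.val_injective).trans hZ)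

theorem exists_reflection (hT : IsUniversalTheory T) {κ : Cardinal.{u}} (hκ : ℵ₀ < κ)
    (hTκ : KUnique T κ) (hE : E ⊨ T) {Z W : Set E} (hZ : #Z ≤ κ)
    [Infinite (Substructure.closure L Z)] (hW : #W ≤ κ) :
    ∃ (M : Type u) (_ : L.Structure M) (f : E → M) (D : Ultrafilter (Unit → E))
      (J : κ.ord.ToType → Unit → M) (M₁ : Type u) (_ : L.Structure M₁)
      (e : Substructure.closure L Z → M₁) (D₁ : Ultrafilter (Unit → Substructure.closure L Z))
      (K : (WithTop κ.ord.ToType)ᵒᵈ ×ₗ ℕ → Unit → M₁),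
      EqT L id f ∧ DSeq L f D J ∧ {x : Unit → E | ∀ k, x k ∈ Substructure.closure L Z} ∈ D ∧
      EqT L id e ∧ DSeq L e D₁ K ∧ M ⊨ T ∧ M₁ ⊨ T ∧
      Nonempty (Substructure.closure L (f '' W ∪ range fun i => J i ()) ≃[L]
        Substructure.closure L (range e ∪ range fun i => K i ())) := by
  set C := Substructure.closure L Z with hC
  let D₁ := nonprincipal C
  have hD₁ := nonprincipal_ne C
  have : Nonempty E := ⟨((Classical.arbitrary C : C) : E)⟩
  obtain ⟨M, _, f, J, hf, hJ⟩ := exists_dseq (L := L) (D₁.map ((Subtype.val : C → E) ∘ ·))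
    κ.ord.ToType
  obtain ⟨M₁, _, e, D₂, K, he, hK, hKs⟩ := exists_strictlyGenerated_blocks (L := L) hκ hZ
  have hM : M ⊨ T := hf.models hE
  have hM₁ : M₁ ⊨ T := he.models (models_of_embedding hT C.subtype hE)
  refine ⟨M, _, f, _, J, M₁, _, e, D₂, K, hf, hJ, ?_, he, hK, hM, hM₁, ?_⟩
  · rw [Ultrafilter.mem_map]
    exact Filter.univ_mem' fun x k => (x k).2
  have hfi := hf.injective Function.injective_id
  refine hTκ.2 _ _ _ _ (models_of_embedding hT (Substructure.subtype _) hM)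
    (models_of_embedding hT (Substructure.subtype _) hM₁) ?_ hKs
  · refine hJ.strictlyGenerated hfi (fun a => ?_) hκ (image_subset_range _ _)
      (mk_image_le.trans hW) (mk_ord_toType κ)
    change ∀ᶠ x in (D₁ : Filter (Unit → C)), (x () : E) ≠ a
    by_cases ha : a ∈ C
    · filter_upwards [hD₁ ⟨a, ha⟩] with x hx hxa
      exact hx (Subtype.ext hxa)
    · exact Filter.Eventually.of_forall fun x hx => ha (hx ▸ (x ()).2)

end Reflection

section SuccType

/-- A well-order of order type the successor of the infinite cardinal `θ`. -/
structure IsSuccType (θ : Cardinal.{u}) (Ω : Type u) [LinearOrder Ω] : Prop where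
  aleph0_le : ℵ₀ ≤ θ
  wf : WellFoundedLT Ω
  mk_Iio_le : ∀ a : Ω, #(Iio a) ≤ θ
  mk_eq : #Ω = Order.succ θ

theorem exists_isSuccType {θ : Cardinal.{u}} (hθ : ℵ₀ ≤ θ) :
    ∃ (Ω : Type u) (_ : LinearOrder Ω), IsSuccType θ Ω := by
  refine ⟨(Order.succ θ).ord.ToType, inferInstance, hθ, inferInstance, fun a => ?_,
    mk_ord_toType _⟩
  have h1 : #(Iio a) < Order.succ θ := (mk_Iio_lt a (by simp)).trans_eq (mk_ord_toType _)
  exact Order.lt_succ_iff.1 h1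

variable {Ω : Type u} [LinearOrder Ω]

theorem IsSuccType.mk_biUnion_le {θ : Cardinal.{u}} {Ω : Type u} [LinearOrder Ω]
    (h : IsSuccType θ Ω) {α β : Type u} {S : Set α} (hS : #S ≤ θ) {F : α → Set β}
    (hF : ∀ a ∈ S, #(F a) ≤ θ) : #(⋃ a ∈ S, F a : Set β) ≤ θ := by
  refine (Cardinal.mk_biUnion_le F S).trans (mul_le_of_le h.aleph0_le hS
    (ciSup_le' fun a => hF a a.2))

theorem IsSuccType.mk_union_le {θ : Cardinal.{u}} {Ω : Type u} [LinearOrder Ω]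
    (h : IsSuccType θ Ω) {β : Type u} {S S' : Set β} (hS : #S ≤ θ) (hS' : #S' ≤ θ) :
    #(S ∪ S' : Set β) ≤ θ :=
  (Cardinal.mk_union_le _ _).trans (add_le_of_le h.aleph0_le hS hS')

theorem IsSuccType.mk_le_of_countable {θ : Cardinal.{u}} {Ω : Type u} [LinearOrder Ω]
    (h : IsSuccType θ Ω) {β : Type u} {S : Set β} (hS : S.Countable) : #S ≤ θ :=
  (le_aleph0_iff_set_countable.2 hS).trans h.aleph0_le

theorem IsSuccType.mk_Iic_le {θ : Cardinal.{u}} (h : IsSuccType θ Ω) (a : Ω) :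
    #(Iic a) ≤ θ := by
  rw [← Iio_insert, insert_eq]
  exact h.mk_union_le (h.mk_le_of_countable (countable_singleton a)) (h.mk_Iio_le a)

theorem IsSuccType.exists_gt {θ : Cardinal.{u}} (h : IsSuccType θ Ω) {S : Set Ω} (hS : #S ≤ θ) :
    ∃ d, ∀ s ∈ S, s < d := by
  by_contra! hcon
  have h1 : (⋃ s ∈ S, Iic s) = Set.univ := eq_univ_of_forall fun d => by
    obtain ⟨s, hs, hds⟩ := hcon d
    exact mem_biUnion hs hds
  have h2 : #(⋃ s ∈ S, Iic s) ≤ θ := h.mk_biUnion_le hS fun s _ => h.mk_Iic_le s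
  rw [h1, mk_univ, h.mk_eq] at h2
  exact absurd h2 (not_le.2 (Order.lt_succ θ))

/-- `d` is the limit of a strictly increasing sequence. -/
def HasLadder (d : Ω) (η : ℕ → Ω) : Prop :=
  StrictMono η ∧ (∀ n, η n < d) ∧ ∀ a < d, ∃ n, a < η n

theorem IsSuccType.exists_ladder {θ : Cardinal.{u}} (h : IsSuccType θ Ω) (g : Ω → Ω)
    (hg : ∀ a, a < g a) (a₀ : Ω) :
    ∃ d, a₀ < d ∧ HasLadder d fun n => g^[n] a₀ := by
  have := h.wf
  have hmono : StrictMono fun n => g^[n] a₀ := strictMono_nat_of_lt_succ fun n => by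
    rw [Function.iterate_succ_apply']
    exact hg _
  obtain ⟨d₁, hd₁⟩ := h.exists_gt (h.mk_le_of_countable
    (countable_range fun n => g^[n] a₀))
  obtain ⟨d, hd, hmin⟩ := (wellFounded_lt (α := Ω)).has_min {d | ∀ n, g^[n] a₀ < d}
    ⟨d₁, fun n => hd₁ _ ⟨n, rfl⟩⟩
  refine ⟨d, hd 0, hmono, hd, fun a ha => ?_⟩
  by_contra! hcon
  refine hmin a (fun n => ?_) ha
  exact lt_of_lt_of_le (hmono (Nat.lt_succ_self n)) (hcon (n + 1))

end SuccType

section Stages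

variable {Ω : Type u} [LinearOrder Ω] {E : Type u} [L.Structure E]

/-- The elements available before stage `a`. -/
def stage (Z : Set E) (B : Ω → Set E) (a : Ω) : Set E := Z ∪ ⋃ b < a, B b

theorem stage_mono (Z : Set E) (B : Ω → Set E) : Monotone (stage Z B) := fun _ _ h =>
  union_subset_union_right _ (iUnion_mono fun _ => iUnion_mono' fun hb => ⟨hb.trans_le h, le_rfl⟩)

variable {θ : Cardinal.{u}}

theorem mk_stage_le (hΩ : IsSuccType θ Ω) {Z : Set E} (hZ : #Z ≤ θ) {B : Ω → Set E}
    (hB : ∀ a, #(B a) ≤ θ) (a : Ω) : #(stage Z B a) ≤ θ :=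
  hΩ.mk_union_le hZ (hΩ.mk_biUnion_le (hΩ.mk_Iio_le a) fun b _ => hB b)

theorem exists_stage (hΩ : IsSuccType θ Ω) {Z : Set E} {B : Ω → Set E} {S : Set E}
    (hS : #S ≤ θ) (h : S ⊆ Z ∪ ⋃ b, B b) : ∃ a, S ⊆ stage Z B a := by
  have : ∀ s : S, ∃ b, (s : E) ∈ Z ∪ B b := fun s => by
    rcases h s.2 with hs | hs
    · obtain ⟨b, -⟩ := hΩ.exists_gt (hΩ.mk_le_of_countable countable_empty)
      exact ⟨b, Or.inl hs⟩
    · obtain ⟨b, hb⟩ := mem_iUnion.1 hs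
      exact ⟨b, Or.inr hb⟩
  choose b hb using this
  obtain ⟨a, ha⟩ := hΩ.exists_gt (mk_range_le.trans hS : #(range b) ≤ θ)
  refine ⟨a, fun s hs => ?_⟩
  rcases hb ⟨s, hs⟩ with h | h
  · exact Or.inl h
  · exact Or.inr (mem_biUnion (ha _ ⟨_, rfl⟩) h)

theorem mem_closure_stage {Z : Set E} {B : Ω → Set E} {d : Ω} {η : ℕ → Ω} (hη : HasLadder d η)
    {x : E} (hx : x ∈ Substructure.closure L (stage Z B d)) :
    ∃ n, x ∈ Substructure.closure L (stage Z B (η n)) := by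
  classical
  obtain ⟨F, hFZ, hF⟩ := exists_finset_of_mem_closure hx
  have : ∀ s ∈ F, ∃ n, s ∈ stage Z B (η n) := fun s hs => by
    rcases hFZ hs with h | h
    · exact ⟨0, Or.inl h⟩
    · obtain ⟨b, hb, h⟩ := mem_iUnion₂.1 h
      obtain ⟨n, hn⟩ := hη.2.2 b hb
      exact ⟨n, Or.inr (mem_biUnion hn h)⟩
  choose! n hn using this
  refine ⟨F.sup n, Substructure.closure_mono (fun s hs => ?_) hF⟩
  exact stage_mono Z B (hη.1.monotone (Finset.le_sup hs)) (hn s hs)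

variable {T : L.Theory}

theorem exists_finSat_stage (hT : IsUniversalTheory T) {κ : Cardinal.{u}} (hκ : ℵ₀ < κ)
    (hTκ : KUnique T κ) (hΩ : IsSuccType θ Ω) (hθκ : θ < κ) (hE : E ⊨ T) {Z : Set E}
    (hZ : #Z ≤ θ) [Infinite (Substructure.closure L Z)] {B : Ω → Set E} (hB : ∀ a, #(B a) ≤ θ)
    (u : Ω → Ω) (a₀ : Ω) :
    ∃ d, a₀ < d ∧ (∃ η, HasLadder d η) ∧ (∀ a < d, u a < d) ∧
      ∀ {ι : Type} [Finite ι] (b : ι → E),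
      (∀ k, b k ∈ Substructure.closure L (Z ∪ ⋃ a, B a)) → ∃ a < d,
        FinSat T (Substructure.closure L (stage Z B a) : Set E)
          (Substructure.closure L (stage Z B d)) b := by
  classical
  have hW : #(Z ∪ ⋃ a, B a : Set E) ≤ κ := by
    refine (Cardinal.mk_union_le _ _).trans (add_le_of_le hκ.le (hZ.trans hθκ.le) ?_)
    refine (mk_iUnion_le _).trans (mul_le_of_le hκ.le ?_ ?_)
    · rw [hΩ.mk_eq]
      exact Order.succ_le_of_lt hθκ
    · exact (ciSup_le' hB).trans hθκ.le
  obtain ⟨M, _, f, D, J, M₁, _, e, D₁, K, hf, hJ, hD, he, hK, hM, hM₁, ⟨h⟩⟩ :=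
    exists_reflection (W := Z ∪ ⋃ a, B a) hT hκ hTκ hE (hZ.trans hθκ.le) hW
  set W := Z ∪ ⋃ a, B a with hWdef
  set P := Substructure.closure L (f '' W ∪ range fun i => J i ()) with hP
  set Q := Substructure.closure L (range e ∪ range fun i => K i ()) with hQ
  have hfi := hf.injective Function.injective_id
  have hei := he.injective Function.injective_id
  have hfP : ∀ x ∈ Substructure.closure L W, f x ∈ P := fun x hx =>
    Substructure.closure_mono subset_union_left ((mem_closure_image_iff hf).2 hx)
  have : Infinite P := Infinite.of_injective
    (fun c : Substructure.closure L Z => (⟨f c, hfP _ (Substructure.closure_mono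
      subset_union_left c.2)⟩ : P))
    fun c c' hcc => Subtype.ext (hfi (Subtype.ext_iff.1 hcc))
  have : Infinite Q := h.toEquiv.infinite_iff.1 this
  have : Infinite M₁ := Infinite.of_injective _ hei
  have hPT : P ⊨ T := models_of_embedding hT P.subtype hM
  have hQT : Q ⊨ T := models_of_embedding hT Q.subtype hM₁
  have : Infinite E := Infinite.of_injective (fun c : Substructure.closure L Z => (c : E))
    Subtype.val_injective
  have : Infinite M := Infinite.of_injective _ hfi
  let p : P ↪[L] M₁ := Q.subtype.comp h.toEmbedding
  let q : Q ↪[L] M := P.subtype.comp h.symm.toEmbedding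
  have hqp : ∀ (x : P) (hx : p x ∈ Q), q ⟨p x, hx⟩ = x := fun x hx => by
    change ((h.symm (h x) : P) : M) = x
    rw [h.symm_apply_apply]
  have hpQ : ∀ x, p x ∈ Q := fun x => (h x).2
  have hWP : f '' W ⊆ P := fun x hx => Substructure.subset_closure (Or.inl hx)
  -- supports
  have hsupp : ∀ x : P, ∃ G : Finset (WithTop κ.ord.ToType), p x ∈
      Substructure.closure L (range e ∪ blocks K (G : Set (WithTop κ.ord.ToType))) := fun x => by
    have h1 := hpQ x
    rw [hQ] at h1
    obtain ⟨F, hF⟩ := exists_finset_of_mem_closure_union h1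
    refine ⟨F.image block, Substructure.closure_mono (union_subset_union_right _ ?_) hF⟩
    refine image_mono fun i hi => ?_
    simp only [Finset.coe_image]
    exact ⟨i, hi, rfl⟩
  choose G hG using hsupp
  let Y : Ω → Set (WithTop κ.ord.ToType) := fun a =>
    {⊤} ∪ ⋃ x ∈ {x : P | (x : M) ∈ f '' stage Z B a}, (G x : Set (WithTop κ.ord.ToType))
  have hYmono : Monotone Y := fun a a' haa => union_subset_union_right _
    (biUnion_subset_biUnion_left fun x hx => image_mono (stage_mono Z B haa) hx)
  have hYc : ∀ a, #(Y a) ≤ θ := fun a =>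
    hΩ.mk_union_le (hΩ.mk_le_of_countable (countable_singleton _)) (hΩ.mk_biUnion_le
      ((mk_preimage_of_injective _ _ Subtype.val_injective).trans
        (mk_image_le.trans (mk_stage_le hΩ hZ hB a)))
      fun x _ => hΩ.mk_le_of_countable (G x).countable_toSet)
  have hstW : ∀ a, stage Z B a ⊆ W := fun a =>
    union_subset_union_right _ (iUnion₂_subset fun b _ => subset_iUnion B b)
  have hpY : ∀ a, ∀ x : P, (x : M) ∈ Substructure.closure L (f '' stage Z B a) →
      p x ∈ Substructure.closure L (range e ∪ blocks K (Y a)) := fun a x hx => by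
    refine embedding_mem_closure p ((image_mono (hstW a)).trans hWP) hx fun y hy => ?_
    refine Substructure.closure_mono (union_subset_union_right _ (image_mono fun i hi => ?_)) (hG y)
    exact Or.inr (mem_biUnion (show y ∈ {x : P | (x : M) ∈ f '' stage Z B a} from hy) hi)
  -- bounding
  have hbound : ∀ x : P, ∃ a, (x : M) ∈ Substructure.closure L
      (f '' stage Z B a ∪ range fun i => J i ()) := fun x => by
    have h1 : (x : M) ∈ Substructure.closure L ((range fun i => J i ()) ∪ f '' W) := by
      have h2 : (x : M) ∈ Substructure.closure L (f '' W ∪ range fun i => J i ()) := x.2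
      rwa [union_comm] at h2
    obtain ⟨F, hFW, hF⟩ := exists_finset_index h1
    obtain ⟨a, ha⟩ := exists_stage hΩ (hΩ.mk_le_of_countable F.countable_toSet) hFW
    refine ⟨a, ?_⟩
    rw [union_comm]
    exact Substructure.closure_mono (union_subset_union_right _ (image_mono ha)) hF
  choose bd hbd using hbound
  have hgex : ∀ a, ∃ a', a < a' ∧ (∀ x ≤ a, u x < a') ∧ ∀ y : Q, (y : M₁) ∈ Substructure.closure L
      (range e ∪ blocks K (Y a)) → q y ∈ Substructure.closure L
      (f '' stage Z B a' ∪ range fun i => J i ()) := fun a => by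
    set X : Set M₁ := e '' (Subtype.val ⁻¹' Z) ∪ blocks K (Y a) with hX
    have hXc : #X ≤ θ := by
      refine hΩ.mk_union_le (mk_image_le.trans
        ((mk_preimage_of_injective _ _ Subtype.val_injective).trans hZ)) (mk_image_le.trans ?_)
      have : {i : (WithTop κ.ord.ToType)ᵒᵈ ×ₗ ℕ | block i ∈ Y a} =
        ⋃ c ∈ Y a, range fun n : ℕ => toLex (OrderDual.toDual c, n) := by
        ext i
        simp only [mem_iUnion]
        constructor
        · intro hi
          exact ⟨block i, hi, posn i, rfl⟩
        · rintro ⟨c, hc, n, rfl⟩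
          exact hc
      rw [this]
      exact hΩ.mk_biUnion_le (hYc a) fun c _ => hΩ.mk_le_of_countable (countable_range _)
    have hXQ : X ⊆ Q := by
      rintro x (⟨c, -, rfl⟩ | ⟨i, -, rfl⟩)
      · exact Substructure.subset_closure (Or.inl ⟨c, rfl⟩)
      · exact Substructure.subset_closure (Or.inr ⟨i, rfl⟩)
    obtain ⟨a', ha'⟩ := hΩ.exists_gt (S := ((fun y : Q => bd (h.symm y)) ''
      (Subtype.val ⁻¹' X)) ∪ (Iic a ∪ u '' Iic a)) (hΩ.mk_union_le (mk_image_le.trans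
        ((mk_preimage_of_injective _ _ Subtype.val_injective).trans hXc))
        (hΩ.mk_union_le (hΩ.mk_Iic_le a) (mk_image_le.trans (hΩ.mk_Iic_le a))))
    refine ⟨a', ha' a (Or.inr (Or.inl le_rfl)),
      fun x hx => ha' _ (Or.inr (Or.inr ⟨x, hx, rfl⟩)), fun y hy => ?_⟩
    refine embedding_mem_closure q hXQ ?_ fun z hz => ?_
    · refine Substructure.closure_le.2 ?_ hy
      rintro x (⟨c, rfl⟩ | hx)
      · refine Substructure.closure_mono subset_union_left ((mem_closure_image_iff he).2 ?_)
        exact mem_closure_preimage Substructure.subset_closure c.2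
      · exact Substructure.subset_closure (Or.inr hx)
    · have h1 := hbd (h.symm z)
      have h2 := ha' (bd (h.symm z)) (Or.inl ⟨z, hz, rfl⟩)
      exact Substructure.closure_mono (union_subset_union_left _
        (image_mono (stage_mono Z B h2.le))) h1
  choose g hg hgu hgq using hgex
  obtain ⟨d, had, hη⟩ := hΩ.exists_ladder g hg a₀
  have hud : ∀ a < d, u a < d := fun a ha => by
    obtain ⟨n, hn⟩ := hη.2.2 a ha
    have h1 : u a < g^[n + 1] a₀ := by
      rw [Function.iterate_succ_apply']
      exact hgu _ _ hn.le
    exact h1.trans (hη.2.1 _)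
  refine ⟨d, had, ⟨_, hη⟩, hud, fun {ι} _ b hb => ?_⟩
  obtain ⟨Gb, hGb, hsol⟩ := hK.exists_finite_blocks (Y := ⋃ n, Y (g^[n] a₀))
    (mem_iUnion.2 ⟨0, Or.inl rfl⟩) (fun k => p ⟨f (b k), hfP _ (hb k)⟩) fun k => hpQ _
  obtain ⟨n, hn⟩ : ∃ n, (Gb : Set _) ⊆ Y (g^[n] a₀) := by
    have h1 : ∀ c ∈ Gb, ∃ n, c ∈ Y (g^[n] a₀) := fun c hc => mem_iUnion.1 (hGb hc)
    choose! n hn using h1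
    exact ⟨Gb.sup n, fun c hc => hYmono (hη.1.monotone (Finset.le_sup hc)) (hn c hc)⟩
  refine ⟨g (g^[n] a₀), ?_, fun φ hφ hbφ => ?_⟩
  · rw [← Function.iterate_succ_apply' g]
    exact hη.2.1 _
  have hcW : ∀ c : (Substructure.closure L (stage Z B d) : Set E),
    (c : E) ∈ Substructure.closure L W := fun c => Substructure.closure_mono (hstW d) c.2
  let cP : (Substructure.closure L (stage Z B d) : Set E) → P := fun c => ⟨f c, hfP _ (hcW c)⟩
  let bP : ι → P := fun k => ⟨f (b k), hfP _ (hb k)⟩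
  have h1 : φ.Realize (Sum.elim cP bP) := by
    rw [hφ P M hPT hM P.subtype]
    have := (hf.comp (Sum.elim (fun c : (Substructure.closure L (stage Z B d) : Set E) => (c : E))
      b) φ).1 hbφ
    convert this using 1
    funext k
    rcases k with k | k <;> rfl
  rw [hφ P M₁ hPT hM₁ p, Sum.comp_elim] at h1
  have hcY : ∀ c, (p ∘ cP) c ∈ Substructure.closure L
      (range e ∪ blocks K (⋃ n, Y (g^[n] a₀))) := fun c => by
    obtain ⟨m, hm⟩ := mem_closure_stage hη c.2
    have hsub : Y (g^[m] a₀) ⊆ ⋃ n, Y (g^[n] a₀) := subset_iUnion (fun n => Y (g^[n] a₀)) m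
    have hsub' : blocks K (Y (g^[m] a₀)) ⊆ blocks K (⋃ n, Y (g^[n] a₀)) :=
      image_mono fun i hi => hsub hi
    exact Substructure.closure_mono (union_subset_union_right _ hsub')
      (hpY (g^[m] a₀) (cP c) ((mem_closure_image_iff hf).2 hm))
  obtain ⟨b', hb', h2⟩ := hsol (p ∘ cP) hcY φ h1
  have hb'Q : ∀ k, b' k ∈ Q := fun k => Substructure.closure_mono
    (union_subset_union_right _ (image_subset_range _ _)) (hb' k)
  have h3 : φ.Realize (Sum.elim (fun c => (⟨p (cP c), hpQ _⟩ : Q)) fun k => ⟨b' k, hb'Q k⟩) := by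
    rw [hφ Q M₁ hQT hM₁ Q.subtype]
    convert h2 using 1
    funext k
    rcases k with k | k <;> rfl
  rw [hφ Q M hQT hM q, Sum.comp_elim] at h3
  have e1 : (q ∘ fun c => (⟨p (cP c), hpQ _⟩ : Q)) =
    f ∘ fun c : (Substructure.closure L (stage Z B d) : Set E) => (c : E) := by
    funext c
    exact hqp _ _
  rw [e1] at h3
  have hD' : {x : Unit → E | ∀ k, x k ∈ Substructure.closure L (stage Z B (g (g^[n] a₀)))} ∈ D := by
    filter_upwards [hD] with x hx k
    exact Substructure.closure_mono subset_union_left (hx k)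
  refine hJ.exists_base_closure hf hD' _ _ (fun k => ?_) φ h3
  have hsub : blocks K (Gb : Set (WithTop κ.ord.ToType)) ⊆ blocks K (Y (g^[n] a₀)) :=
    image_mono fun i hi => hn hi
  have h4 := hgq (g^[n] a₀) ⟨b' k, hb'Q k⟩ (Substructure.closure_mono
    (union_subset_union_right _ hsub) (hb' k))
  refine Substructure.closure_mono (union_subset_union_right _ ?_) h4
  rintro _ ⟨i, rfl⟩
  exact ⟨(i, ()), rfl⟩

end Stages

section Existence

variable {M N : Type u} [L.Structure M] [L.Structure N] {α : Type*} {v : α → M} {w : α → N}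

theorem EqT.exists_realize (h : EqT L v w) {ι : Type*} [Finite ι] (φ : L.Formula (α ⊕ ι))
    (hφ : ∃ x, φ.Realize (Sum.elim v x)) : ∃ y, φ.Realize (Sum.elim w y) := by
  have h1 := (h (φ.iExs ι)).1 (by
    rw [Formula.realize_iExs]
    exact hφ)
  rwa [Formula.realize_iExs] at h1

theorem Absolute.relabel {T : L.Theory} {β : Type*} {φ : L.Formula α} (hφ : Absolute T φ)
    (g : α → β) : Absolute T (φ.relabel g) := fun M N _ _ _ _ hM hN f v => by
  rw [Formula.realize_relabel, Formula.realize_relabel]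
  exact hφ M N hM hN f _

end Existence

section Branches

variable {Ω : Type u} {ρ : Type}

/-- The values along the branch of the tree leading to the node `σ`; nodes are lists with the
latest entry first. -/
def path {M : Type*} (v : List Ω → ρ → M) (σ : List Ω) (i : ℕ) : ρ → M :=
  v (σ.drop (σ.length - (i + 1)))

theorem path_cons_lt {M : Type*} (v : List Ω → ρ → M) (ξ : Ω) (τ : List Ω) {i : ℕ}
    (hi : i < τ.length) : path v (ξ :: τ) i = path v τ i := by
  have : (ξ :: τ).length - (i + 1) = (τ.length - (i + 1)) + 1 := by
    rw [List.length_cons]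
    omega
  rw [path, this, List.drop_succ_cons, path]

theorem path_cons_length {M : Type*} (v : List Ω → ρ → M) (ξ : Ω) (τ : List Ω) :
    path v (ξ :: τ) τ.length = v (ξ :: τ) := by
  rw [path, List.length_cons, Nat.sub_self, List.drop_zero]

/-- The node given by the first `n + 1` values of a sequence. -/
def ladder (η : ℕ → Ω) : ℕ → List Ω
  | 0 => [η 0]
  | n + 1 => η (n + 1) :: ladder η n

theorem length_ladder (η : ℕ → Ω) (n : ℕ) : (ladder η n).length = n + 1 := by
  induction n with
  | zero => rfl
  | succ n ih => rw [ladder, List.length_cons, ih]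

theorem mem_ladder {η : ℕ → Ω} {n : ℕ} {x : Ω} : x ∈ ladder η n ↔ ∃ i ≤ n, x = η i := by
  induction n with
  | zero => simp [ladder]
  | succ n ih =>
    rw [ladder, List.mem_cons, ih]
    constructor
    · rintro (rfl | ⟨i, hi, rfl⟩)
      · exact ⟨n + 1, le_rfl, rfl⟩
      · exact ⟨i, hi.trans n.le_succ, rfl⟩
    · rintro ⟨i, hi, rfl⟩
      rcases hi.eq_or_lt with rfl | hi
      · exact Or.inl rfl
      · exact Or.inr ⟨i, Nat.lt_succ_iff.1 hi, rfl⟩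

theorem pairwise_ladder [LinearOrder Ω] {η : ℕ → Ω} (hη : StrictMono η) (n : ℕ) :
    (ladder η n).Pairwise (· > ·) := by
  induction n with
  | zero => simp [ladder]
  | succ n ih =>
    rw [ladder, List.pairwise_cons]
    refine ⟨fun x hx => ?_, ih⟩
    obtain ⟨i, hi, rfl⟩ := mem_ladder.1 hx
    exact hη (Nat.lt_succ_iff.2 hi)

theorem path_ladder {M : Type*} (v : List Ω → ρ → M) (η : ℕ → Ω) {i n : ℕ} (hi : i ≤ n) :
    path v (ladder η n) i = v (ladder η i) := by
  induction n with
  | zero =>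
    obtain rfl := Nat.le_zero.1 hi
    rfl
  | succ n ih =>
    rcases hi.eq_or_lt with rfl | hi
    · have := path_cons_length v (η (n + 1)) (ladder η n)
      rwa [length_ladder] at this
    · rw [ladder, path_cons_lt _ _ _ (by rwa [length_ladder]), ih (Nat.lt_succ_iff.1 hi)]

/-- The first `n` tuples of a sequence of tuples. -/
def initial {M : Type*} (d : ℕ → ρ → M) (n : ℕ) : Fin n × ρ → M := fun p => d p.1 p.2

theorem initial_congr {M : Type*} {d d' : ℕ → ρ → M} {n : ℕ} (h : ∀ i < n, d i = d' i) :
    initial d n = initial d' n := by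
  funext p
  rw [initial, initial, h _ p.1.2]

theorem finite_lists [LinearOrder Ω] (s : Finset Ω) :
    {τ : List Ω | (∀ x ∈ τ, x ∈ s) ∧ τ.Pairwise (· > ·)}.Finite := by
  refine Set.Finite.of_finite_image (f := List.toFinset)
    (Set.Finite.subset s.powerset.finite_toSet ?_) ?_
  · rintro _ ⟨τ, hτ, rfl⟩
    exact Finset.mem_powerset.2 fun x hx => hτ.1 x (List.mem_toFinset.1 hx)
  · intro τ hτ τ' hτ' h
    have h1 : τ.Perm τ' := List.perm_of_nodup_nodup_toFinset_eq
      (hτ.2.imp fun h => ne_of_gt h) (hτ'.2.imp fun h => ne_of_gt h) h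
    exact h1.eq_of_pairwise (fun a b _ _ h1 h2 => absurd h1 h2.asymm) hτ.2 hτ'.2

end Branches

section Tree

variable {Ω : Type u} [LinearOrder Ω] {E : Type u} [L.Structure E] {γ : Type u} {ρ ι : Type}

/-- A finite part of the tree construction. -/
structure IsTree (z : γ → E) (c : ℕ → ρ → E) (χ : ∀ n, L.Formula ((γ ⊕ (Fin (n + 1) × ρ)) ⊕ ι))
    (η : Ω → ℕ → Ω) (s : Finset Ω) {M : Type u} [L.Structure M] (e : γ → M)
    (v : List Ω → ρ → M) (b : Ω → ι → M) (P : Ω → L.Substructure M) : Prop where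
  eqT : ∀ σ : List Ω, (∀ x ∈ σ, x ∈ s) → σ.Pairwise (· > ·) →
    EqT L (Sum.elim z (initial c σ.length)) (Sum.elim e (initial (path v σ) σ.length))
  base_mem : ∀ ξ ∈ s, ∀ k, e k ∈ P ξ
  node_mem : ∀ ξ ∈ s, ∀ σ : List Ω, (∀ x ∈ σ, x ∈ s) → (∀ x ∈ σ, x < ξ) → ∀ k, v σ k ∈ P ξ
  leaf_mem : ∀ ξ ∈ s, ∀ d ∈ s, d < ξ → ∀ k, b d k ∈ P ξ
  avoid : ∀ ξ ∈ s, ∀ τ : List Ω, (∀ x ∈ τ, x ∈ s) → (ξ :: τ).Pairwise (· > ·) → ∀ x : ι → M,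
    (∀ k, x k ∈ P ξ) → ¬ (χ τ.length).Realize
      (Sum.elim (Sum.elim e (initial (path v (ξ :: τ)) (τ.length + 1))) x)
  leaf : ∀ d ∈ s, HasLadder d (η d) → ∀ n, (∀ i ≤ n, η d i ∈ s) →
    (χ n).Realize (Sum.elim (Sum.elim e (initial (fun i => v (ladder (η d) i)) (n + 1))) (b d))

/-- The hypothesis that the next tuple of the tree can be chosen generically. -/
def OneStep (z : γ → E) (c : ℕ → ρ → E) (χ : ∀ n, L.Formula ((γ ⊕ (Fin (n + 1) × ρ)) ⊕ ι)) :
    Prop :=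
  ∀ (n : ℕ) (M : Type u) [L.Structure M] (e : γ → M) (d : ℕ → ρ → M),
    EqT L (Sum.elim z (initial c n)) (Sum.elim e (initial d n)) →
    ∃ (M' : Type u) (_ : L.Structure M') (f : M → M') (y : ρ → M'), EqT L id f ∧
      EqT L (Sum.elim z (initial c (n + 1)))
        (Sum.elim (f ∘ e) (initial (Function.update (fun i => f ∘ d i) n y) (n + 1))) ∧
      ∀ x : ι → M, ¬ (χ n).Realize (Sum.elim (Sum.elim (f ∘ e)
        (initial (Function.update (fun i => f ∘ d i) n y) (n + 1))) (f ∘ x))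

variable {z : γ → E} {c : ℕ → ρ → E} {χ : ∀ n, L.Formula ((γ ⊕ (Fin (n + 1) × ρ)) ⊕ ι)}

theorem comp_elim_initial {M M' : Type*} (f : M → M') (e : γ → M) (d : ℕ → ρ → M) (n : ℕ) :
    f ∘ Sum.elim e (initial d n) = Sum.elim (f ∘ e) (initial (fun i => f ∘ d i) n) := by
  rw [Sum.comp_elim]
  rfl

/-- Simultaneous extension of finitely many branches. -/
theorem OneStep.extend (h : OneStep z c χ) {M : Type u} [L.Structure M] (e : γ → M)
    (d : List Ω → ℕ → ρ → M) (S : Finset (List Ω))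
    (hS : ∀ τ ∈ S, EqT L (Sum.elim z (initial c τ.length))
      (Sum.elim e (initial (d τ) τ.length))) [Nonempty M] :
    ∃ (M' : Type u) (_ : L.Structure M') (f : M → M') (y : List Ω → ρ → M'), EqT L id f ∧
      ∀ τ ∈ S, EqT L (Sum.elim z (initial c (τ.length + 1)))
        (Sum.elim (f ∘ e) (initial (Function.update (fun i => f ∘ d τ i) τ.length (y τ))
          (τ.length + 1))) ∧
      ∀ x : ι → M, ¬ (χ τ.length).Realize (Sum.elim (Sum.elim (f ∘ e)
        (initial (Function.update (fun i => f ∘ d τ i) τ.length (y τ)) (τ.length + 1)))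
          (f ∘ x)) := by
  classical
  induction S using Finset.induction_on with
  | empty =>
    exact ⟨M, _, id, fun _ _ => Classical.arbitrary M, EqT.refl _, by simp⟩
  | insert τ S hτ ih =>
    obtain ⟨M₁, _, f, y, hf, hy⟩ := ih fun τ' hτ' => hS τ' (Finset.mem_insert_of_mem hτ')
    have h1 := (hS τ (Finset.mem_insert_self _ _)).trans
      (hf.comp (Sum.elim e (initial (d τ) τ.length)))
    rw [comp_elim_initial] at h1
    obtain ⟨M₂, _, g, y₂, hg, hy₂, hno⟩ := h τ.length M₁ _ _ h1
    refine ⟨M₂, _, g ∘ f, Function.update (fun σ => g ∘ y σ) τ y₂, hf.trans (hg.comp f), ?_⟩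
    intro σ hσ
    by_cases hστ : σ = τ
    · subst hστ
      rw [Function.update_self]
      exact ⟨hy₂, fun x => hno (f ∘ x)⟩
    · rw [Function.update_of_ne hστ]
      obtain ⟨h2, h3⟩ := hy σ ((Finset.mem_insert.1 hσ).resolve_left hστ)
      have e1 : (Function.update (fun i => (g ∘ f) ∘ d σ i) σ.length (g ∘ y σ)) =
          fun i => g ∘ (Function.update (fun i => f ∘ d σ i) σ.length (y σ)) i := by
        funext i
        by_cases hi : i = σ.length
        · subst hi
          simp
        · simp [Function.update_of_ne hi, Function.comp_assoc]
      rw [e1]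
      have e2 := comp_elim_initial g (f ∘ e)
        (Function.update (fun i => f ∘ d σ i) σ.length (y σ)) (σ.length + 1)
      rw [Function.comp_assoc, ← e2]
      refine ⟨h2.trans (hg.comp _), fun x hx => h3 x ?_⟩
      rw [Function.comp_assoc, ← Sum.comp_elim] at hx
      exact ((hg.comp _) _).2 hx

end Tree

section TreeStep

variable {Ω : Type u} [LinearOrder Ω] {E : Type u} [L.Structure E] {γ : Type u} {ρ ι : Type}
  {z : γ → E} {c : ℕ → ρ → E} {χ : ∀ n, L.Formula ((γ ⊕ (Fin (n + 1) × ρ)) ⊕ ι)}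

theorem IsTree.exists_leaf [Finite ι] {b₀ : ι → E}
    (hb₀ : ∀ n, (χ n).Realize (Sum.elim (Sum.elim z (initial c (n + 1))) b₀))
    {η : Ω → ℕ → Ω} {s : Finset Ω} {M : Type u} [L.Structure M] {e : γ → M}
    {v : List Ω → ρ → M} {b : Ω → ι → M} {P : Ω → L.Substructure M}
    (h : IsTree z c χ η s e v b P) [Nonempty M] (θ : ℕ → Ω) (hθ : StrictMono θ) :
    ∃ x : ι → M, ∀ n, (∀ i ≤ n, θ i ∈ s) →
      (χ n).Realize (Sum.elim (Sum.elim e (initial (fun i => v (ladder θ i)) (n + 1))) x) := by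
  classical
  have hex : ∃ n, θ n ∉ s := by
    by_contra! hcon
    exact Set.infinite_range_of_injective hθ.injective
      (s.finite_toSet.subset (range_subset_iff.2 hcon))
  obtain ⟨m, hm⟩ : ∃ m, Nat.find hex = m := ⟨_, rfl⟩
  have hm1 : θ m ∉ s := hm ▸ Nat.find_spec hex
  have hm2 : ∀ i < m, θ i ∈ s := fun i hi => not_not.1 (Nat.find_min hex (hm ▸ hi))
  cases m with
  | zero => exact ⟨fun _ => Classical.arbitrary M, fun n hn => absurd (hn 0 n.zero_le) hm1⟩
  | succ m =>
    have h1 := h.eqT (ladder θ m) (fun x hx => by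
      obtain ⟨i, hi, rfl⟩ := mem_ladder.1 hx
      exact hm2 i (Nat.lt_succ_iff.2 hi)) (pairwise_ladder hθ m)
    rw [length_ladder] at h1
    rw [initial_congr (d' := fun i => v (ladder θ i)) fun i hi =>
      path_ladder v θ (Nat.lt_succ_iff.1 hi)] at h1
    let r : ∀ n : Fin (m + 1), (γ ⊕ (Fin (n + 1) × ρ)) ⊕ ι → (γ ⊕ (Fin (m + 1) × ρ)) ⊕ ι :=
      fun n => Sum.map (Sum.map id (Prod.map (Fin.castLE n.2) id)) id
    have hr : ∀ {Q : Type u} (e : γ → Q) (d : ℕ → ρ → Q) (x : ι → Q) (n : Fin (m + 1)),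
        Sum.elim (Sum.elim e (initial d (m + 1))) x ∘ r n =
          Sum.elim (Sum.elim e (initial d (n + 1))) x := fun e d x n => by
      funext k
      rcases k with (k | k) | k <;> rfl
    obtain ⟨x, hx⟩ := h1.exists_realize (ι := ι)
      (Formula.iInf fun n : Fin (m + 1) => (χ n).relabel (r n)) ⟨b₀, by
        rw [Formula.realize_iInf]
        intro n
        rw [Formula.realize_relabel, hr]
        exact hb₀ n⟩
    rw [Formula.realize_iInf] at hx
    refine ⟨x, fun n hn => ?_⟩
    have hnm : n < m + 1 := by
      by_contra! hcon
      exact hm1 (hn _ hcon)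
    have h2 := hx ⟨n, hnm⟩
    rwa [Formula.realize_relabel, hr] at h2

theorem exists_isTree [Finite ι] [Nonempty γ] (hstep : OneStep z c χ) {b₀ : ι → E}
    (hb₀ : ∀ n, (χ n).Realize (Sum.elim (Sum.elim z (initial c (n + 1))) b₀))
    (η : Ω → ℕ → Ω) (s : Finset Ω) :
    ∃ (M : Type u) (_ : L.Structure M) (e : γ → M) (v : List Ω → ρ → M) (b : Ω → ι → M)
      (P : Ω → L.Substructure M), IsTree z c χ η s e v b P := by
  classical
  induction s using Finset.induction_on_max with
  | empty =>
    refine ⟨E, _, z, fun _ _ => z (Classical.arbitrary γ), fun _ _ => z (Classical.arbitrary γ),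
      fun _ => ⊤, ⟨fun σ hσ _ => ?_, by simp, by simp, by simp, by simp, by simp⟩⟩
    obtain rfl : σ = [] := List.eq_nil_iff_forall_not_mem.2 fun x hx => by simpa using hσ x hx
    rw [List.length_nil, initial_congr (d' := path (fun _ _ => z (Classical.arbitrary γ)) [])
      fun i hi => absurd hi i.not_lt_zero]
    exact EqT.refl _
  | insert ξ s hξ ih =>
    obtain ⟨M, _, e, v, b, P, h⟩ := ih
    have : Nonempty M := ⟨e (Classical.arbitrary γ)⟩
    have hξs : ξ ∉ s := fun hmem => lt_irrefl _ (hξ ξ hmem)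
    obtain ⟨M', _, f, y, hf, hy⟩ := hstep.extend e (fun τ => path v τ) (finite_lists s).toFinset
      fun τ hτ => by
        rw [Set.Finite.mem_toFinset] at hτ
        exact h.eqT τ hτ.1 hτ.2
    simp only [Set.Finite.mem_toFinset] at hy
    have hleaf : ∃ x : ι → M, HasLadder ξ (η ξ) → ∀ n, (∀ i ≤ n, η ξ i ∈ s) → (χ n).Realize
        (Sum.elim (Sum.elim e (initial (fun i => v (ladder (η ξ) i)) (n + 1))) x) := by
      by_cases hl : HasLadder ξ (η ξ)
      · obtain ⟨x, hx⟩ := h.exists_leaf hb₀ (η ξ) hl.1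
        exact ⟨x, fun _ => hx⟩
      · exact ⟨fun _ => Classical.arbitrary M, fun hl' => absurd hl' hl⟩
    obtain ⟨x₀, hx₀⟩ := hleaf
    let v' : List Ω → ρ → M' := fun σ => if σ.head? = some ξ then y σ.tail else f ∘ v σ
    have hv₁ : ∀ σ : List Ω, (∀ x ∈ σ, x ∈ s) → v' σ = f ∘ v σ := fun σ hσ =>
      if_neg fun hh => hξs (hσ ξ (List.mem_of_mem_head? hh))
    have hp₁ : ∀ σ : List Ω, (∀ x ∈ σ, x ∈ s) → path v' σ = fun i => f ∘ path v σ i :=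
      fun σ hσ => funext fun i => hv₁ _ fun x hx => hσ x (List.mem_of_mem_drop hx)
    have hp₂ : ∀ τ : List Ω, (∀ x ∈ τ, x ∈ s) → initial (path v' (ξ :: τ)) (τ.length + 1) =
        initial (Function.update (fun i => f ∘ path v τ i) τ.length (y τ)) (τ.length + 1) :=
      fun τ hτ => initial_congr fun i hi => by
        rcases (Nat.lt_succ_iff.1 hi).eq_or_lt with rfl | hi
        · rw [path_cons_length, Function.update_self]
          exact if_pos rfl
        · rw [path_cons_lt _ _ _ hi, Function.update_of_ne hi.ne, hp₁ τ hτ]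
    have hsub : ∀ (σ : List Ω), (∀ x ∈ σ, x ∈ insert ξ s) → (∀ x ∈ σ, x < ξ) → ∀ x ∈ σ, x ∈ s :=
      fun σ hσ hlt x hx => (Finset.mem_insert.1 (hσ x hx)).resolve_left (hlt x hx).ne
    let P' : Ω → L.Substructure M' := fun t =>
      (if t = ξ then ⊤ else P t).map hf.toEmbedding.toHom
    have hPξ : ∀ m : M, f m ∈ P' ξ := fun m => ⟨m, by simp, rfl⟩
    have hPs : ∀ t ∈ s, ∀ m ∈ P t, f m ∈ P' t := fun t ht m hm =>
      ⟨m, by rwa [if_neg (ne_of_lt (hξ t ht))], rfl⟩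
    refine ⟨M', _, f ∘ e, v', Function.update (fun d => f ∘ b d) ξ (f ∘ x₀), P',
      ⟨?_, ?_, ?_, ?_, ?_, ?_⟩⟩
    · have hold : ∀ σ : List Ω, (∀ x ∈ σ, x ∈ s) → σ.Pairwise (· > ·) →
          EqT L (Sum.elim z (initial c σ.length))
            (Sum.elim (f ∘ e) (initial (path v' σ) σ.length)) := fun σ hσ hσp => by
        have h1 := (h.eqT σ hσ hσp).trans (hf.comp (Sum.elim e (initial (path v σ) σ.length)))
        rwa [comp_elim_initial, ← hp₁ σ hσ] at h1
      intro σ hσ hσp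
      cases σ with
      | nil => exact hold [] (by simp) List.Pairwise.nil
      | cons x τ =>
        have hx := hσ x List.mem_cons_self
        have hτp := List.pairwise_cons.1 hσp
        rcases Finset.mem_insert.1 hx with rfl | hxs
        · have hτ := hsub τ (fun y hy => hσ y (List.mem_cons_of_mem _ hy)) hτp.1
          have h1 := (hy τ ⟨hτ, hτp.2⟩).1
          rwa [← hp₂ τ hτ] at h1
        · refine hold _ (hsub _ hσ fun y hy => ?_) hσp
          rcases List.mem_cons.1 hy with rfl | hy
          · exact hξ _ hxs
          · exact (hτp.1 y hy).trans (hξ _ hxs)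
    · intro t ht k
      rcases Finset.mem_insert.1 ht with rfl | hts
      · exact hPξ _
      · exact hPs t hts _ (h.base_mem t hts k)
    · intro t ht σ hσ hσt k
      have hσs : ∀ x ∈ σ, x ∈ s := hsub σ hσ fun x hx => (hσt x hx).trans_le (by
        rcases Finset.mem_insert.1 ht with rfl | hts
        · exact le_rfl
        · exact (hξ t hts).le)
      rw [hv₁ σ hσs]
      rcases Finset.mem_insert.1 ht with rfl | hts
      · exact hPξ _
      · exact hPs t hts _ (h.node_mem t hts σ hσs hσt k)
    · intro t ht d hd hdt k
      have hdξ : d < ξ := hdt.trans_le (by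
        rcases Finset.mem_insert.1 ht with rfl | hts
        · exact le_rfl
        · exact (hξ t hts).le)
      rw [Function.update_of_ne hdξ.ne]
      have hds := (Finset.mem_insert.1 hd).resolve_left hdξ.ne
      rcases Finset.mem_insert.1 ht with rfl | hts
      · exact hPξ _
      · exact hPs t hts _ (h.leaf_mem t hts d hds hdt k)
    · intro t ht τ hτ hτp x hx
      have hτp' := List.pairwise_cons.1 hτp
      rcases Finset.mem_insert.1 ht with rfl | hts
      · have hτs := hsub τ hτ hτp'.1
        rw [hp₂ τ hτs]
        have hx' : ∀ k, ∃ m : M, f m = x k := fun k => by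
          obtain ⟨m, -, hm⟩ := hx k
          exact ⟨m, hm⟩
        choose x' hx' using hx'
        obtain rfl : f ∘ x' = x := funext hx'
        exact (hy τ ⟨hτs, hτp'.2⟩).2 x'
      · have hτs := hsub τ hτ fun y hy => (hτp'.1 y hy).trans (hξ t hts)
        have htτ : ∀ y ∈ t :: τ, y ∈ s := fun y hy => by
          rcases List.mem_cons.1 hy with rfl | hy
          · exact hts
          · exact hτs y hy
        have hx' : ∀ k, ∃ m ∈ P t, f m = x k := fun k => by
          obtain ⟨m, hm, hmx⟩ := hx k
          rw [SetLike.mem_coe, if_neg (ne_of_lt (hξ t hts))] at hm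
          exact ⟨m, hm, hmx⟩
        choose x' hxP hx' using hx'
        obtain rfl : f ∘ x' = x := funext hx'
        intro hcon
        refine h.avoid t hts τ hτs hτp x' hxP ((hf.comp (Sum.elim (Sum.elim e
          (initial (path v (t :: τ)) (τ.length + 1))) x') _).2 ?_)
        rwa [Sum.comp_elim, comp_elim_initial, ← hp₁ _ htτ]
    · intro d hd hl n hn
      have hdn : ∀ i ≤ n, η d i ∈ s := fun i hi =>
        (Finset.mem_insert.1 (hn i hi)).resolve_left (ne_of_lt ((hl.2.1 i).trans_le (by
          rcases Finset.mem_insert.1 hd with rfl | hds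
          · exact le_rfl
          · exact (hξ d hds).le)))
      have e1 : initial (fun i => v' (ladder (η d) i)) (n + 1) =
          initial (fun i => f ∘ v (ladder (η d) i)) (n + 1) := initial_congr fun i hi =>
        hv₁ _ fun x hx => by
          obtain ⟨j, hj, rfl⟩ := mem_ladder.1 hx
          exact hdn j (hj.trans (Nat.lt_succ_iff.1 hi))
      rw [e1]
      rcases Finset.mem_insert.1 hd with rfl | hds
      · rw [Function.update_self, ← comp_elim_initial, ← Sum.comp_elim]
        exact (hf.comp _ _).1 (hx₀ hl n hdn)
      · rw [Function.update_of_ne (hξ d hds).ne, ← comp_elim_initial, ← Sum.comp_elim]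
        exact (hf.comp _ _).1 (h.leaf d hds hl n hdn)

end TreeStep

section TreeLimit

variable {E : Type u} [L.Structure E] {γ : Type u} {ρ ι : Type}
  {z : γ → E} {c : ℕ → ρ → E} {χ : ∀ n, L.Formula ((γ ⊕ (Fin (n + 1) × ρ)) ⊕ ι)}

theorem exists_ladder_eq_cons {Ω : Type*} (θ : ℕ → Ω) (n : ℕ) :
    ∃ τ, ladder θ n = θ n :: τ ∧ τ.length = n := by
  have h : ∃ τ, ladder θ n = θ n :: τ := by
    cases n with
    | zero => exact ⟨[], rfl⟩
    | succ n => exact ⟨_, rfl⟩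
  obtain ⟨τ, hτ⟩ := h
  have h1 := length_ladder θ n
  rw [hτ, List.length_cons] at h1
  exact ⟨τ, hτ, by omega⟩

variable {T : L.Theory}

theorem not_oneStep (hT : IsUniversalTheory T) {κ : Cardinal.{u}} (hκ : ℵ₀ < κ)
    (hTκ : KUnique T κ) (hE : E ⊨ T) [Countable γ] [Nonempty γ] [Countable ρ] [Finite ι]
    [Infinite (Substructure.closure L (range z))] (hχ : ∀ n, Absolute T (χ n)) {b₀ : ι → E}
    (hb₀ : ∀ n, (χ n).Realize (Sum.elim (Sum.elim z (initial c (n + 1))) b₀)) :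
    ¬ OneStep z c χ := fun hstep => by
  classical
  obtain ⟨Ω, _, hΩ⟩ := exists_isSuccType (le_refl ℵ₀)
  obtain ⟨ξ₀, -⟩ := hΩ.exists_gt (hΩ.mk_le_of_countable countable_empty)
  have hη : ∀ d : Ω, ∃ θ : ℕ → Ω, (∃ θ, HasLadder d θ) → HasLadder d θ := fun d => by
    by_cases h : ∃ θ, HasLadder d θ
    · obtain ⟨θ, hθ⟩ := h
      exact ⟨θ, fun _ => hθ⟩
    · exact ⟨fun _ => ξ₀, fun h' => absurd h' h⟩
  choose η hη using hη
  choose M instM e v b P h using exists_isTree hstep hb₀ η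
  let w : ∀ s : Finset Ω, (γ ⊕ (List Ω × ρ)) ⊕ (Ω × ι) → M s := fun s =>
    Sum.elim (Sum.elim (e s) (Function.uncurry (v s))) (Function.uncurry (b s))
  have : Nonempty ((γ ⊕ (List Ω × ρ)) ⊕ (Ω × ι)) := ⟨Sum.inl (Sum.inl (Classical.arbitrary γ))⟩
  obtain ⟨N, _, W, hW⟩ := exists_limit (L := L) (atTop : Filter (Finset Ω)) M w
  have hlim : ∀ {β : Type u} (g : β → L.Term ((γ ⊕ (List Ω × ρ)) ⊕ (Ω × ι))) (φ : L.Formula β),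
      (∀ᶠ s in atTop, φ.Realize fun k => (g k).realize (w s)) →
        φ.Realize fun k => (g k).realize W := fun g φ hφ => by
    rw [← realize_subst_formula]
    exact hW _ (hφ.mono fun s hs => realize_subst_formula.2 hs)
  have hmem : ∀ x : Ω, ∀ᶠ s : Finset Ω in atTop, x ∈ s := fun x =>
    (eventually_ge_atTop {x}).mono fun s hs => Finset.singleton_subset_iff.1 hs
  have hmems : ∀ σ : List Ω, ∀ᶠ s : Finset Ω in atTop, ∀ x ∈ σ, x ∈ s := fun σ =>
    (eventually_ge_atTop σ.toFinset).mono fun s hs x hx => hs (List.mem_toFinset.2 hx)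
  let e' : γ → N := fun k => W (Sum.inl (Sum.inl k))
  let v' : List Ω → ρ → N := fun σ k => W (Sum.inl (Sum.inr (σ, k)))
  let b' : Ω → ι → N := fun d k => W (Sum.inr (d, k))
  have heq : EqT L z e' := fun φ => by
    have hs : ∀ s, EqT L z (e s) := fun s =>
      ((h s).eqT [] (by simp) List.Pairwise.nil).comp Sum.inl
    have h1 : ∀ ψ : L.Formula γ, ψ.Realize z → ψ.Realize e' := fun ψ hψ =>
      hlim (fun k => Term.var (Sum.inl (Sum.inl k))) ψ (Eventually.of_forall fun s => (hs s ψ).1 hψ)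
    refine ⟨h1 φ, fun h2 => ?_⟩
    by_contra h3
    exact h1 φ.not h3 h2
  have hN : N ⊨ T := heq.models hE
  obtain ⟨e₁, -⟩ := heq.exists_equiv
  have : Infinite (Substructure.closure L (range e')) := e₁.toEquiv.infinite_iff.1 inferInstance
  let B : Ω → Set N := fun ξ =>
    (⋃ τ ∈ {τ : List Ω | ∀ y ∈ τ, y < ξ}, range (v' (ξ :: τ))) ∪ range (b' ξ)
  have hB : ∀ ξ, (B ξ).Countable := fun ξ => by
    refine Set.Countable.union (Set.Countable.biUnion ?_ fun τ _ => countable_range _)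
      (countable_range _)
    have := (le_aleph0_iff_set_countable.1 (hΩ.mk_Iio_le ξ)).to_subtype
    refine (countable_range fun l : List (Iio ξ) => l.map Subtype.val).mono fun τ hτ => ?_
    exact ⟨τ.attachWith (· ∈ Iio ξ) hτ, List.attachWith_map_subtype_val hτ⟩
  -- nodes avoid earlier elements
  have havoid : ∀ (ξ : Ω) (τ : List Ω) (n : ℕ), τ.length = n → (ξ :: τ).Pairwise (· > ·) →
      ∀ x : ι → N, (∀ k, x k ∈ Substructure.closure L (stage (range e') B ξ)) →
      ¬ (χ n).Realize (Sum.elim (Sum.elim e' (initial (path v' (ξ :: τ)) (n + 1))) x) := by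
    rintro ξ τ _ rfl hp x hx
    let S : Set ((γ ⊕ (List Ω × ρ)) ⊕ (Ω × ι)) := {i | ∀ᶠ s in atTop, w s i ∈ P s ξ}
    have hS : ∀ m ∈ stage (range e') B ξ, m ∈ range fun i : S => W i := by
      rintro m (⟨k, rfl⟩ | hm)
      · exact ⟨⟨Sum.inl (Sum.inl k), (hmem ξ).mono fun s hs => (h s).base_mem ξ hs k⟩, rfl⟩
      · obtain ⟨ξ', hξ', hm⟩ := mem_iUnion₂.1 hm
        rcases hm with hm | ⟨k, rfl⟩
        · obtain ⟨σ, hσ, k, rfl⟩ := mem_iUnion₂.1 hm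
          refine ⟨⟨Sum.inl (Sum.inr (ξ' :: σ, k)), ?_⟩, rfl⟩
          filter_upwards [hmem ξ, hmems (ξ' :: σ)] with s hs hσs
          refine (h s).node_mem ξ hs _ hσs (fun y hy => ?_) k
          rcases List.mem_cons.1 hy with rfl | hy
          · exact hξ'
          · exact (hσ y hy).trans hξ'
        · refine ⟨⟨Sum.inr (ξ', k), ?_⟩, rfl⟩
          filter_upwards [hmem ξ, hmem ξ'] with s hs hs'
          exact (h s).leaf_mem ξ hs ξ' hs' hξ' k
    obtain ⟨t, ht⟩ := exists_terms _ (fun i : S => W i) hS x hx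
    have htP : ∀ t : L.Term S, ∀ᶠ s in atTop, (t.relabel Subtype.val).realize (w s) ∈ P s ξ :=
      fun t => by
        induction t with
        | var i => exact i.2
        | func f ts ih =>
          filter_upwards [eventually_all.2 ih] with s hs
          exact (P s ξ).fun_mem f _ hs
    have h1 := hlim (Sum.elim (Sum.elim (fun k => Term.var (Sum.inl (Sum.inl k)))
      (fun p : Fin (τ.length + 1) × ρ =>
        Term.var (Sum.inl (Sum.inr ((ξ :: τ).drop ((ξ :: τ).length - (p.1 + 1)), p.2)))))
      fun k => (t k).relabel Subtype.val) (χ τ.length).not (by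
        filter_upwards [hmem ξ, hmems τ, eventually_all.2 fun k => htP (t k)] with s h1 h2 h3
        have h4 := (h s).avoid ξ h1 τ h2 hp _ h3
        rw [Formula.realize_not]
        convert h4 using 3
        rename_i k
        rcases k with (k | k) | k <;> rfl)
    rw [Formula.realize_not] at h1
    convert h1 using 3
    rename_i k
    rcases k with (k | k) | k
    · rfl
    · rfl
    · rw [Sum.elim_inr, Sum.elim_inr, Term.realize_relabel, ← ht]
      rfl
  have hleaf : ∀ d, (∃ θ, HasLadder d θ) → ∀ n, (χ n).Realize
      (Sum.elim (Sum.elim e' (initial (fun i => v' (ladder (η d) i)) (n + 1))) (b' d)) :=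
    fun d hd n => by
    have h1 := hlim (Sum.elim (Sum.elim (fun k => Term.var (Sum.inl (Sum.inl k)))
      (fun p : Fin (n + 1) × ρ => Term.var (Sum.inl (Sum.inr (ladder (η d) p.1, p.2)))))
      fun k => Term.var (Sum.inr (d, k))) (χ n) (by
        filter_upwards [hmem d, hmems (ladder (η d) n)] with s h1 h2
        have h4 := (h s).leaf d h1 (hη d hd) n fun i hi => h2 _ (mem_ladder.2 ⟨i, hi, rfl⟩)
        convert h4 using 1
        funext k
        rcases k with (k | k) | k <;> rfl)
    convert h1 using 1
    funext k
    rcases k with (k | k) | k <;> rfl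
  obtain ⟨d, -, hd, -, hfs⟩ := exists_finSat_stage hT hκ hTκ hΩ hκ hN
    (hΩ.mk_le_of_countable (countable_range e')) (fun ξ => hΩ.mk_le_of_countable (hB ξ)) id ξ₀
  have hl := hη d hd
  obtain ⟨a, had, hfs⟩ := hfs (b' d) fun k => Substructure.subset_closure
    (Or.inr (mem_iUnion.2 ⟨d, Or.inr ⟨k, rfl⟩⟩))
  obtain ⟨n, hn⟩ := hl.2.2 a had
  have hvd : ∀ i k, v' (ladder (η d) i) k ∈ stage (range e') B d := fun i k => by
    obtain ⟨τ, hτ, -⟩ := exists_ladder_eq_cons (η d) i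
    have hp := pairwise_ladder hl.1 i
    rw [hτ] at hp ⊢
    refine Or.inr (mem_biUnion (hl.2.1 i) (Or.inl (mem_biUnion ?_ ⟨k, rfl⟩)))
    exact (List.pairwise_cons.1 hp).1
  let C := Substructure.closure L (stage (range e') B d)
  let g : γ ⊕ (Fin (n + 1) × ρ) → (C : Set N) := Sum.elim
    (fun k => ⟨e' k, Substructure.subset_closure (Or.inl ⟨k, rfl⟩)⟩)
    (fun p => ⟨v' (ladder (η d) p.1) p.2, Substructure.subset_closure (hvd _ _)⟩)
  have hg : ∀ x : ι → N, Sum.elim (fun i : (C : Set N) => (i : N)) x ∘ Sum.map g id =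
      Sum.elim (Sum.elim e' (initial (fun i => v' (ladder (η d) i)) (n + 1))) x := fun x => by
    funext k
    rcases k with (k | k) | k <;> rfl
  obtain ⟨x, hx, hxχ⟩ := hfs ((χ n).relabel (Sum.map g id)) ((hχ n).relabel _) (by
    rw [Formula.realize_relabel, hg]
    exact hleaf d hd n)
  rw [Formula.realize_relabel, hg] at hxχ
  obtain ⟨τ, hτ, hτn⟩ := exists_ladder_eq_cons (η d) n
  have hp := pairwise_ladder hl.1 n
  rw [hτ] at hp
  refine havoid (η d n) τ n hτn hp x (fun k => ?_) ?_
  · exact Substructure.closure_mono (stage_mono _ _ hn.le) (hx k)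
  · rwa [← hτ, initial_congr fun i hi => path_ladder v' (η d) (Nat.lt_succ_iff.1 hi)]

end TreeLimit

section AbsoluteFormulas

variable {T : L.Theory} {α : Type*}

theorem Absolute.not {φ : L.Formula α} (h : Absolute T φ) : Absolute T φ.not :=
  fun M N _ _ _ _ hM hN f v => by
  rw [Formula.realize_not, Formula.realize_not, h M N hM hN f v]

theorem absolute_equal (s t : L.Term α) : Absolute T (s.equal t) := fun M N _ _ _ _ _ _ f v => by
  rw [Formula.realize_equal, Formula.realize_equal]
  simp only [HomClass.realize_term, f.injective.eq_iff]

theorem absolute_rel {n : ℕ} (r : L.Relations n) (t : Fin n → L.Term α) :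
    Absolute T (r.formula t) := fun M N _ _ _ _ _ _ f v => by
  rw [Formula.realize_rel, Formula.realize_rel, ← f.map_rel]
  have : ∀ i, (t i).realize (f ∘ v) = f ((t i).realize v) := fun i => HomClass.realize_term f
  simp only [this]
  rfl

/-- A map preserving the absolute formulas is an embedding. -/
def embeddingOfAbsolute {M N : Type u} [L.Structure M] [L.Structure N] {f : M → N}
    (h : ∀ φ : L.Formula M, Absolute T φ → φ.Realize id → φ.Realize f) : M ↪[L] N where
  toFun := f
  inj' x y hxy := by
    by_contra hne
    have := h ((Term.var x).equal (Term.var y)).not (absolute_equal _ _).not (by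
      simpa [Formula.realize_equal] using hne)
    rw [Formula.realize_not, Formula.realize_equal] at this
    exact this hxy
  map_fun' {n} g x := by
    have := h ((Term.func g fun i => Term.var (x i)).equal (Term.var (Structure.funMap g x)))
      (absolute_equal _ _) (by simp [Formula.realize_equal, Term.realize])
    rw [Formula.realize_equal] at this
    exact this.symm
  map_rel' {n} r x := by
    constructor
    · intro hr
      by_contra hne
      have := h (r.formula fun i => Term.var (x i)).not (absolute_rel _ _).not (by
        rw [Formula.realize_not, Formula.realize_rel]
        exact hne)
      rw [Formula.realize_not, Formula.realize_rel] at this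
      exact this hr
    · intro hr
      have := h (r.formula fun i => Term.var (x i)) (absolute_rel _ _) (by
        rw [Formula.realize_rel]
        exact hr)
      rw [Formula.realize_rel] at this
      exact this

end AbsoluteFormulas

section Rich

variable {T : L.Theory} {E X : Type u}

/-- Names for the elements of a rich extension of `E`. -/
inductive Name (L : FirstOrder.Language.{u, u}) (E X : Type u) : Type u
  | base : E → Name L E X
  | wit (Γ : Set (L.Formula (X ⊕ X))) (a : X → Name L E X) (i : X) : Name L E X

/-- A set of formulas to be realized, with parameters. -/
abbrev Req (L : FirstOrder.Language.{u, u}) (E X : Type u) : Type u :=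
  Set (L.Formula (X ⊕ X)) × (X → Name L E X)

namespace Name

/-- The names in use. -/
def active (P : Set (Req L E X)) : Set (Name L E X) :=
  range base ∪ ⋃ p ∈ P, range (wit p.1 p.2)

theorem active_mono {P Q : Set (Req L E X)} (h : P ⊆ Q) : active P ⊆ active Q :=
  union_subset_union_right _ (biUnion_subset_biUnion_left h)

variable [L.Structure E]

/-- A realization of the requirements in `P`. -/
structure IsModel (T : L.Theory) (P : Set (Req L E X)) {M : Type u} [L.Structure M]
    (v : Name L E X → M) : Prop where
  base : ∀ φ : L.Formula E, Absolute T φ → φ.Realize id → φ.Realize (v ∘ base)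
  wit : ∀ p ∈ P, ∀ φ ∈ p.1, φ.Realize (Sum.elim (v ∘ p.2) (v ∘ wit p.1 p.2))

/-- Consistent sets of requirements. -/
structure Good (T : L.Theory) (P : Set (Req L E X)) : Prop where
  absolute : ∀ p ∈ P, ∀ φ ∈ p.1, Absolute T φ
  mem : ∀ p ∈ P, ∀ i, p.2 i ∈ active P
  exists_model : ∃ (M : Type u) (_ : L.Structure M) (v : Name L E X → M), M ⊨ T ∧ IsModel T P v

theorem good_empty [Nonempty E] (hE : E ⊨ T) : Good T (∅ : Set (Req L E X)) where
  absolute := by simp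
  mem := by simp
  exists_model := ⟨E, _, fun | base x => x | wit _ _ _ => Classical.arbitrary E, hE,
    ⟨fun φ _ hφ => hφ, by simp⟩⟩

theorem good_sUnion [Nonempty E] {c : Set (Set (Req L E X))} (hc : IsChain (· ⊆ ·) c)
    (hne : c.Nonempty) (h : ∀ P ∈ c, Good T P) : Good T (⋃₀ c) where
  absolute := fun p ⟨P, hP, hp⟩ => (h P hP).absolute p hp
  mem := fun p ⟨P, hP, hp⟩ i => active_mono (subset_sUnion_of_mem hP) ((h P hP).mem p hp i)
  exists_model := by
    classical
    have : Nonempty (Name L E X) := ⟨base (Classical.arbitrary E)⟩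
    let Φ : Set (Req L E X) → Set (L.Formula (Name L E X)) := fun P =>
      (fun φ : L.Sentence => Formula.relabel Empty.elim φ) '' T ∪
      ((fun φ : L.Formula E => φ.relabel base) '' {φ | Absolute T φ ∧ φ.Realize id} ∪
      ⋃ p ∈ P, (fun φ : L.Formula (X ⊕ X) => φ.relabel (Sum.elim p.2 (wit p.1 p.2))) '' p.1)
    have key : ∀ (M : Type u) [L.Structure M] (v : Name L E X → M) (P : Set (Req L E X)),
        (∀ φ ∈ Φ P, φ.Realize v) ↔ M ⊨ T ∧ IsModel T P v := fun M _ v P => by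
      have hsent : ∀ φ : L.Sentence, (Formula.relabel Empty.elim φ).Realize v ↔ M ⊨ φ := fun φ => by
        rw [Formula.realize_relabel]
        simp only [Sentence.Realize]
        congr! 1
      constructor
      · intro hv
        refine ⟨⟨fun φ hφ => (hsent φ).1 (hv _ (Or.inl ⟨φ, hφ, rfl⟩))⟩, fun φ hφ hφE => ?_,
          fun p hp φ hφ => ?_⟩
        · exact Formula.realize_relabel.1 (hv _ (Or.inr (Or.inl ⟨φ, ⟨hφ, hφE⟩, rfl⟩)))
        · have := Formula.realize_relabel.1
            (hv _ (Or.inr (Or.inr (mem_biUnion hp ⟨φ, hφ, rfl⟩))))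
          rwa [Sum.comp_elim] at this
      · rintro ⟨hM, hv⟩ _ (⟨φ, hφ, rfl⟩ | ⟨φ, ⟨hφ, hφE⟩, rfl⟩ | hφ)
        · exact (hsent φ).2 (hM.realize_of_mem φ hφ)
        · exact Formula.realize_relabel.2 (hv.base φ hφ hφE)
        · obtain ⟨p, hp, ψ, hψ, rfl⟩ := mem_iUnion₂.1 hφ
          refine Formula.realize_relabel.2 ?_
          rw [Sum.comp_elim]
          exact hv.wit p hp ψ hψ
    have hfin : ∀ s : Finset (L.Formula (Name L E X)), (s : Set _) ⊆ Φ (⋃₀ c) →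
        ∃ P ∈ c, (s : Set _) ⊆ Φ P := fun s hs => by
      have hmono : ∀ {P Q : Set (Req L E X)}, P ⊆ Q → Φ P ⊆ Φ Q := fun hPQ =>
        union_subset_union_right _ (union_subset_union_right _ (biUnion_subset_biUnion_left hPQ))
      induction s using Finset.induction_on with
      | empty =>
        obtain ⟨P, hP⟩ := hne
        exact ⟨P, hP, by simp⟩
      | insert φ s hφs ih =>
        rw [Finset.coe_insert, insert_subset_iff] at hs
        obtain ⟨P, hP, hsP⟩ := ih hs.2
        have : ∃ Q ∈ c, φ ∈ Φ Q := by
          rcases hs.1 with h1 | h1 | h1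
          · exact ⟨P, hP, Or.inl h1⟩
          · exact ⟨P, hP, Or.inr (Or.inl h1)⟩
          · obtain ⟨p, ⟨Q, hQ, hp⟩, h1⟩ := mem_iUnion₂.1 h1
            exact ⟨Q, hQ, Or.inr (Or.inr (mem_biUnion hp h1))⟩
        obtain ⟨Q, hQ, hφQ⟩ := this
        rcases hc.total hP hQ with h1 | h1
        · refine ⟨Q, hQ, ?_⟩
          rw [Finset.coe_insert]
          exact insert_subset hφQ (hsP.trans (hmono h1))
        · refine ⟨P, hP, ?_⟩
          rw [Finset.coe_insert]
          exact insert_subset (hmono h1 hφQ) hsP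
    obtain ⟨M, _, v, hv⟩ := compactness (Φ (⋃₀ c)) fun s hs => by
      obtain ⟨P, hP, hsP⟩ := hfin s hs
      obtain ⟨M, _, v, hM, hv⟩ := (h P hP).exists_model
      exact ⟨M, _, v, fun φ hφ => (key M v P).2 ⟨hM, hv⟩ φ (hsP hφ)⟩
    exact ⟨M, _, v, (key M v _).1 hv⟩

theorem mem_of_isModel {P : Set (Req L E X)} (hP : Maximal (Good T) P) {p : Req L E X}
    (hp : ∀ φ ∈ p.1, Absolute T φ) (ha : ∀ i, p.2 i ∈ active P) {M : Type u} [L.Structure M]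
    (hM : M ⊨ T) {v : Name L E X → M} (hv : IsModel T P v) (y : X → M)
    (hy : ∀ φ ∈ p.1, φ.Realize (Sum.elim (v ∘ p.2) y)) : p ∈ P := by
  classical
  by_contra hpP
  let v' : Name L E X → M
    | base x => v (base x)
    | wit Γ a i => if (Γ, a) = p then y i else v (wit Γ a i)
  have h1 : ∀ w ∈ active P, v' w = v w := by
    rintro w (⟨x, rfl⟩ | hw)
    · rfl
    · obtain ⟨q, hq, i, rfl⟩ := mem_iUnion₂.1 hw
      have : q ≠ p := fun h => hpP (h ▸ hq)
      exact if_neg this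
  have h2 : ∀ q : Req L E X, q ≠ p → v' ∘ wit q.1 q.2 = v ∘ wit q.1 q.2 := fun q hq =>
    funext fun i => if_neg hq
  have h3 : v' ∘ wit p.1 p.2 = y := funext fun i => if_pos rfl
  refine hpP (hP.2 (y := insert p P) ⟨?_, ?_, M, _, v', hM, ⟨hv.base, ?_⟩⟩ (subset_insert _ _)
    (mem_insert _ _))
  · rintro q (rfl | hq)
    exacts [hp, hP.1.absolute q hq]
  · rintro q (rfl | hq) i
    · exact active_mono (subset_insert _ _) (ha i)
    · exact active_mono (subset_insert _ _) (hP.1.mem q hq i)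
  · rintro q (rfl | hq) φ hφ
    · rw [h3, show v' ∘ q.2 = v ∘ q.2 from funext fun i => h1 _ (ha i)]
      exact hy φ hφ
    · rw [h2 q fun h => hpP (h ▸ hq),
        show v' ∘ q.2 = v ∘ q.2 from funext fun i => h1 _ (hP.1.mem q hq i)]
      exact hv.wit q hq φ hφ

end Name

variable [L.Structure E]

/-- Every set of absolute formulas with parameters indexed by `X` which is realized in a model
extending `E` is realized in `E`. -/
def Rich (T : L.Theory) (X : Type u) (E : Type u) [L.Structure E] : Prop :=
  ∀ (Γ : Set (L.Formula (X ⊕ X))) (a : X → E), (∀ φ ∈ Γ, Absolute T φ) →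
    ∀ (M : Type u) [L.Structure M], M ⊨ T → ∀ (f : E ↪[L] M) (y : X → M),
      (∀ φ ∈ Γ, φ.Realize (Sum.elim (f ∘ a) y)) → ∃ x : X → E, ∀ φ ∈ Γ, φ.Realize (Sum.elim a x)

theorem exists_rich (hT : IsUniversalTheory T) [Infinite E] (hE : E ⊨ T) (X : Type u)
    [Infinite X] : ∃ (N : Type u) (_ : L.Structure N) (_ : E ↪[L] N), N ⊨ T ∧ Rich T X N := by
  classical
  obtain ⟨P, -, hP⟩ := zorn_subset_nonempty {P : Set (Req L E X) | Name.Good T P}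
    (fun c hc hchain hne => ⟨⋃₀ c, Name.good_sUnion hchain hne hc,
      fun s hs => subset_sUnion_of_mem hs⟩) ∅ (Name.good_empty hE)
  replace hP : Maximal (Name.Good T) P := hP
  obtain ⟨M, _, v, hM, hv⟩ := hP.1.exists_model
  let N : L.Substructure M :=
    { carrier := v '' Name.active P
      fun_mem := fun {n} g x hx => by
        choose w hw hwx using hx
        let j : Fin n ↪ X := Fin.valEmbedding.trans (Infinite.natEmbedding X)
        let a : X → Name L E X := Function.extend j w fun _ => Name.base (Classical.arbitrary E)
        have ha : ∀ i, a (j i) = w i := fun i => j.injective.extend_apply _ _ _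
        have hact : ∀ i, a i ∈ Name.active P := fun i => by
          by_cases hi : ∃ k, j k = i
          · obtain ⟨k, rfl⟩ := hi
            rw [ha]
            exact hw k
          · have : a i = Name.base (Classical.arbitrary E) := Function.extend_apply' _ _ _ hi
            rw [this]
            exact Or.inl ⟨_, rfl⟩
        let i₀ : X := Classical.arbitrary X
        let φ : L.Formula (X ⊕ X) :=
          (Term.var (Sum.inr i₀)).equal (Term.func g fun i => Term.var (Sum.inl (j i)))
        have hφ : ∀ y : X → M, φ.Realize (Sum.elim (v ∘ a) y) ↔ y i₀ = Structure.funMap g x :=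
          fun y => by
            rw [Formula.realize_equal]
            simp only [Term.realize, Sum.elim_inr, Sum.elim_inl, Function.comp_apply, ha, hwx]
        have hmem : (({φ}, a) : Req L E X) ∈ P := by
          refine Name.mem_of_isModel hP (fun ψ hψ => ?_) hact hM hv
            (fun _ => Structure.funMap g x) fun ψ hψ => ?_
          · rw [mem_singleton_iff.1 hψ]
            exact absolute_equal _ _
          · rw [mem_singleton_iff.1 hψ]
            exact (hφ _).2 rfl
        have := hv.wit _ hmem φ rfl
        rw [hφ] at this
        exact ⟨_, Or.inr (mem_biUnion hmem ⟨i₀, rfl⟩), this⟩ }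
  have hmem : ∀ {w}, w ∈ Name.active P → v w ∈ N := fun hw => ⟨_, hw, rfl⟩
  have hNT : N ⊨ T := models_of_embedding hT N.subtype hM
  let e₀ : E ↪[L] M := embeddingOfAbsolute hv.base
  let e : E ↪[L] N := Embedding.codRestrict N e₀ fun x => hmem (Or.inl ⟨x, rfl⟩)
  have : Infinite N := Infinite.of_injective e e.injective
  have : Infinite M := Infinite.of_injective e₀ e₀.injective
  refine ⟨N, _, e, hNT, fun Γ a hΓ M' _ hM' f y hy => ?_⟩
  have : Infinite M' := Infinite.of_injective f f.injective
  have hw : ∀ i, ∃ w ∈ Name.active P, v w = a i := fun i => (a i).2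
  choose w hw hwa using hw
  let v' : Name L E X → M' := fun x =>
    if hx : x ∈ Name.active P then f ⟨v x, hmem hx⟩ else Classical.arbitrary M'
  have hv' : ∀ {x} (hx : x ∈ Name.active P), v' x = f ⟨v x, hmem hx⟩ := fun hx => dif_pos hx
  have htrans : ∀ {β : Type u} (φ : L.Formula β), Absolute T φ → ∀ x : β → Name L E X,
      (∀ i, x i ∈ Name.active P) → φ.Realize (v ∘ x) → φ.Realize (v' ∘ x) := fun φ hφ x hx h => by
    have h1 : φ.Realize fun i => (⟨v (x i), hmem (hx i)⟩ : N) := (hφ N M hNT hM N.subtype _).2 h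
    rw [hφ N M' hNT hM' f] at h1
    convert h1 using 1
    funext i
    exact hv' (hx i)
  have hwit : ∀ p ∈ P, ∀ i, Name.wit p.1 p.2 i ∈ Name.active P := fun p hp i =>
    Or.inr (mem_biUnion hp ⟨i, rfl⟩)
  have hp : ((Γ, w) : Req L E X) ∈ P := by
    refine Name.mem_of_isModel hP hΓ hw hM' (v := v') ⟨fun φ hφ h => ?_, fun p hp φ hφ => ?_⟩ y
      fun φ hφ => ?_
    · exact htrans φ hφ Name.base (fun i => Or.inl ⟨i, rfl⟩) (hv.base φ hφ h)
    · have h1 := htrans φ (hP.1.absolute p hp φ hφ) (Sum.elim p.2 (Name.wit p.1 p.2)) (by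
        rintro (i | i)
        exacts [hP.1.mem p hp i, hwit p hp i])
      rw [Sum.comp_elim, Sum.comp_elim] at h1
      exact h1 (hv.wit p hp φ hφ)
    · convert hy φ hφ using 2
      funext i
      refine (hv' (hw i)).trans (congrArg f (Subtype.ext (hwa i)))
  refine ⟨fun i => ⟨v (Name.wit Γ w i), hmem (hwit _ hp i)⟩, fun φ hφ => ?_⟩
  have h1 := hv.wit _ hp φ hφ
  rw [hΓ φ hφ N M hNT hM N.subtype, Sum.comp_elim]
  convert h1 using 2
  · funext i
    exact (hwa i).symm
  · rfl

end Rich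

section Closing

variable {T : L.Theory} {E : Type u} [L.Structure E]

theorem FinSat.comp {A C : Set E} {ι ι' : Type} {b : ι → E} (h : FinSat T A C b) (g : ι' → ι) :
    FinSat T A C (b ∘ g) := fun φ hφ hb => by
  obtain ⟨x, hx, hφx⟩ := h (φ.relabel (Sum.map id g)) (hφ.relabel _) (by
    rw [Formula.realize_relabel, Sum.elim_comp_map]
    exact hb)
  rw [Formula.realize_relabel, Sum.elim_comp_map] at hφx
  exact ⟨x ∘ g, fun i => hx _, hφx⟩

/-- Absolute formulas over `S` with a solution have one in `S`. -/
def ExClosed (T : L.Theory) (S : Set E) : Prop :=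
  ∀ {ι : Type} [Finite ι] (φ : L.Formula (S ⊕ ι)), Absolute T φ →
    (∃ x : ι → E, φ.Realize (Sum.elim (↑) x)) → ∃ x : ι → E, (∀ i, x i ∈ S) ∧
      φ.Realize (Sum.elim (↑) x)

variable {κ θ : Cardinal.{u}} {Ω : Type u} [LinearOrder Ω]

theorem exists_closing (hT : IsUniversalTheory T) (hκ : ℵ₀ < κ) (hTκ : KUnique T κ)
    (hΩ : IsSuccType θ Ω) (hθκ : θ < κ) (hE : E ⊨ T) {Z : Set E} (hZ : #Z ≤ θ)
    [Infinite (Substructure.closure L Z)]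
    (hgen : ∀ W : Set E, #W ≤ θ → ∃ x, x ∉ Substructure.closure L W) :
    ∃ (B : Ω → Set E) (e : Ω → E), (∀ a, #(B a) ≤ θ) ∧
      (∀ a, e a ∈ B a ∧ e a ∉ Substructure.closure L (stage Z B a)) ∧
      ∀ (u : Ω → Ω) (a₀ : Ω), ∃ d, a₀ < d ∧ (∀ a < d, u a < d) ∧ ∀ {ι : Type} [Finite ι]
        (b : ι → E), ∃ a < d, FinSat T (Substructure.closure L (stage Z B a) : Set E)
          (Substructure.closure L (stage Z B d)) b := by
  classical
  have hwf := hΩ.wf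
  have : Nonempty E := ⟨((Classical.arbitrary (Substructure.closure L Z) :) : E)⟩
  let bad : (Ω → Set E) → Ω → (Σ n : ℕ, Fin n → E) → Prop := fun B d b => ∀ a < d,
    ¬ FinSat T (Substructure.closure L (stage Z B a) : Set E)
      (Substructure.closure L (stage Z B d)) b.2
  let x : (Ω → Set E) → Ω → E := fun B d => Classical.epsilon
    fun x => x ∉ Substructure.closure L (stage Z B d)
  let w : ((Σ n : ℕ, Fin n → E) → Prop) → Set E := fun P =>
    if h : ∃ b, P b then range h.choose.2 else ∅
  let G : (Ω → Set E) → Ω → Set E := fun B d => insert (x B d) (w (bad B d))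
  let H : ∀ d : Ω, (∀ a, a < d → Set E) → Set E := fun d h =>
    G (fun a => if ha : a < d then h a ha else ∅) d
  let B : Ω → Set E := (wellFounded_lt (α := Ω)).fix H
  have hst : ∀ d, ∀ a ≤ d, stage Z (fun a => if a < d then B a else ∅) a = stage Z B a :=
    fun d a had => by
      unfold stage
      congr 1
      refine iUnion_congr fun b => iUnion_congr fun hb => ?_
      exact if_pos (hb.trans_le had)
  have hBG : ∀ d, B d = G B d := fun d => by
    have h1 : B d = G (fun a => if a < d then B a else ∅) d := by
      change (wellFounded_lt (α := Ω)).fix H d = _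
      rw [WellFounded.fix_eq]
      simp only [H, dite_eq_ite]
      rfl
    rw [h1]
    have hx : x (fun a => if a < d then B a else ∅) d = x B d := by
      simp only [x, hst d d le_rfl]
    have hbad : bad (fun a => if a < d then B a else ∅) d = bad B d := by
      funext b
      simp only [bad, hst d d le_rfl, eq_iff_iff]
      refine forall_congr' fun a => forall_congr' fun ha => ?_
      rw [hst d a ha.le]
    simp only [G, hx, hbad]
  have hB : ∀ a, #(B a) ≤ θ := fun a => by
    refine hΩ.mk_le_of_countable ?_
    rw [hBG]
    refine Countable.insert _ ?_
    simp only [w]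
    split_ifs
    exacts [countable_range _, countable_empty]
  refine ⟨B, x B, hB, fun a => ⟨?_, ?_⟩, fun u a₀ => ?_⟩
  · rw [hBG]
    exact mem_insert _ _
  · exact Classical.epsilon_spec (hgen _ (mk_stage_le hΩ hZ hB a))
  · obtain ⟨d, h0, -, hu, hd⟩ := exists_finSat_stage hT hκ hTκ hΩ hθκ hE hZ hB u a₀
    have hnb : ¬ ∃ b, bad B d b := fun h => by
      have hsub : range h.choose.2 ⊆ B d := by
        rw [hBG]
        simp only [G, w, dif_pos h]
        exact subset_insert _ _
      obtain ⟨a, ha, hfs⟩ := hd h.choose.2 fun k => Substructure.subset_closure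
        (Or.inr (mem_iUnion.2 ⟨d, hsub ⟨k, rfl⟩⟩))
      exact h.choose_spec a ha hfs
    refine ⟨d, h0, hu, fun {ι} _ b => ?_⟩
    obtain ⟨n, ⟨g⟩⟩ := Finite.exists_equiv_fin ι
    have h1 : ¬ bad B d ⟨n, b ∘ g.symm⟩ := fun h => hnb ⟨_, h⟩
    simp only [bad, not_forall, not_not] at h1
    obtain ⟨a, ha, h1⟩ := h1
    refine ⟨a, ha, ?_⟩
    have h2 := h1.comp g
    rwa [Function.comp_assoc, Equiv.symm_comp_self, Function.comp_id] at h2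

theorem infinite_of_forall_exists_notMem
    (hgen : ∀ W : Set E, #W ≤ ℵ₀ → ∃ x, x ∉ Substructure.closure L W) : Infinite E := by
  by_contra h
  rw [not_infinite_iff_finite] at h
  obtain ⟨x, hx⟩ := hgen Set.univ (le_aleph0_iff_set_countable.2 (Set.countable_univ))
  exact hx (Substructure.subset_closure (mem_univ _))

theorem exists_exClosed (hT : IsUniversalTheory T) (hκ : ℵ₀ < κ) (hTκ : KUnique T κ)
    (hθ : ℵ₀ ≤ θ) (hθκ : θ < κ) (hE : E ⊨ T)
    (hgen : ∀ W : Set E, #W ≤ θ → ∃ x, x ∉ Substructure.closure L W) {S : Set E} (hS : #S ≤ θ) :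
    ∃ A : Set E, S ⊆ A ∧ #A ≤ θ ∧ ExClosed T (Substructure.closure L A : Set E) := by
  obtain ⟨Ω, _, hΩ⟩ := exists_isSuccType hθ
  have : Infinite E := infinite_of_forall_exists_notMem fun W hW => hgen W (hW.trans hθ)
  let g := Infinite.natEmbedding E
  have hZ : #(S ∪ range g : Set E) ≤ θ :=
    hΩ.mk_union_le hS (hΩ.mk_le_of_countable (countable_range _))
  have : Infinite (Substructure.closure L (S ∪ range g)) :=
    ((infinite_range_of_injective g.injective).mono
      (subset_union_right.trans Substructure.subset_closure)).to_subtype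
  obtain ⟨B, e, hB, -, hcl⟩ := exists_closing hT hκ hTκ hΩ hθκ hE hZ hgen
  obtain ⟨a₀, -⟩ := hΩ.exists_gt (hΩ.mk_le_of_countable countable_empty)
  obtain ⟨d, -, -, hd⟩ := hcl id a₀
  refine ⟨stage (S ∪ range g) B d, subset_union_left.trans subset_union_left,
    mk_stage_le hΩ hZ hB d, fun {ι} _ φ hφ ⟨x, hx⟩ => ?_⟩
  obtain ⟨a, ha, hfs⟩ := hd x
  obtain ⟨y, hy, hφy⟩ := hfs φ hφ hx
  exact ⟨y, fun i => Substructure.closure_mono (stage_mono _ _ ha.le) (hy i), hφy⟩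

theorem exists_not_subset_closure (hT : IsUniversalTheory T) (hκ : ℵ₀ < κ) (hTκ : KUnique T κ)
    (hθ : ℵ₀ ≤ θ) (hθκ : θ < κ) (hE : E ⊨ T)
    (hgen : ∀ W : Set E, #W ≤ θ → ∃ x, x ∉ Substructure.closure L W) :
    ∃ Y : Set E, #Y ≤ Order.succ θ ∧
      ∀ W : Set E, #W ≤ θ → ¬ Y ⊆ Substructure.closure L W := by
  classical
  obtain ⟨Ω, _, hΩ⟩ := exists_isSuccType hθ
  have : Infinite E := infinite_of_forall_exists_notMem fun W hW => hgen W (hW.trans hθ)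
  let g := Infinite.natEmbedding E
  have hZ : #(range g : Set E) ≤ θ := hΩ.mk_le_of_countable (countable_range _)
  have : Infinite (Substructure.closure L (range g)) :=
    ((infinite_range_of_injective g.injective).mono Substructure.subset_closure).to_subtype
  obtain ⟨B, e, hB, he, hcl⟩ := exists_closing hT hκ hTκ hΩ hθκ hE hZ hgen
  refine ⟨range e, mk_range_le.trans hΩ.mk_eq.le, fun W hW hsub => ?_⟩
  have hF : ∀ a, ∃ F : Finset W, e a ∈ Substructure.closure L (Subtype.val '' (F : Set W)) :=
    fun a => by
      obtain ⟨s, hs, hes⟩ := exists_finset_of_mem_closure (hsub ⟨a, rfl⟩)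
      refine ⟨s.subtype (· ∈ W), Substructure.closure_mono (fun x hx => ?_) hes⟩
      exact ⟨⟨x, hs hx⟩, by simpa using hx, rfl⟩
  choose F hF using hF
  have hunb : ∃ F₀, ∀ a, ∃ b, a < b ∧ F b = F₀ := by
    by_contra! hcon
    choose a ha using hcon
    have h1 : (⋃ G ∈ (Set.univ : Set (Finset W)), {b | F b = G}) = Set.univ :=
      eq_univ_of_forall fun b => mem_biUnion (mem_univ (F b)) rfl
    have h2 : #(⋃ G ∈ (Set.univ : Set (Finset W)), {b | F b = G}) ≤ θ := by
      refine hΩ.mk_biUnion_le ?_ fun G _ => ?_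
      · rw [mk_univ]
        rcases finite_or_infinite W with h | h
        · exact (mk_le_aleph0).trans hθ
        · rw [mk_finset_of_infinite]
          exact hW
      · refine (mk_le_mk_of_subset (fun b hb => ?_ : _ ⊆ Iic (a G))).trans (hΩ.mk_Iic_le _)
        exact le_of_not_gt fun h => ha G b h hb
    rw [h1, mk_univ, hΩ.mk_eq] at h2
    exact absurd h2 (not_le.2 (Order.lt_succ θ))
  obtain ⟨F₀, hF₀⟩ := hunb
  choose u hu huF using hF₀
  obtain ⟨a₀, -⟩ := hΩ.exists_gt (hΩ.mk_le_of_countable countable_empty)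
  obtain ⟨d, -, hud, hd⟩ := hcl u a₀
  obtain ⟨n, ⟨σ⟩⟩ := Finite.exists_equiv_fin F₀
  let y : Fin n → E := fun i => ((σ.symm i : F₀) : W)
  obtain ⟨a, ha, hfs⟩ := hd y
  obtain ⟨t, ht⟩ := exists_terms (Subtype.val '' (F₀ : Set W)) y (by
    rintro _ ⟨w, hw, rfl⟩
    exact ⟨σ ⟨w, hw⟩, by simp [y]⟩) (fun _ : Unit => e (u a)) (fun _ => by
      have := hF (u a)
      rwa [huF] at this)
  have hmem : e (u a) ∈ stage (range g) B d := Or.inr (mem_biUnion (hud a ha) (he (u a)).1)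
  obtain ⟨x, hx, hφ⟩ := hfs (((t ()).relabel Sum.inr).equal
    (Term.var (Sum.inl ⟨e (u a), Substructure.subset_closure hmem⟩))) (absolute_equal _ _) (by
      rw [Formula.realize_equal]
      simpa using ht ())
  rw [Formula.realize_equal] at hφ
  simp only [Term.realize_relabel, Sum.elim_comp_inr, Term.realize_var, Sum.elim_inl] at hφ
  refine (he (u a)).2 ?_
  rw [← hφ]
  exact Substructure.closure_mono (stage_mono _ _ (hu a).le) (realize_mem_closure _ _ _ hx)

end Closing

section Support

variable {T : L.Theory} {α : Type*} {ι : Type*}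

theorem exists_finset_params (φ : L.Formula (α ⊕ ι)) : ∃ (F : Finset α) (ψ : L.Formula (F ⊕ ι)),
    (∀ (M : Type u) [L.Structure M] (a : α → M) (x : ι → M),
      φ.Realize (Sum.elim a x) ↔ ψ.Realize (Sum.elim (fun i : F => a i) x)) ∧
    (Absolute T φ → Absolute T ψ) := by
  classical
  obtain ⟨s, ψ, hψ⟩ := exists_finset_formula φ
  let F : Finset α := s.biUnion (Sum.elim (fun a => {a}) fun _ => ∅)
  have hF : ∀ a, Sum.inl a ∈ s → a ∈ F := fun a ha => Finset.mem_biUnion.2 ⟨_, ha, by simp⟩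
  let g : s → F ⊕ ι := fun k => match h : (k : α ⊕ ι) with
    | Sum.inl a => Sum.inl ⟨a, hF a (h ▸ k.2)⟩
    | Sum.inr i => Sum.inr i
  have hg : ∀ (k : s), Sum.map Subtype.val id (g k) = (k : α ⊕ ι) := by
    rintro ⟨a | i, h⟩ <;> rfl
  have key : ∀ (M : Type u) [L.Structure M] (a : α → M) (x : ι → M),
      φ.Realize (Sum.elim a x) ↔ (ψ.relabel g).Realize (Sum.elim (fun i : F => a i) x) :=
    fun M _ a x => by
      rw [hψ, Formula.realize_relabel]
      congr! 1
      funext k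
      rw [← hg k]
      rcases h : g k with i | i <;> simp [h]
  refine ⟨F, ψ.relabel g, key, fun h M N _ _ _ _ hM hN f v => ?_⟩
  let v' : α → M := fun a => if ha : a ∈ F then v (Sum.inl ⟨a, ha⟩) else Classical.arbitrary M
  have hv : v = Sum.elim (fun i : F => v' i) (v ∘ Sum.inr) := by
    funext k
    rcases k with k | k
    · simp [v']
    · rfl
  have h1 := h M N hM hN f (Sum.elim v' (v ∘ Sum.inr))
  rw [key, Sum.comp_elim, key] at h1
  rw [hv, h1, Sum.comp_elim]
  rfl

end Support

section Closed

variable {T : L.Theory} {E : Type u} [L.Structure E]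

theorem ExClosed.exists_realize {S : Set E} (h : ExClosed T S) {α : Type*} {ι : Type} [Finite ι]
    {φ : L.Formula (α ⊕ ι)} (hφ : Absolute T φ) {a : α → E} (ha : ∀ i, a i ∈ S)
    (hx : ∃ x, φ.Realize (Sum.elim a x)) :
    ∃ x : ι → E, (∀ i, x i ∈ S) ∧ φ.Realize (Sum.elim a x) := by
  have h1 : ∀ x : ι → E, (φ.relabel (Sum.map (fun i => (⟨a i, ha i⟩ : S)) id)).Realize
      (Sum.elim (↑) x) ↔ φ.Realize (Sum.elim a x) := fun x => by
    rw [Formula.realize_relabel, Sum.elim_comp_map]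
    rfl
  obtain ⟨x, hx⟩ := hx
  obtain ⟨y, hy, hφy⟩ := h _ (hφ.relabel _) ⟨x, (h1 x).2 hx⟩
  exact ⟨y, hy, (h1 y).1 hφy⟩

theorem exists_closed_under {χ : Cardinal.{u}} (hχ : ℵ₀ ≤ χ) (R : Finset E → Set E)
    (hR : ∀ s, #(R s) ≤ χ) {X₀ : Set E} (hX₀ : #X₀ ≤ χ) :
    ∃ X : Set E, X₀ ⊆ X ∧ #X ≤ χ ∧ ∀ s : Finset E, (s : Set E) ⊆ X → R s ⊆ X := by
  classical
  let step : Set E → Set E := fun X => X ∪ ⋃ s : Finset X, R (s.map (Function.Embedding.subtype _))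
  have hstep : ∀ X : Set E, #X ≤ χ → #(step X) ≤ χ := fun X hX => by
    refine (Cardinal.mk_union_le _ _).trans (add_le_of_le hχ hX ?_)
    refine (mk_iUnion_le _).trans (mul_le_of_le hχ ?_ (ciSup_le' fun _ => hR _))
    rcases finite_or_infinite X with h | h
    · exact mk_le_aleph0.trans hχ
    · rw [mk_finset_of_infinite]
      exact hX
  let X : ℕ → Set E := fun n => step^[n] X₀
  have hX : ∀ n, X (n + 1) = step (X n) := fun n => Function.iterate_succ_apply' _ _ _
  have hmono : Monotone X := monotone_nat_of_le_succ fun n => by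
    rw [hX]
    exact subset_union_left
  refine ⟨⋃ n, X n, subset_iUnion X 0, ?_, fun s hs => ?_⟩
  · have h1 : #(⋃ n : ULift.{u} ℕ, X n.down) ≤ χ := by
      refine (mk_iUnion_le _).trans (mul_le_of_le hχ (mk_le_aleph0.trans hχ)
        (ciSup_le' fun n => ?_))
      rcases n with ⟨n⟩
      induction n with
      | zero => exact hX₀
      | succ n ih =>
        change #(X (n + 1)) ≤ χ
        rw [hX]
        exact hstep _ ih
    rwa [show (⋃ n : ULift.{u} ℕ, X n.down) = ⋃ n, X n from
      (Equiv.ulift.surjective.iUnion_comp X)] at h1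
  · obtain ⟨n, hn⟩ : ∃ n, (s : Set E) ⊆ X n := by
      have : ∀ x ∈ s, ∃ n, x ∈ X n := fun x hx => mem_iUnion.1 (hs hx)
      choose! n hn using this
      exact ⟨s.sup n, fun x hx => hmono (Finset.le_sup hx) (hn x hx)⟩
    refine Set.Subset.trans ?_ (subset_iUnion X (n + 1))
    rw [hX]
    refine Set.Subset.trans ?_ subset_union_right
    have : (s.subtype (· ∈ X n)).map (Function.Embedding.subtype _) = s :=
      Finset.subtype_map_of_mem fun x hx => hn hx
    refine Set.Subset.trans ?_ (subset_iUnion _ (s.subtype (· ∈ X n)))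
    rw [this]

theorem exists_finset_forall_mem_closure {α : Type*} [Finite α] {X : Set E} {a : α → E}
    (h : ∀ i, a i ∈ Substructure.closure L X) :
    ∃ s : Finset E, (s : Set E) ⊆ X ∧ ∀ i, a i ∈ Substructure.closure L (s : Set E) := by
  classical
  cases nonempty_fintype α
  choose s hs ha using fun i => exists_finset_of_mem_closure (h i)
  refine ⟨Finset.univ.biUnion s, ?_, fun i => Substructure.closure_mono ?_ (ha i)⟩
  · rw [Finset.coe_biUnion]
    exact iUnion₂_subset fun i _ => hs i
  · exact Finset.coe_subset.2 (Finset.subset_biUnion_of_mem s (Finset.mem_univ i))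

theorem exClosed_of_closed_under {X : Set E} {R : Finset E → Set E}
    (hR : ∀ s : Finset E, (s : Set E) ⊆ R s)
    (hRT : ∀ s, ExClosed T (Substructure.closure L (R s) : Set E))
    (hX : ∀ s : Finset E, (s : Set E) ⊆ X → R s ⊆ X) :
    ExClosed T (Substructure.closure L X : Set E) := by
  intro ι _ φ hφ ⟨x, hx⟩
  obtain ⟨F, ψ, hψ, hψT⟩ := exists_finset_params (T := T) φ
  obtain ⟨s, hs, hsF⟩ := exists_finset_forall_mem_closure (α := F)
    (a := fun i => ((i : (Substructure.closure L X : Set E)) : E)) fun i => i.1.2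
  obtain ⟨y, hy, hψy⟩ := ExClosed.exists_realize (hRT s) (hψT hφ)
    (a := fun i : F => ((i : (Substructure.closure L X : Set E)) : E))
    (fun i => Substructure.closure_mono (hR s) (hsF i)) ⟨x, (hψ E _ x).1 hx⟩
  exact ⟨y, fun i => Substructure.closure_mono (hX s hs) (hy i), (hψ E _ y).2 hψy⟩

end Closed

section Large

variable {T : L.Theory}

theorem exists_model_card {M : Type u} [L.Structure M] [Infinite M] (hM : M ⊨ T)
    {μ : Cardinal.{u}} (hμ : max L.card ℵ₀ ≤ μ) :
    ∃ (N : Type u) (_ : L.Structure N), N ⊨ T ∧ #N = μ := by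
  obtain ⟨N, h, hN⟩ := exists_elementaryEmbedding_card_eq L M μ ((le_max_right _ _).trans hμ)
    (by simpa using (le_max_left _ _).trans hμ)
  refine ⟨N, inferInstance, ?_, hN⟩
  rcases h with ⟨⟨f⟩⟩ | ⟨⟨f⟩⟩
  · exact (f.theory_model_iff T).2 hM
  · exact (f.theory_model_iff T).1 hM

theorem mk_closure_le {M : Type u} [L.Structure M] (X : Set M) {μ : Cardinal.{u}}
    (hμ : max L.card ℵ₀ ≤ μ) (hX : #X ≤ μ) : #(Substructure.closure L X) ≤ μ := by
  have h1 := Substructure.lift_card_closure_le (L := L) (s := X)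
  rw [lift_id, lift_id, lift_id] at h1
  have h2 : #(Σ i, L.Functions i) ≤ μ := by
    refine le_trans ?_ ((le_max_left _ _).trans hμ)
    exact mk_le_of_injective (f := fun x => (Sum.inl x : L.Symbols)) Sum.inl_injective
  exact h1.trans (max_le ((le_max_right _ _).trans hμ)
    (add_le_of_le ((le_max_right _ _).trans hμ) hX h2))

theorem exists_notMem_closure {M : Type u} [L.Structure M] {μ : Cardinal.{u}}
    (hμ : max L.card ℵ₀ ≤ μ) (hM : μ < #M) (X : Set M) (hX : #X ≤ μ) :
    ∃ x, x ∉ Substructure.closure L X := by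
  by_contra! h
  have h1 : #M ≤ #(Substructure.closure L X) :=
    mk_le_of_injective (f := fun x => (⟨x, h x⟩ : Substructure.closure L X)) fun x y hxy =>
      congrArg Subtype.val hxy
  exact absurd (h1.trans (mk_closure_le X hμ hX)) (not_le.2 hM)

theorem infinite_of_strictlyGenerated {M : Type u} [L.Structure M] {κ : Cardinal.{u}} (hκ : ℵ₀ < κ)
    (hM : StrictlyGenerated L M κ) : Infinite M := by
  obtain ⟨X, hX, -⟩ := hM.1
  have : Infinite X := infinite_iff.2 (hX ▸ hκ.le)
  exact Infinite.of_injective (Subtype.val : X → M) Subtype.val_injective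

end Large

section Existential

variable {T : L.Theory} {κ : Cardinal.{u}}

/-- Absolute formulas over `M` solvable in a model extending `M` are solvable in `M`. -/
def EClosed (T : L.Theory) (M : Type u) [L.Structure M] : Prop :=
  ∀ (N : Type u) [L.Structure N], N ⊨ T → ∀ (f : M ↪[L] N) {α : Type u} {ι : Type} [Finite ι]
    (φ : L.Formula (α ⊕ ι)), Absolute T φ → ∀ a : α → M,
    (∃ x, φ.Realize (Sum.elim (f ∘ a) x)) → ∃ x, φ.Realize (Sum.elim a x)

theorem exists_exClosed_strictlyGenerated (hT : IsUniversalTheory T) (hκ : ℵ₀ < κ)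
    (hTκ : KUnique T κ) {E : Type u} [L.Structure E] (hE : E ⊨ T)
    (hgen : ∀ W : Set E, #W ≤ κ → ∃ x, x ∉ Substructure.closure L W) :
    ∃ X : Set E, ExClosed T (Substructure.closure L X : Set E) ∧
      StrictlyGenerated L (Substructure.closure L X) κ := by
  choose! Y hY hYW using fun (θ : Cardinal.{u}) (hθ : ℵ₀ ≤ θ ∧ θ < κ) =>
    exists_not_subset_closure hT hκ hTκ hθ.1 hθ.2 hE fun W hW => hgen W (hW.trans hθ.2.le)
  choose R hR hRc hRT using fun s : Finset E => exists_exClosed hT hκ hTκ le_rfl hκ hE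
    (fun W hW => hgen W (hW.trans hκ.le)) (S := (s : Set E)) (mk_le_aleph0)
  let t : κ.ord.ToType → Cardinal.{u} := fun i => max ℵ₀ #(Iio i)
  have ht : ∀ i, ℵ₀ ≤ t i ∧ t i < κ := fun i =>
    ⟨le_max_left _ _, max_lt hκ ((mk_Iio_lt i (by simp)).trans_eq (mk_ord_toType _))⟩
  have hX₀ : #(⋃ i, Y (t i)) ≤ κ := by
    refine (mk_iUnion_le _).trans (mul_le_of_le hκ.le (mk_ord_toType κ).le (ciSup_le' fun i => ?_))
    exact (hY _ (ht i)).trans (Order.succ_le_of_lt (ht i).2)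
  obtain ⟨X, hX₀X, hX, hXR⟩ := exists_closed_under hκ.le R (fun s => (hRc s).trans hκ.le) hX₀
  have hlt : ∀ W : Set E, #W < κ → ¬ X ⊆ Substructure.closure L W := fun W hW hsub => by
    have h1 : (#W).ord < Ordinal.type fun x y : κ.ord.ToType => x < y := by
      rw [Ordinal.type_toType]
      exact ord_lt_ord.2 hW
    obtain ⟨i, hi⟩ := Ordinal.typein_surj _ h1
    have h2 : #(Iio i) = #W := by
      have := Ordinal.card_typein (r := fun x y : κ.ord.ToType => x < y) i
      rw [hi, card_ord] at this
      exact this.symm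
    refine hYW _ (ht i) W ?_ ((subset_iUnion (fun i => Y (t i)) i).trans (hX₀X.trans hsub))
    rw [← h2]
    exact le_max_right _ _
  refine ⟨X, exClosed_of_closed_under hR hRT hXR, strictlyGenerated_of X ?_ fun W _ => hlt W⟩
  refine le_antisymm hX (le_of_not_gt fun h => hlt X h Substructure.subset_closure)

theorem Rich.exists_realize {E X : Type u} [L.Structure E] [Infinite E] [Infinite X]
    (h : Rich T X E) (M : Type u) [L.Structure M] (hM : M ⊨ T) (f : E ↪[L] M) {α : Type*}
    {ι : Type} [Finite ι] {φ : L.Formula (α ⊕ ι)} (hφ : Absolute T φ) (a : α → E)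
    (hx : ∃ x, φ.Realize (Sum.elim (f ∘ a) x)) : ∃ x, φ.Realize (Sum.elim a x) := by
  classical
  obtain ⟨x, hx⟩ := hx
  obtain ⟨F, ψ, hψ, hψT⟩ := exists_finset_params (T := T) φ
  obtain ⟨n, ⟨σ⟩⟩ := Finite.exists_equiv_fin F
  obtain ⟨m, ⟨τ⟩⟩ := Finite.exists_equiv_fin ι
  let j : F → X := fun i => Infinite.natEmbedding X (σ i)
  let k : ι → X := fun i => Infinite.natEmbedding X (τ i)
  have hj : Function.Injective j := (Infinite.natEmbedding X).injective.comp
    (Fin.val_injective.comp σ.injective)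
  have hk : Function.Injective k := (Infinite.natEmbedding X).injective.comp
    (Fin.val_injective.comp τ.injective)
  let a' : X → E := Function.extend j (fun i : F => a i) fun _ => Classical.arbitrary E
  have ha' : a' ∘ j = fun i : F => a i := Function.extend_comp hj _ _
  have : Nonempty M := ⟨f (Classical.arbitrary E)⟩
  let x' : X → M := Function.extend k x fun _ => Classical.arbitrary M
  have hx' : x' ∘ k = x := Function.extend_comp hk _ _
  obtain ⟨y, hy⟩ := h {ψ.relabel (Sum.map j k)} a'
    (fun χ hχ => by rw [mem_singleton_iff.1 hχ]; exact (hψT hφ).relabel _) M hM f x'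
    (fun χ hχ => by
      rw [mem_singleton_iff.1 hχ, Formula.realize_relabel, Sum.elim_comp_map, hx',
        Function.comp_assoc, ha']
      exact (hψ M _ x).1 hx)
  have h1 := hy _ rfl
  rw [Formula.realize_relabel, Sum.elim_comp_map, ha'] at h1
  exact ⟨y ∘ k, (hψ E _ _).2 h1⟩

end Existential

section Amalgamation

variable {T : L.Theory} {κ : Cardinal.{u}}

theorem exists_conj {α : Type*} (s : Finset (L.Formula α)) : ∃ χ : L.Formula α,
    (∀ (M : Type u) [L.Structure M] (v : α → M), χ.Realize v ↔ ∀ φ ∈ s, φ.Realize v) ∧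
    ((∀ φ ∈ s, Absolute T φ) → Absolute T χ) := by
  classical
  have key : ∃ χ : L.Formula α, ∀ (M : Type u) [L.Structure M] (v : α → M),
      χ.Realize v ↔ ∀ φ ∈ s, φ.Realize v := by
    induction s using Finset.induction_on with
    | empty => exact ⟨⊤, by simp [Formula.Realize]⟩
    | insert φ s _ ih =>
      obtain ⟨χ, hχ⟩ := ih
      refine ⟨φ ⊓ χ, fun M _ v => ?_⟩
      rw [Formula.realize_inf, hχ]
      simp
  obtain ⟨χ, hχ⟩ := key
  refine ⟨χ, hχ, fun h M N _ _ _ _ hM hN f v => ?_⟩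
  rw [hχ, hχ]
  exact forall₂_congr fun φ hφ => h φ hφ M N hM hN f v

theorem exists_retraction {E : Type u} [L.Structure E] {S : Set E} [Nonempty S]
    (hS : ExClosed T S) (s : Finset (L.Formula E)) (hs : ∀ φ ∈ s, Absolute T φ)
    (hsE : ∀ φ ∈ s, φ.Realize id) :
    ∃ r : E → S, (∀ x : S, r x = x) ∧ ∀ φ ∈ s, φ.Realize fun x => (r x : E) := by
  classical
  obtain ⟨χ, hχ, hχT⟩ := exists_conj (T := T) s
  let g : E → E ⊕ S := fun x => if hx : x ∈ S then Sum.inr ⟨x, hx⟩ else Sum.inl x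
  obtain ⟨F, ψ, hψ, hψT⟩ := exists_finset_params (T := T) (χ.relabel g)
  obtain ⟨n, ⟨σ⟩⟩ := Finite.exists_equiv_fin F
  have key : ∀ y : E → E, (ψ.relabel (Sum.elim (Sum.inr ∘ σ) Sum.inl)).Realize
      (Sum.elim ((↑) : S → E) fun i => y (σ.symm i)) ↔
        ∀ φ ∈ s, φ.Realize fun x => if x ∈ S then x else y x := fun y => by
    rw [← hχ, Formula.realize_relabel]
    have h1 := hψ E y ((↑) : S → E)
    rw [Formula.realize_relabel] at h1
    have h2 : Sum.elim y ((↑) : S → E) ∘ g = fun x => if x ∈ S then x else y x := by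
      funext x
      by_cases hx : x ∈ S <;> simp [g, hx]
    rw [← h2, h1]
    congr! 1
    funext k
    rcases k with k | k <;> simp
  obtain ⟨y, hy, hyψ⟩ := hS (ψ.relabel (Sum.elim (Sum.inr ∘ σ) Sum.inl))
    ((hψT ((hχT hs).relabel _)).relabel _) ⟨fun i => (σ.symm i : E), (key id).2 fun φ hφ => by
      convert hsE φ hφ using 1
      funext x
      simp⟩
  let z : E → E := fun x => if hx : x ∈ F then y (σ ⟨x, hx⟩) else (Classical.arbitrary S : S)
  have hz : ∀ x, z x ∈ S := fun x => by
    simp only [z]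
    split_ifs
    exacts [hy _, Subtype.coe_prop _]
  have h1 := (key z).1 (by
    convert hyψ using 2
    funext i
    simp [z])
  refine ⟨fun x => if hx : x ∈ S then ⟨x, hx⟩ else ⟨z x, hz x⟩, fun x => by simp, fun φ hφ => ?_⟩
  convert h1 φ hφ using 1
  funext x
  by_cases hx : x ∈ S <;> simp [hx]

theorem exists_amalgam {E : Type u} [L.Structure E] [Infinite E] (hE : E ⊨ T)
    (hT : IsUniversalTheory T)
    {S : L.Substructure E} [Infinite S] (hS : ExClosed T (S : Set E)) {N : Type u} [L.Structure N]
    (hN : N ⊨ T) (f : S ↪[L] N) :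
    ∃ (Q : Type u) (_ : L.Structure Q) (g : N ↪[L] Q) (h : E ↪[L] Q), Q ⊨ T ∧
      ∀ x : S, g (f x) = h x := by
  classical
  have : Infinite N := Infinite.of_injective f f.injective
  have : Nonempty (S : Set E) := ⟨Classical.arbitrary S⟩
  let A : Set (L.Formula (E ⊕ N)) :=
    (fun φ : L.Formula E => φ.relabel Sum.inl) '' {φ | Absolute T φ ∧ φ.Realize id}
  let B : Set (L.Formula (E ⊕ N)) :=
    {φ | ∀ v : E → N, (∀ x : S, v x = f x) → φ.Realize (Sum.elim v id)}
  obtain ⟨Q, _, w, hw⟩ := compactness (A ∪ B) fun s hs => by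
    obtain ⟨s', hs'A, hs'⟩ := Finset.subset_set_image_iff.1
      (show ((s.filter (· ∈ A) : Finset _) : Set (L.Formula (E ⊕ N))) ⊆ A from fun φ hφ =>
        (Finset.mem_filter.1 hφ).2)
    obtain ⟨r, hr, hrs⟩ := exists_retraction hS s' (fun φ hφ => (hs'A hφ).1)
      fun φ hφ => (hs'A hφ).2
    refine ⟨N, inferInstance, Sum.elim (fun x => f (r x)) id, fun φ hφ => ?_⟩
    by_cases hφA : φ ∈ A
    · have h1 : φ ∈ s'.image fun φ : L.Formula E => φ.relabel Sum.inl := by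
        rw [hs']
        exact Finset.mem_filter.2 ⟨hφ, hφA⟩
      obtain ⟨ψ, hψ, rfl⟩ := Finset.mem_image.1 h1
      rw [Formula.realize_relabel, Sum.elim_comp_inl]
      have hST := models_of_embedding hT S.subtype hE
      exact ((hs'A hψ).1 S N hST hN f _).1 (((hs'A hψ).1 S E hST hE S.subtype _).2 (hrs ψ hψ))
    · exact (hs hφ).resolve_left hφA _ fun x => congrArg f (hr x)
  have hg : EqT L id (w ∘ Sum.inr) := by
    have h1 : ∀ φ : L.Formula N, φ.Realize id → φ.Realize (w ∘ Sum.inr) := fun φ hφ => by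
      rw [← Formula.realize_relabel]
      refine hw _ (Or.inr fun v _ => ?_)
      rwa [Formula.realize_relabel, Sum.elim_comp_inr]
    refine fun φ => ⟨h1 φ, fun h => ?_⟩
    by_contra hn
    exact h1 φ.not hn h
  have hh : ∀ φ : L.Formula E, Absolute T φ → φ.Realize id → φ.Realize (w ∘ Sum.inl) :=
    fun φ hφ hφE => by
      rw [← Formula.realize_relabel]
      exact hw _ (Or.inl ⟨φ, ⟨hφ, hφE⟩, rfl⟩)
  refine ⟨Q, _, hg.toEmbedding, embeddingOfAbsolute hh, hg.models hN, fun x => ?_⟩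
  have h1 := hw ((Term.var (Sum.inr (f x))).equal (Term.var (Sum.inl (x : E)))) (Or.inr
    fun v hv => by
      rw [Formula.realize_equal]
      exact (hv x).symm)
  rw [Formula.realize_equal] at h1
  exact h1

theorem EClosed.of_equiv {M N : Type u} [L.Structure M] [L.Structure N] [Infinite M]
    [Infinite N] (hM : M ⊨ T) (hN : N ⊨ T)
    (h : EClosed T M) (g : M ≃[L] N) : EClosed T N := by
  intro P _ hP f α ι _ φ hφ a hx
  obtain ⟨y, hy⟩ := h P hP (f.comp g.toEmbedding) φ hφ (g.symm ∘ a) (by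
    have : (f.comp g.toEmbedding) ∘ (g.symm ∘ a) = f ∘ a := by
      funext i
      simp
    rwa [this])
  rw [hφ M N hM hN g.toEmbedding, Sum.comp_elim] at hy
  have : g.toEmbedding ∘ (g.symm ∘ a) = a := by
    funext i
    simp
  rw [this] at hy
  exact ⟨_, hy⟩

theorem exists_eClosed (hT : IsUniversalTheory T) (hκ : ℵ₀ < κ) (hTκ : KUnique T κ) :
    ∃ (M : Type u) (_ : L.Structure M), M ⊨ T ∧ StrictlyGenerated L M κ ∧ EClosed T M := by
  obtain ⟨M₀, _, hM₀, hM₀κ⟩ := hTκ.1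
  have := infinite_of_strictlyGenerated hκ hM₀κ
  let μ := max κ (max L.card ℵ₀)
  obtain ⟨M, _, hM, hMμ⟩ := exists_model_card (L := L) (μ := Order.succ μ) hM₀
    ((le_max_right _ _).trans (Order.le_succ μ))
  have hω : ℵ₀ ≤ μ := (le_max_right _ _).trans (le_max_right _ _)
  have : Infinite M := infinite_iff.2 (hMμ ▸ hω.trans (Order.le_succ μ))
  obtain ⟨E, _, e, hE, hR⟩ := exists_rich hT hM (ULift.{u} ℕ)
  have : Infinite E := Infinite.of_injective e e.injective
  have hEμ : μ < #E := by
    have h1 : #M ≤ #E := mk_le_of_injective e.injective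
    rw [hMμ] at h1
    exact (Order.lt_succ μ).trans_le h1
  obtain ⟨X, hX, hXκ⟩ := exists_exClosed_strictlyGenerated hT hκ hTκ hE fun W hW =>
    exists_notMem_closure (le_max_right _ _) hEμ W (hW.trans (le_max_left _ _))
  refine ⟨Substructure.closure L X, _, models_of_embedding hT (Substructure.subtype _) hE, hXκ,
    fun N _ hN f α ι _ φ hφ a hx => ?_⟩
  have := infinite_of_strictlyGenerated hκ hXκ
  have hXT := models_of_embedding hT (Substructure.closure L X).subtype hE
  have : Infinite N := Infinite.of_injective f f.injective
  obtain ⟨Q, _, g, h, hQ, hgh⟩ := exists_amalgam hE hT hX hN f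
  have : Infinite Q := Infinite.of_injective g g.injective
  obtain ⟨x, hx⟩ := hx
  rw [hφ N Q hN hQ g, Sum.comp_elim,
    show g ∘ f ∘ a = h ∘ (fun i => (a i : E)) from funext fun i => hgh _] at hx
  obtain ⟨y, hy⟩ := hR.exists_realize Q hQ h hφ (fun i => (a i : E)) ⟨_, hx⟩
  obtain ⟨z, hz, hzφ⟩ := ExClosed.exists_realize hX hφ (fun i => (a i).2) ⟨y, hy⟩
  refine ⟨fun i => ⟨z i, hz i⟩, ?_⟩
  rw [hφ _ E hXT hE (Substructure.closure L X).subtype, Sum.comp_elim]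
  exact hzφ

end Amalgamation

section ModelCompleteness

variable {T : L.Theory} {κ : Cardinal.{u}}

theorem exists_dseq_over {E : Type u} [L.Structure E] (Z : Set E)
    [Infinite (Substructure.closure L Z)] (I : Type u) [LinearOrder I] :
    ∃ (M : Type u) (_ : L.Structure M) (f : E → M) (D : Ultrafilter (Unit → E))
      (J : I → Unit → M), EqT L id f ∧ DSeq L f D J ∧
      {x : Unit → E | ∀ k, x k ∈ Substructure.closure L Z} ∈ D ∧
      ∀ a, ∀ᶠ x in (D : Filter (Unit → E)), x () ≠ a := by
  set C := Substructure.closure L Z with hC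
  have hD₁ := nonprincipal_ne C
  have : Nonempty E := ⟨((Classical.arbitrary C : C) : E)⟩
  obtain ⟨M, _, f, J, hf, hJ⟩ := exists_dseq (L := L)
    ((nonprincipal C).map ((Subtype.val : C → E) ∘ ·)) I
  refine ⟨M, _, f, _, J, hf, hJ, ?_, fun a => ?_⟩
  · rw [Ultrafilter.mem_map]
    exact Filter.univ_mem' fun x k => (x k).2
  · change ∀ᶠ x in (nonprincipal C : Filter (Unit → C)), (x () : E) ≠ a
    by_cases ha : a ∈ C
    · filter_upwards [hD₁ ⟨a, ha⟩] with x hx hxa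
      exact hx (Subtype.ext hxa)
    · exact Filter.Eventually.of_forall fun x hx => ha (hx ▸ (x ()).2)

/-- Every countable subset of an infinite structure is contained in a countable set generating an
infinite substructure. -/
theorem exists_countable_infinite {E : Type u} [L.Structure E] [Infinite E] {S : Set E}
    (hS : S.Countable) :
    ∃ Z : Set E, S ⊆ Z ∧ Z.Countable ∧ Infinite (Substructure.closure L Z) := by
  let g := Infinite.natEmbedding E
  exact ⟨S ∪ range g, subset_union_left, hS.union (countable_range _),
    ((infinite_range_of_injective g.injective).mono
      (subset_union_right.trans Substructure.subset_closure)).to_subtype⟩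

theorem eClosed_of_kUnique (hT : IsUniversalTheory T) (hκ : ℵ₀ < κ) (hTκ : KUnique T κ)
    {M : Type u} [L.Structure M] [Infinite M] (hM : M ⊨ T) : EClosed T M := by
  obtain ⟨S, _, hS, hSκ, hSe⟩ := exists_eClosed hT hκ hTκ
  have := infinite_of_strictlyGenerated hκ hSκ
  intro N _ hN f α ι _ φ hφ a ⟨x, hx⟩
  have : Infinite N := Infinite.of_injective f f.injective
  obtain ⟨F, ψ, hψ, hψT⟩ := exists_finset_params (T := T) φ
  replace hψT := hψT hφ
  rw [hψ] at hx
  obtain ⟨Z, haZ, hZ, _⟩ := exists_countable_infinite (L := L)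
    (S := range fun i : F => a i) (countable_range _)
  have hfZ : f '' (Substructure.closure L Z) = (Substructure.closure L (f '' Z) : Set N) := by
    have h1 : Substructure.closure L (f '' Z) = (Substructure.closure L Z).map f.toHom :=
      Substructure.closure_image f.toHom
    rw [h1]
    rfl
  have : Infinite (Substructure.closure L (f '' Z)) := by
    have h1 : (Substructure.closure L (f '' Z) : Set N).Infinite := by
      rw [← hfZ]
      exact (Set.infinite_coe_iff.1 ‹_›).image f.injective.injOn
    exact h1.to_subtype
  obtain ⟨P, _, g, D, J, hg, hJ, hDZ, hD⟩ := exists_dseq_over (L := L) (f '' Z) κ.ord.ToType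
  have hP : P ⊨ T := hg.models hN
  have : Infinite P := Infinite.of_injective g (hg.injective Function.injective_id)
  have hgen := hJ.strictlyGenerated (hg.injective Function.injective_id) hD hκ
    (image_subset_range g (f '' Z))
    ((mk_image_le.trans (mk_image_le.trans (le_aleph0_iff_set_countable.2 hZ))).trans hκ.le)
    (mk_ord_toType κ)
  set Q := Substructure.closure L (g '' (f '' Z) ∪ range fun i => J i ()) with hQ
  have hQT : Q ⊨ T := models_of_embedding hT Q.subtype hP
  have := infinite_of_strictlyGenerated hκ hgen
  obtain ⟨σ⟩ := hTκ.2 S Q _ _ hS hQT hSκ hgen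
  have hQe : EClosed T Q := hSe.of_equiv hS hQT σ
  have haQ : ∀ i : F, g (f (a i)) ∈ Q := fun i =>
    Substructure.subset_closure (Or.inl ⟨_, ⟨_, haZ ⟨i, rfl⟩, rfl⟩, rfl⟩)
  obtain ⟨y, hy⟩ := hQe P hP Q.subtype ψ hψT (fun i => ⟨g (f (a i)), haQ i⟩) ⟨g ∘ x, by
    have h1 := (hg.comp (Sum.elim (fun i : F => f (a i)) x) ψ).1 hx
    rwa [Sum.comp_elim] at h1⟩
  rw [hψT Q P hQT hP Q.subtype, Sum.comp_elim] at hy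
  have hJr : (range fun i => J i ()) = range (Function.uncurry J) := by
    ext z
    constructor
    · rintro ⟨i, rfl⟩
      exact ⟨(i, ()), rfl⟩
    · rintro ⟨⟨i, _⟩, rfl⟩
      exact ⟨i, rfl⟩
  obtain ⟨z, hz, hzψ⟩ := hJ.exists_base_closure hg hDZ (fun i : F => f (a i)) (Q.subtype ∘ y)
    (fun k => by
      rw [← hJr]
      exact (y k).2) ψ hy
  have hz' : ∀ k, ∃ w : M, f w = z k := fun k => by
    have h1 : z k ∈ (Substructure.closure L (f '' Z) : Set N) := hz k
    rw [← hfZ] at h1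
    obtain ⟨w, -, hw⟩ := h1
    exact ⟨w, hw⟩
  choose w hw using hz'
  refine ⟨w, ?_⟩
  rw [hψ, hψT M N hM hN f, Sum.comp_elim]
  rwa [show f ∘ w = z from funext hw]

theorem absolute_toFormula (hT : IsUniversalTheory T) (hκ : ℵ₀ < κ) (hTκ : KUnique T κ)
    {α : Type u} {n : ℕ} (φ : L.BoundedFormula α n) : Absolute T φ.toFormula := by
  induction φ with
  | falsum => exact fun M N _ _ _ _ _ _ f v => Iff.rfl
  | equal t s =>
    refine fun M N _ _ _ _ _ _ f v => ?_
    rw [BoundedFormula.realize_toFormula, BoundedFormula.realize_toFormula]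
    exact ((BoundedFormula.IsAtomic.equal t s).isQF.realize_embedding f (v := v ∘ Sum.inl)
      (xs := v ∘ Sum.inr)).symm
  | rel r t =>
    refine fun M N _ _ _ _ _ _ f v => ?_
    rw [BoundedFormula.realize_toFormula, BoundedFormula.realize_toFormula]
    exact ((BoundedFormula.IsAtomic.rel r t).isQF.realize_embedding f (v := v ∘ Sum.inl)
      (xs := v ∘ Sum.inr)).symm
  | imp φ ψ hφ hψ =>
    refine fun M N _ _ _ _ hM hN f v => ?_
    have h1 := hφ M N hM hN f v
    have h2 := hψ M N hM hN f v
    rw [BoundedFormula.realize_toFormula, BoundedFormula.realize_toFormula] at h1 h2 ⊢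
    rw [BoundedFormula.realize_imp, BoundedFormula.realize_imp, h1, h2]
  | @all n φ hφ =>
    let g : α ⊕ Fin (n + 1) → (α ⊕ Fin n) ⊕ Unit :=
      Sum.elim (fun a => Sum.inl (Sum.inl a))
        (Fin.lastCases (Sum.inr ()) fun i => Sum.inl (Sum.inr i))
    have key : ∀ (M : Type u) [L.Structure M] (v : α ⊕ Fin n → M),
        φ.all.toFormula.Realize v ↔ ∀ x : Unit → M,
          (φ.toFormula.relabel g).Realize (Sum.elim v x) := fun M _ v => by
      rw [BoundedFormula.realize_toFormula, BoundedFormula.realize_all]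
      have h1 : ∀ x : Unit → M, (φ.toFormula.relabel g).Realize (Sum.elim v x) ↔
          φ.Realize (v ∘ Sum.inl) (Fin.snoc (v ∘ Sum.inr) (x ())) := fun x => by
        rw [Formula.realize_relabel, BoundedFormula.realize_toFormula]
        congr! 1
        funext i
        refine Fin.lastCases ?_ (fun i => ?_) i <;> simp [g]
      constructor
      · exact fun h x => (h1 x).2 (h _)
      · exact fun h x => (h1 fun _ => x).1 (h _)
    have hφ' := hφ.relabel g
    refine fun M N _ _ _ _ hM hN f v => ?_
    rw [key, key]
    constructor
    · intro h
      by_contra! hn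
      obtain ⟨x, hx⟩ := eClosed_of_kUnique hT hκ hTκ hM N hN f (φ.toFormula.relabel g).not
        hφ'.not v (by
          obtain ⟨x, hx⟩ := hn
          exact ⟨x, hx⟩)
      exact hx (h x)
    · intro h x
      rw [hφ' M N hM hN f, Sum.comp_elim]
      exact h _

theorem eqT_of_embedding (hT : IsUniversalTheory T) (hκ : ℵ₀ < κ) (hTκ : KUnique T κ)
    {M N : Type u} [L.Structure M] [L.Structure N] [Infinite M] (hM : M ⊨ T) (hN : N ⊨ T)
    (f : M ↪[L] N) : EqT L id f := by
  intro φ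
  have : Infinite N := Infinite.of_injective f f.injective
  have h1 := absolute_toFormula hT hκ hTκ φ M N hM hN f (Sum.elim id Fin.elim0)
  rw [BoundedFormula.realize_toFormula, BoundedFormula.realize_toFormula] at h1
  convert h1 using 1
  · rw [Formula.Realize]
    congr! 1
  · rw [Formula.Realize]
    congr! 1

theorem absolute_of_kUnique (hT : IsUniversalTheory T) (hκ : ℵ₀ < κ) (hTκ : KUnique T κ)
    {α : Type*} (φ : L.Formula α) : Absolute T φ := fun _ _ _ _ _ _ hM hN f v =>
  (eqT_of_embedding hT hκ hTκ hM hN f).comp v φ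

end ModelCompleteness

section Quantifiers

variable {α ι : Type*}

/-- Existential quantification over an arbitrary tuple of variables. -/
theorem exists_ex_formula (φ : L.Formula (α ⊕ ι)) : ∃ ψ : L.Formula α, ∀ (M : Type u)
    [L.Structure M] [Nonempty M] (v : α → M), ψ.Realize v ↔ ∃ x, φ.Realize (Sum.elim v x) := by
  classical
  obtain ⟨F, ψ, hψ, -⟩ := exists_finset_params (T := (∅ : L.Theory)) (φ.relabel Sum.swap)
  have hψ' : ∀ (M : Type u) [L.Structure M] (v : α → M) (x : ι → M),
      φ.Realize (Sum.elim v x) ↔ ψ.Realize (Sum.elim (fun i : F => x i) v) := fun M _ v x => by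
    rw [← hψ, Formula.realize_relabel]
    congr! 1
    funext k
    rcases k with k | k <;> rfl
  refine ⟨(ψ.relabel Sum.swap).iExs F, fun M _ _ v => ?_⟩
  rw [Formula.realize_iExs]
  have h1 : ∀ y : F → M, (ψ.relabel Sum.swap).Realize (Sum.elim v y) ↔
      ψ.Realize (Sum.elim y v) := fun y => by
    rw [Formula.realize_relabel]
    congr! 1
    funext k
    rcases k with k | k <;> rfl
  constructor
  · rintro ⟨y, hy⟩
    refine ⟨fun i => if hi : i ∈ F then y ⟨i, hi⟩ else Classical.arbitrary M, ?_⟩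
    rw [hψ']
    simpa using (h1 y).1 hy
  · rintro ⟨x, hx⟩
    exact ⟨fun i => x i, (h1 _).2 ((hψ' M v x).1 hx)⟩

theorem EqT.exists_realize_of_nonempty {M N : Type u} [L.Structure M] [L.Structure N] [Nonempty M]
    [Nonempty N] {v : α → M} {w : α → N} (h : EqT L v w) (φ : L.Formula (α ⊕ ι))
    (hφ : ∃ x, φ.Realize (Sum.elim v x)) : ∃ y, φ.Realize (Sum.elim w y) := by
  obtain ⟨ψ, hψ⟩ := exists_ex_formula φ
  exact (hψ N w).1 ((h ψ).1 ((hψ M v).2 hφ))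

end Quantifiers

/-- An infinite model of a universal theory which is `κ`-unique for an uncountable `κ`. -/
structure Ambient (T : L.Theory) (κ : Cardinal.{u}) (E : Type u) [L.Structure E] : Prop where
  universal : IsUniversalTheory T
  uncountable : ℵ₀ < κ
  unique : KUnique T κ
  models : E ⊨ T
  infinite : Infinite E

section Ambient

variable {T : L.Theory} {κ : Cardinal.{u}} {E : Type u} [L.Structure E]

theorem Ambient.of_eqT (h : Ambient T κ E) {M : Type u} [L.Structure M] {f : E → M}
    (hf : EqT L id f) : Ambient T κ M :=
  ⟨h.universal, h.uncountable, h.unique, hf.models h.models,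
    have := h.infinite; Infinite.of_injective f (hf.injective Function.injective_id)⟩

theorem Ambient.substructure (h : Ambient T κ E) (S : L.Substructure E) [Infinite S] :
    Ambient T κ S :=
  ⟨h.universal, h.uncountable, h.unique, models_of_embedding h.universal S.subtype h.models,
    inferInstance⟩

theorem Ambient.eqT_of_embedding (h : Ambient T κ E) {M : Type u} [L.Structure M] (hM : M ⊨ T)
    (f : E ↪[L] M) : EqT L id f :=
  have := h.infinite
  UniversalCategoricity.eqT_of_embedding h.universal h.uncountable h.unique h.models hM f

theorem Ambient.eqT_subtype (h : Ambient T κ E) (S : L.Substructure E) [Infinite S] :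
    EqT L id (Subtype.val : S → E) :=
  (h.substructure S).eqT_of_embedding h.models S.subtype

/-- Formulas with parameters in an infinite substructure have solutions there. -/
theorem Ambient.exists_mem (h : Ambient T κ E) (S : L.Substructure E) [Infinite S] {α ι : Type*}
    (φ : L.Formula (α ⊕ ι)) (a : α → E) (ha : ∀ i, a i ∈ S)
    (hx : ∃ x, φ.Realize (Sum.elim a x)) :
    ∃ x : ι → E, (∀ i, x i ∈ S) ∧ φ.Realize (Sum.elim a x) := by
  have hS := h.eqT_subtype S
  have := h.infinite
  have h1 : EqT L (fun i => (⟨a i, ha i⟩ : S)) a := (eqT_embedding_iff_comp hS _)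
  obtain ⟨y, hy⟩ := h1.symm.exists_realize_of_nonempty φ hx
  refine ⟨fun i => y i, fun i => (y i).2, ?_⟩
  have h2 := (eqT_embedding_iff_comp hS (Sum.elim (fun i => (⟨a i, ha i⟩ : S)) y) φ).1 hy
  rwa [Sum.comp_elim] at h2

/-- Every formula over `C` true of `b` has a solution in `N`. -/
def FS (L : FirstOrder.Language.{u, u}) {E : Type u} [L.Structure E] (N : L.Substructure E)
    (C : Set E) {ι : Type*} (b : ι → E) : Prop :=
  ∀ φ : L.Formula (C ⊕ ι), φ.Realize (Sum.elim (↑) b) →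
    ∃ x : ι → E, (∀ i, x i ∈ N) ∧ φ.Realize (Sum.elim (↑) x)

variable {N N' : L.Substructure E} {C C' : Set E} {ι ι' : Type*} {b : ι → E}

theorem FS.of_family {γ : Type*} (v : γ → E) (hC : C ⊆ range v)
    (h : ∀ φ : L.Formula (γ ⊕ ι), φ.Realize (Sum.elim v b) →
      ∃ x : ι → E, (∀ i, x i ∈ N) ∧ φ.Realize (Sum.elim v x)) : FS L N C b := fun φ hφ => by
  choose g hg using fun k : C => hC k.2
  have h1 : ∀ x : ι → E, (φ.relabel (Sum.map g id)).Realize (Sum.elim v x) ↔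
      φ.Realize (Sum.elim (↑) x) := fun x => by
    rw [Formula.realize_relabel]
    congr! 1
    funext k
    rcases k with k | k
    · exact hg k
    · rfl
  obtain ⟨x, hx, hx'⟩ := h _ ((h1 b).2 hφ)
  exact ⟨x, hx, (h1 x).1 hx'⟩

theorem FS.exists_mem (h : FS L N C b) {γ : Type*} (c : γ → E)
    (hc : ∀ k, c k ∈ Substructure.closure L C) (φ : L.Formula (γ ⊕ ι))
    (hφ : φ.Realize (Sum.elim c b)) :
    ∃ x : ι → E, (∀ i, x i ∈ N) ∧ φ.Realize (Sum.elim c x) := by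
  obtain ⟨t, ht⟩ := exists_terms C (Subtype.val : C → E) (fun m hm => ⟨⟨m, hm⟩, rfl⟩) c hc
  let σ : γ ⊕ ι → L.Term (C ⊕ ι) := Sum.elim (fun k => (t k).relabel Sum.inl)
    fun i => Term.var (Sum.inr i)
  have h1 : ∀ x : ι → E, Formula.Realize (BoundedFormula.subst φ σ) (Sum.elim Subtype.val x) ↔
      φ.Realize (Sum.elim c x) := fun x => by
    rw [realize_subst_formula]
    congr! 1
    funext k
    rcases k with k | k
    · simpa [σ] using ht k
    · rfl
  obtain ⟨x, hx, hx'⟩ := h _ ((h1 b).2 hφ)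
  exact ⟨x, hx, (h1 x).1 hx'⟩

theorem FS.mono (h : FS L N C b) (hN : N ≤ N') (hC : C' ⊆ Substructure.closure L C) :
    FS L N' C' b := fun φ hφ => by
  obtain ⟨x, hx, hx'⟩ := h.exists_mem (Subtype.val : C' → E) (fun k => hC k.2) φ hφ
  exact ⟨x, fun i => hN (hx i), hx'⟩

theorem FS.of_eqT (h : FS L N C b) {b' : ι → E}
    (hb : EqT L (Sum.elim (fun k : C => (k : E)) b) (Sum.elim (↑) b')) : FS L N C b' :=
  fun φ hφ => h φ ((hb φ).2 hφ)

/-- Tuples inside an infinite substructure can be chosen to satisfy formulas over it. -/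
theorem Ambient.fs_of_subset (h : Ambient T κ E) (N : L.Substructure E) [Infinite N]
    (hC : C ⊆ N) (b : ι → E) : FS L N C b := fun φ hφ =>
  h.exists_mem N φ _ (fun k => hC k.2) ⟨b, hφ⟩

end Ambient

section Chain

variable {T : L.Theory} {κ : Cardinal.{u}} {E : Type u} [L.Structure E]

/-- Extending a partial copy of a chain while avoiding the given structure. -/
theorem Ambient.exists_avoiding (h : Ambient T κ E) (N : L.Substructure E) [Infinite N]
    {α ι : Type*} {ρ : Type u} (a : α → E) (ha : ∀ k, a k ∈ N) (c : ρ → E)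
    (φ : L.Formula (ρ ⊕ ι)) (hφ : ∀ x : ι → E, (∀ i, x i ∈ N) → ¬ φ.Realize (Sum.elim c x))
    {M : Type u} [L.Structure M] (a' : α → M) (haa : EqT L a a') :
    ∃ (M' : Type u) (_ : L.Structure M') (f : M → M') (y : ρ → M'), EqT L id f ∧
      EqT L (Sum.elim a c) (Sum.elim (f ∘ a') y) ∧
      ∀ x : ι → M, ¬ φ.Realize (Sum.elim y (f ∘ x)) := by
  classical
  have hEi := h.infinite
  have hME : Nonempty M := by
    have h1 := (haa.exists_realize (ι := Unit) (⊤ : L.Formula (α ⊕ Unit))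
      ⟨fun _ => Classical.arbitrary E, by simp⟩)
    exact ⟨h1.choose ()⟩
  let Θ := {θ : L.Formula (α ⊕ ρ) // θ.Realize (Sum.elim a c)}
  let G : Θ ⊕ (ι → M) → L.Formula (M ⊕ ρ) := Sum.elim
    (fun θ => θ.1.relabel (Sum.map a' id))
    (fun x => (φ.relabel (Sum.elim Sum.inr fun i => Sum.inl (x i))).not)
  have hG1 : ∀ (θ : Θ) (M' : Type u) [L.Structure M'] (f : M → M') (y : ρ → M'),
      (G (Sum.inl θ)).Realize (Sum.elim f y) ↔ θ.1.Realize (Sum.elim (f ∘ a') y) :=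
    fun θ M' _ f y => by
      simp only [G, Sum.elim_inl, Formula.realize_relabel]
      congr! 1
      funext k
      rcases k with k | k <;> rfl
  have hG2 : ∀ (x : ι → M) (M' : Type u) [L.Structure M'] (f : M → M') (y : ρ → M'),
      (G (Sum.inr x)).Realize (Sum.elim f y) ↔ ¬ φ.Realize (Sum.elim y (f ∘ x)) :=
    fun x M' _ f y => by
      simp only [G, Sum.elim_inr, Formula.realize_not, Formula.realize_relabel]
      congr! 2
      funext k
      rcases k with k | k <;> rfl
  obtain ⟨M', _, f, y, hf, hy⟩ := exists_elementary_realization (range G) (fun s hs => by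
    rw [← image_univ] at hs
    obtain ⟨s', -, rfl⟩ := Finset.subset_set_image_iff.1 hs
    obtain ⟨θ, hθ, -⟩ := exists_conj (T := T) (s'.toLeft.image Subtype.val)
    have hθ' : θ.Realize (Sum.elim a c) := by
      rw [hθ]
      intro φ hφ
      obtain ⟨θ, -, rfl⟩ := Finset.mem_image.1 hφ
      exact θ.2
    obtain ⟨η, hη, -⟩ := exists_conj (T := T) (α := (α ⊕ (s'.toRight × ι)) ⊕ ρ)
      (Finset.univ.image fun x : s'.toRight =>
        (φ.relabel (Sum.elim Sum.inr fun i => Sum.inl (Sum.inr (x, i)))).not)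
    have hη' : ∀ (P : Type u) [L.Structure P] (p : α → P) (q : s'.toRight × ι → P) (y : ρ → P),
        η.Realize (Sum.elim (Sum.elim p q) y) ↔
          ∀ x : s'.toRight, ¬ φ.Realize (Sum.elim y fun i => q (x, i)) := fun P _ p q y => by
      rw [hη]
      simp only [Finset.mem_image, Finset.mem_univ, true_and, forall_exists_index,
        forall_apply_eq_imp_iff, Formula.realize_not, Formula.realize_relabel]
      refine forall_congr' fun x => not_congr ?_
      congr! 1
      funext k
      rcases k with k | k <;> rfl
    let ξ : L.Formula ((α ⊕ (s'.toRight × ι)) ⊕ ρ) :=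
      (θ.relabel (Sum.map Sum.inl id)) ⊓ η
    have hξ : ∀ (P : Type u) [L.Structure P] (p : α → P) (q : s'.toRight × ι → P) (y : ρ → P),
        ξ.Realize (Sum.elim (Sum.elim p q) y) ↔ θ.Realize (Sum.elim p y) ∧
          ∀ x : s'.toRight, ¬ φ.Realize (Sum.elim y fun i => q (x, i)) := fun P _ p q y => by
      rw [← hη' P p q y, Formula.realize_inf, Formula.realize_relabel]
      congr! 2
      funext k
      rcases k with k | k <;> rfl
    obtain ⟨ζ, hζ⟩ := exists_ex_formula ξ
    have hne : ∃ y, ξ.Realize (Sum.elim (Sum.elim a' fun p : s'.toRight × ι => p.1.1 p.2) y) := by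
      rw [← hζ]
      by_contra hcon
      obtain ⟨q, hq⟩ := haa.symm.exists_realize_of_nonempty ζ.not
        ⟨fun p : s'.toRight × ι => p.1.1 p.2, by rwa [Formula.realize_not]⟩
      obtain ⟨q, hqN, hq⟩ := h.exists_mem N ζ.not a ha ⟨q, hq⟩
      rw [Formula.realize_not, hζ] at hq
      refine hq ⟨c, ?_⟩
      rw [hξ]
      exact ⟨hθ', fun x => hφ _ fun i => hqN _⟩
    obtain ⟨y, hy⟩ := hne
    rw [hξ] at hy
    refine ⟨y, fun ψ hψ => ?_⟩
    obtain ⟨k, hk, rfl⟩ := Finset.mem_image.1 hψ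
    rcases k with k | k
    · rw [hG1, Function.id_comp]
      exact (hθ _ _).1 hy.1 _ (Finset.mem_image_of_mem _ (Finset.mem_toLeft.2 hk))
    · rw [hG2, Function.id_comp]
      exact hy.2 ⟨k, Finset.mem_toRight.2 hk⟩)
  refine ⟨M', _, f, y, hf, fun θ => ?_, fun x => (hG2 x M' f y).1 (hy _ ⟨_, rfl⟩)⟩
  constructor
  · exact fun hθ => (hG1 ⟨θ, hθ⟩ M' f y).1 (hy _ ⟨_, rfl⟩)
  · intro hθ
    by_contra hcon
    exact (hG1 ⟨θ.not, hcon⟩ M' f y).1 (hy _ ⟨_, rfl⟩) hθ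

/-- Along an increasing chain of countable sets, the type of a finite tuple eventually is finitely
satisfiable one step below. -/
theorem Ambient.exists_fs_succ (h : Ambient T κ E) {Z : ℕ → Set E} (hZ : Monotone Z)
    (hZc : ∀ n, (Z n).Countable) [Infinite (Substructure.closure L (Z 0))] {ι : Type} [Finite ι]
    (b : ι → E) : ∃ n, FS L (Substructure.closure L (Z n)) (Z (n + 1)) b := by
  have key : ∀ Z : ℕ → Set E, Monotone Z → (∀ n, (Z n).Countable) → (Z 0).Nonempty →
      Infinite (Substructure.closure L (Z 0)) →
      ∃ n, FS L (Substructure.closure L (Z n)) (Z (n + 1)) b := by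
    clear hZ hZc
    intro Z hZ hZc hne hinf
    by_contra! hcon
    have hne' : ∀ n, (Z n).Nonempty := fun n => hne.mono (hZ (Nat.zero_le n))
    have hinf' : ∀ n, Infinite (Substructure.closure L (Z n)) := fun n =>
      Set.Infinite.to_subtype ((Set.infinite_coe_iff.1 hinf).mono
        (Substructure.closure_mono (hZ (Nat.zero_le n))))
    unfold FS at hcon
    push Not at hcon
    choose φ hφ hφ' using hcon
    choose c hc using fun n => (hZc (n + 1)).exists_eq_range (hne' _)
    choose g hg using fun (n : ℕ) (k : Z (n + 1)) => (hc n ▸ k.2 : (k : E) ∈ range (c n))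
    let χ : ∀ n, L.Formula ((Z 0 ⊕ (Fin (n + 1) × ℕ)) ⊕ ι) := fun n =>
      (φ n).relabel (Sum.map (fun k => Sum.inr (Fin.last n, g n k)) id)
    have hχ : ∀ (n : ℕ) (M : Type u) [L.Structure M] (e : Z 0 → M) (d : ℕ → ℕ → M) (x : ι → M),
        (χ n).Realize (Sum.elim (Sum.elim e (initial d (n + 1))) x) ↔
          ((φ n).relabel (Sum.map (g n) id)).Realize (Sum.elim (d n) x) := fun n M _ e d x => by
      simp only [χ, Formula.realize_relabel]
      congr! 1
      funext k
      rcases k with k | k <;> simp [initial]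
    have hφc : ∀ n (x : ι → E), ((φ n).relabel (Sum.map (g n) id)).Realize (Sum.elim (c n) x) ↔
        (φ n).Realize (Sum.elim (↑) x) := fun n x => by
      rw [Formula.realize_relabel]
      congr! 1
      funext k
      rcases k with k | k
      · exact hg n k
      · rfl
    have : Countable (Z 0) := hZc 0
    have : Nonempty (Z 0) := hne.to_subtype
    have : Infinite (Substructure.closure L (range (Subtype.val : Z 0 → E))) := by
      rw [Subtype.range_coe]; exact hinf
    refine not_oneStep h.universal h.uncountable h.unique h.models (z := (Subtype.val : Z 0 → E))
      (c := c) (χ := χ) (b₀ := b)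
        (fun n => absolute_of_kUnique h.universal h.uncountable h.unique _)
      (fun n => by rw [hχ, hφc]; exact hφ n) ?_
    intro n M _ e d hed
    let c' : ULift.{u} ℕ → E := fun k => c n k.down
    obtain ⟨M', _, f, y, hf, hy, hy'⟩ := h.exists_avoiding (Substructure.closure L (Z n))
      (Sum.elim (Subtype.val : Z 0 → E) (initial c n)) (fun k => by
        rcases k with k | ⟨i, k⟩
        · exact Substructure.subset_closure (hZ (Nat.zero_le n) k.2)
        · refine Substructure.subset_closure (hZ (Nat.succ_le_of_lt i.2) ?_)
          rw [hc i]
          exact ⟨k, rfl⟩) c' ((φ n).relabel (Sum.map (fun k => ⟨g n k⟩) id)) (fun x hx hcon => by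
        refine hφ' n x hx ?_
        rw [← hφc]
        rw [Formula.realize_relabel] at hcon ⊢
        convert hcon using 1
        funext k
        rcases k with k | k <;> rfl) _ hed
    refine ⟨M', _, f, fun k => y ⟨k⟩, hf, ?_, fun x => ?_⟩
    · let G : (Z 0 ⊕ (Fin (n + 1) × ℕ)) → (Z 0 ⊕ (Fin n × ℕ)) ⊕ ULift.{u} ℕ := Sum.elim
        (fun k => Sum.inl (Sum.inl k)) fun p => if hp : (p.1 : ℕ) < n then
          Sum.inl (Sum.inr (⟨p.1, hp⟩, p.2)) else Sum.inr ⟨p.2⟩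
      have h1 := hy.comp G
      convert h1 using 1
      · funext k
        rcases k with k | ⟨i, k⟩
        · rfl
        · by_cases hi : (i : ℕ) < n
          · simp [G, hi, initial]
          · have : (i : ℕ) = n := by omega
            simp [G, initial, c', this]
      · funext k
        rcases k with k | ⟨i, k⟩
        · rfl
        · by_cases hi : (i : ℕ) < n
          · simp [G, hi, initial, hi.ne]
          · have : (i : ℕ) = n := by omega
            simp [G, initial, this]
    · rw [hχ, Function.update_self]
      refine fun hcon => hy' x ?_
      rw [Formula.realize_relabel] at hcon ⊢
      convert hcon using 1
      funext k
      rcases k with k | k <;> rfl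
  obtain ⟨e₀⟩ := (inferInstance : Nonempty (Substructure.closure L (Z 0)))
  have hcl : ∀ n, Substructure.closure L (insert (e₀ : E) (Z n)) = Substructure.closure L (Z n) :=
    fun n => le_antisymm (Substructure.closure_le.2 (insert_subset
      (Substructure.closure_mono (hZ (Nat.zero_le n)) e₀.2) Substructure.subset_closure))
      (Substructure.closure_mono (subset_insert _ _))
  obtain ⟨n, hn⟩ := key (fun n => insert (e₀ : E) (Z n))
    (fun i j hij => insert_subset_insert (hZ hij))
    (fun n => (hZc n).insert _) ⟨e₀, mem_insert _ _⟩ (by rw [hcl]; infer_instance)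
  rw [hcl] at hn
  exact ⟨n, hn.mono le_rfl ((subset_insert _ _).trans Substructure.subset_closure)⟩

end Chain

section Order

variable {T : L.Theory} {κ : Cardinal.{u}} {E : Type u} [L.Structure E]

/-- No formula with parameters orders infinite sequences of finite tuples. -/
theorem Ambient.not_order (h : Ambient T κ E) {ι₁ ι₂ : Type} [Finite ι₁] [Finite ι₂]
    (φ : L.Formula (E ⊕ (ι₁ ⊕ ι₂))) (x : ℕ → ι₁ → E) (y : ℕ → ι₂ → E)
    (hxy : ∀ k n, k ≠ n → (φ.Realize (Sum.elim id (Sum.elim (x k) (y n))) ↔ k < n)) : False := by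
  classical
  have hEi := h.infinite
  let D : Ultrafilter ((ι₁ ⊕ ι₂) → E) := (hyperfilter ℕ).map fun n => Sum.elim (x n) (y n)
  have hD : ∀ P : ((ι₁ ⊕ ι₂) → E) → Prop, (∃ m, ∀ n, m < n → P (Sum.elim (x n) (y n))) →
      ∀ᶠ v in (D : Filter ((ι₁ ⊕ ι₂) → E)), P v := fun P ⟨m, hm⟩ => by
    change ∀ᶠ n in (hyperfilter ℕ : Filter ℕ), P (Sum.elim (x n) (y n))
    refine hyperfilter_le_cofinite ?_
    rw [Nat.cofinite_eq_atTop]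
    filter_upwards [Filter.eventually_gt_atTop m] with n hn using hm n hn
  obtain ⟨M, _, f, J, hf, hJ⟩ := exists_dseq (L := L) D (ULift.{u} ℚ)
  have hM := h.of_eqT hf
  let R (a b : (ι₁ ⊕ ι₂) → M) : Prop :=
    φ.Realize (Sum.elim f (Sum.elim (a ∘ Sum.inl) (b ∘ Sum.inr)))
  have hRbase : ∀ k n, k ≠ n →
      (R (f ∘ Sum.elim (x k) (y k)) (f ∘ Sum.elim (x n) (y n)) ↔ k < n) := fun k n hkn => by
    rw [← hxy k n hkn, eqT_embedding_iff_comp hf (Sum.elim id (Sum.elim (x k) (y n))) φ]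
    simp only [R]
    refine iff_of_eq (congrArg _ ?_)
    funext k
    rcases k with k | k | k <;> rfl
  have hR1 : ∀ (i : ULift.{u} ℚ) (C : Set M), Avg L f D C (J i) → range f ⊆ C →
      ∀ a : (ι₁ ⊕ ι₂) → M, (∀ k, a k ∈ C) →
      ((R a (J i) ↔ ∀ᶠ v in (D : Filter ((ι₁ ⊕ ι₂) → E)), R a (f ∘ v)) ∧
      (R (J i) a ↔ ∀ᶠ v in (D : Filter ((ι₁ ⊕ ι₂) → E)), R (f ∘ v) a)) := by
    intro i C hav hC a ha
    have hc : ∀ k : E ⊕ (ι₁ ⊕ ι₂), Sum.elim f a k ∈ Substructure.closure L C := by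
      rintro (k | k)
      · exact Substructure.subset_closure (hC ⟨k, rfl⟩)
      · exact Substructure.subset_closure (ha k)
    constructor
    · let g : E ⊕ (ι₁ ⊕ ι₂) → (E ⊕ (ι₁ ⊕ ι₂)) ⊕ (ι₁ ⊕ ι₂) :=
        Sum.elim (Sum.inl ∘ Sum.inl) (Sum.elim (Sum.inl ∘ Sum.inr ∘ Sum.inl) (Sum.inr ∘ Sum.inr))
      have hg : ∀ b : (ι₁ ⊕ ι₂) → M, (φ.relabel g).Realize (Sum.elim (Sum.elim f a) b) ↔ R a b :=
        fun b => by
          rw [Formula.realize_relabel]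
          simp only [R]
          congr! 1
          funext k
          rcases k with k | k | k <;> rfl
      rw [← hg, hav.iff _ hc]
      simp_rw [hg]
    · let g : E ⊕ (ι₁ ⊕ ι₂) → (E ⊕ (ι₁ ⊕ ι₂)) ⊕ (ι₁ ⊕ ι₂) :=
        Sum.elim (Sum.inl ∘ Sum.inl) (Sum.elim (Sum.inr ∘ Sum.inl) (Sum.inl ∘ Sum.inr ∘ Sum.inr))
      have hg : ∀ b : (ι₁ ⊕ ι₂) → M, (φ.relabel g).Realize (Sum.elim (Sum.elim f a) b) ↔ R b a :=
        fun b => by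
          rw [Formula.realize_relabel]
          simp only [R]
          congr! 1
          funext k
          rcases k with k | k | k <;> rfl
      rw [← hg, hav.iff _ hc]
      simp_rw [hg]
  have hRJ : ∀ q r : ULift.{u} ℚ, q ≠ r → (R (J q) (J r) ↔ r < q) := by
    have hav : ∀ i, Avg L f D (range f) (J i) := fun i =>
      (hJ i).mono (subset_union_left.trans Substructure.subset_closure)
    intro q r hqr
    have hfm : ∀ n k, (f ∘ Sum.elim (x n) (y n)) k ∈ range f := fun n k => ⟨_, rfl⟩
    rcases lt_or_gt_of_ne hqr with hlt | hlt
    · refine iff_of_false (fun hcon => ?_) hlt.asymm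
      rw [(hR1 r _ (hJ r) subset_union_left (J q) (fun k =>
        Or.inr (mem_iUnion₂.2 ⟨q, hlt, k, rfl⟩))).1] at hcon
      have h2 : ∀ᶠ v in (D : Filter ((ι₁ ⊕ ι₂) → E)), ¬ R (J q) (f ∘ v) := by
        refine hD (fun v => ¬ R (J q) (f ∘ v)) ⟨0, fun n _ => ?_⟩
        rw [((hR1 q _ (hav q) le_rfl _ (hfm n)).2), ← Ultrafilter.eventually_not]
        refine hD (fun v => ¬ R (f ∘ v) _) ⟨n, fun m hm => ?_⟩
        rw [hRbase m n hm.ne']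
        exact hm.asymm
      obtain ⟨v, hv, hv'⟩ := (hcon.and h2).exists
      exact hv' hv
    · refine iff_of_true ?_ hlt
      rw [(hR1 q _ (hJ q) subset_union_left (J r) (fun k =>
        Or.inr (mem_iUnion₂.2 ⟨r, hlt, k, rfl⟩))).2]
      refine hD (fun v => R (f ∘ v) (J r)) ⟨0, fun n _ => ?_⟩
      rw [((hR1 r _ (hav r) le_rfl _ (hfm n)).1)]
      refine hD (fun v => R _ (f ∘ v)) ⟨n, fun m hm => ?_⟩
      rw [hRbase n m hm.ne]
      exact hm
  obtain ⟨F, ψ, hψ, -⟩ := exists_finset_params (T := T) φ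
  obtain ⟨Z, hFZ, hZc, hZi⟩ := exists_countable_infinite (L := L) (F.countable_toSet)
  let l (n : ℕ) : ULift.{u} ℚ := ⟨-(1 / ((n : ℚ) + 1))⟩
  let r (n : ℕ) : ULift.{u} ℚ := ⟨1 / ((n : ℚ) + 1)⟩
  have hl0 : ∀ n, l n < ⟨0⟩ := fun n => by
    change -(1 / ((n : ℚ) + 1)) < 0
    rw [neg_lt_zero]; positivity
  have hr0 : ∀ n, ⟨0⟩ < r n := fun n => by
    change 0 < (1 / ((n : ℚ) + 1))
    positivity
  have hr : ∀ i n, i < n → r n < r i := fun i n hin => by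
    change 1 / ((n : ℚ) + 1) < 1 / ((i : ℚ) + 1)
    have : (i : ℚ) < n := by exact_mod_cast hin
    gcongr
  have hl : ∀ i n, i < n → l i < l n := fun i n hin => by
    change -(1 / ((i : ℚ) + 1)) < -(1 / ((n : ℚ) + 1))
    exact neg_lt_neg (hr i n hin)
  let W (n : ℕ) : Set (ULift.{u} ℚ) := {j | ∃ i < n, j = l i ∨ j = r i}
  have hWm : Monotone W := fun m n hmn j ⟨i, hi, hj⟩ => ⟨i, hi.trans_le hmn, hj⟩
  have hWc : ∀ n, (W n).Finite := fun n => by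
    refine (((Set.finite_lt_nat n).image l).union ((Set.finite_lt_nat n).image r)).subset ?_
    rintro j ⟨i, hi, rfl | rfl⟩
    exacts [Or.inl ⟨i, hi, rfl⟩, Or.inr ⟨i, hi, rfl⟩]
  let S (n : ℕ) : Set M := f '' Z ∪ (Function.uncurry J) '' (W n ×ˢ Set.univ)
  have hSinf : Infinite (Substructure.closure L (S 0)) := by
    have h1 : (f '' (Substructure.closure L Z : Set E)).Infinite :=
      (Set.infinite_coe_iff.1 hZi).image (hf.injective Function.injective_id).injOn
    rw [closure_image_eq hf] at h1
    exact (h1.mono (Substructure.closure_mono subset_union_left)).to_subtype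
  obtain ⟨n, hn⟩ := hM.exists_fs_succ (Z := S)
    (fun a b hab => union_subset_union_right _ (image_mono (prod_mono (hWm hab) le_rfl)))
    (fun n => (hZc.image f).union ((((hWc n).prod finite_univ).image _).countable)) (J ⟨0⟩)
  have hlW : l n ∈ W (n + 1) := ⟨n, n.lt_succ_self, Or.inl rfl⟩
  have hrW : r n ∈ W (n + 1) := ⟨n, n.lt_succ_self, Or.inr rfl⟩
  have hRψ : ∀ a b : (ι₁ ⊕ ι₂) → M, R a b ↔
      ψ.Realize (Sum.elim (fun k : F => f k) (Sum.elim (a ∘ Sum.inl) (b ∘ Sum.inr))) :=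
    fun a b => hψ _ _ _
  let γ := F ⊕ ((ι₁ ⊕ ι₂) ⊕ (ι₁ ⊕ ι₂))
  let cc : γ → M := Sum.elim (fun k : F => f k) (Sum.elim (J (l n)) (J (r n)))
  have hcc : ∀ k, cc k ∈ Substructure.closure L (S (n + 1)) := by
    rintro (k | k | k)
    · exact Substructure.subset_closure (Or.inl ⟨k, hFZ k.2, rfl⟩)
    · exact Substructure.subset_closure (Or.inr ⟨(l n, k), ⟨hlW, trivial⟩, rfl⟩)
    · exact Substructure.subset_closure (Or.inr ⟨(r n, k), ⟨hrW, trivial⟩, rfl⟩)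
  let g₁ : F ⊕ (ι₁ ⊕ ι₂) → γ ⊕ (ι₁ ⊕ ι₂) := Sum.elim (Sum.inl ∘ Sum.inl)
    (Sum.elim (Sum.inr ∘ Sum.inl) (Sum.inl ∘ Sum.inr ∘ Sum.inl ∘ Sum.inr))
  let g₂ : F ⊕ (ι₁ ⊕ ι₂) → γ ⊕ (ι₁ ⊕ ι₂) := Sum.elim (Sum.inl ∘ Sum.inl)
    (Sum.elim (Sum.inr ∘ Sum.inl) (Sum.inl ∘ Sum.inr ∘ Sum.inr ∘ Sum.inr))
  have hg : ∀ b, (ψ.relabel g₁ ⊓ (ψ.relabel g₂).not).Realize (Sum.elim cc b) ↔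
      R b (J (l n)) ∧ ¬ R b (J (r n)) := fun b => by
    rw [hRψ, hRψ, Formula.realize_inf, Formula.realize_not, Formula.realize_relabel,
      Formula.realize_relabel]
    congr! 3 <;> (funext k; rcases k with k | k | k <;> rfl)
  obtain ⟨a, ha, hφa⟩ := hn.exists_mem cc hcc _ ((hg _).2
    ⟨(hRJ _ _ (hl0 n).ne').2 (hl0 n), fun hcon => (hr0 n).asymm ((hRJ _ _ (hr0 n).ne).1 hcon)⟩)
  rw [hg] at hφa
  let V : Set (ULift.{u} ℚ) := insert (l n) (W n)
  have hlt : ∀ j ∈ W n, j < l n ∧ j < r n ∨ l n < j ∧ r n < j := by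
    rintro j ⟨i, hi, rfl | rfl⟩
    · exact Or.inl ⟨hl i n hi, (hl0 i).trans (hr0 n)⟩
    · exact Or.inr ⟨(hl0 n).trans (hr0 i), hr i n hi⟩
  have hlV : l n ∉ W n := fun hmem => by
    rcases hlt _ hmem with h1 | h1 <;> exact lt_irrefl _ h1.1
  have hmove := hJ.eqT_move (π := Function.update id (l n) (r n)) (S := V) (by
    rintro p (rfl | hp) q (rfl | hq) hpq
    · exact absurd hpq (lt_irrefl _)
    · rw [Function.update_self, Function.update_of_ne (ne_of_mem_of_not_mem hq hlV)]
      rcases hlt q hq with h1 | h1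
      · exact absurd hpq h1.1.asymm
      · exact h1.2
    · rw [Function.update_self, Function.update_of_ne (ne_of_mem_of_not_mem hp hlV)]
      rcases hlt p hp with h1 | h1
      · exact h1.2
      · exact absurd hpq h1.1.asymm
    · rw [Function.update_of_ne (ne_of_mem_of_not_mem hp hlV),
        Function.update_of_ne (ne_of_mem_of_not_mem hq hlV)]
      exact hpq)
  let vW : E ⊕ (W n × (ι₁ ⊕ ι₂)) → M := Sum.elim f (fun p => J p.1 p.2)
  have haW : ∀ k, a k ∈ Substructure.closure L (range vW) := fun k => by
    refine Substructure.closure_mono ?_ (ha k)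
    rintro _ (⟨z, -, rfl⟩ | ⟨⟨j, k⟩, ⟨hj, -⟩, rfl⟩)
    · exact ⟨Sum.inl z, rfl⟩
    · exact ⟨Sum.inr (⟨j, hj⟩, k), rfl⟩
  obtain ⟨t, ht⟩ := exists_terms _ vW (fun m hm => hm) a haW
  have hVW : ∀ j : W n, (j : ULift.{u} ℚ) ∈ V := fun j => mem_insert_of_mem _ j.2
  let u₁ : E ⊕ (V × (ι₁ ⊕ ι₂)) → M := Sum.elim f (Function.uncurry fun s : V => J s)
  let u₂ : E ⊕ (V × (ι₁ ⊕ ι₂)) → M :=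
    Sum.elim f (Function.uncurry fun s : V => J (Function.update id (l n) (r n) s))
  have hmove' : EqT L u₁ u₂ := hmove
  let G : E ⊕ (W n × (ι₁ ⊕ ι₂)) → E ⊕ (V × (ι₁ ⊕ ι₂)) :=
    Sum.map id fun p => (⟨p.1, hVW p.1⟩, p.2)
  have hG₁ : u₁ ∘ G = vW := by funext k; rcases k with k | k <;> rfl
  have hG₂ : u₂ ∘ G = vW := by
    funext k
    rcases k with k | ⟨⟨j, hj⟩, k⟩
    · rfl
    · have : j ≠ l n := fun h => hlV (h ▸ hj)
      simp [u₂, G, vW, Function.update_of_ne this]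
  have h3 := hmove'.terms (Sum.elim (fun k : E => Term.var (Sum.inl k)) (Sum.elim
    (fun k : ι₁ => (t (Sum.inl k)).relabel G)
    (fun k : ι₂ => Term.var (Sum.inr (⟨l n, mem_insert _ _⟩, Sum.inr k))))) φ
  have h4 : ∀ (w : E ⊕ (V × (ι₁ ⊕ ι₂)) → M) (j : ULift.{u} ℚ), w ∘ G = vW →
      (∀ k : E, w (Sum.inl k) = f k) →
      (∀ k, w (Sum.inr (⟨l n, mem_insert _ _⟩, Sum.inr k)) = J j (Sum.inr k)) →
      (fun i => Term.realize w (Sum.elim (fun k : E => Term.var (Sum.inl k)) (Sum.elim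
        (fun k : ι₁ => (t (Sum.inl k)).relabel G)
        (fun k : ι₂ => Term.var (Sum.inr (⟨l n, mem_insert _ _⟩, Sum.inr k)))) i)) =
      Sum.elim f (Sum.elim (a ∘ Sum.inl) (J j ∘ Sum.inr)) := fun w j hw hE hj => by
    funext k
    rcases k with k | k | k
    · simpa using hE k
    · simp only [Sum.elim_inr, Sum.elim_inl, Term.realize_relabel]
      rw [hw, ht]; rfl
    · simpa using hj k
  rw [h4 u₁ (l n) hG₁ (fun k => rfl) (fun k => rfl), h4 u₂ (r n) hG₂ (fun k => rfl)
    (fun k => by simp [u₂])] at h3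
  exact hφa.2 (h3.1 hφa.1)

end Order

theorem exists_fin_params {α ι : Type*} (φ : L.Formula (α ⊕ ι)) :
    ∃ (n : ℕ) (g : Fin n → α) (ψ : L.Formula (Fin n ⊕ ι)), ∀ (M : Type u) [L.Structure M]
      (a : α → M) (x : ι → M), φ.Realize (Sum.elim a x) ↔ ψ.Realize (Sum.elim (a ∘ g) x) := by
  obtain ⟨F, ψ, hψ, -⟩ := exists_finset_params (T := (∅ : L.Theory)) φ
  let e := F.equivFin
  refine ⟨_, fun i => (e.symm i : α), ψ.relabel (Sum.map e id), fun M _ a x => ?_⟩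
  rw [hψ, Formula.realize_relabel]
  congr! 1
  funext k
  rcases k with k | k <;> simp

section Independence

variable {T : L.Theory} {κ : Cardinal.{u}} {E : Type u} [L.Structure E]
variable {N : L.Substructure E} {C : Set E} {ρ : Type*}

theorem FS.exists_agree {ι : Type*} {b : ι → E} (h : FS L N C b) (φ : L.Formula (ρ ⊕ ι))
    (K : Finset (ρ → E)) (hK : ∀ d ∈ K, ∀ k, d k ∈ Substructure.closure L C) :
    ∃ x : ι → E, (∀ i, x i ∈ N) ∧
      ∀ d ∈ K, φ.Realize (Sum.elim d x) ↔ φ.Realize (Sum.elim d b) := by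
  classical
  let θ (d : K) : L.Formula (Substructure.closure L C ⊕ ι) :=
    φ.relabel (Sum.map (fun k => ⟨d.1 k, hK d d.2 k⟩) id)
  have hθ : ∀ (d : K) (x : ι → E), (θ d).Realize (Sum.elim Subtype.val x) ↔
      φ.Realize (Sum.elim d.1 x) := fun d x => by
    simp only [θ, Formula.realize_relabel]
    congr! 1
    funext k
    rcases k with k | k <;> rfl
  obtain ⟨χ, hχ, -⟩ := exists_conj (T := (∅ : L.Theory)) (Finset.univ.image fun d : K =>
    if φ.Realize (Sum.elim d.1 b) then θ d else (θ d).not)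
  have hχ' : ∀ x : ι → E, χ.Realize (Sum.elim Subtype.val x) ↔
      ∀ d ∈ K, φ.Realize (Sum.elim d x) ↔ φ.Realize (Sum.elim d b) := fun x => by
    rw [hχ, Finset.forall_mem_image]
    simp only [Finset.mem_univ, true_imp_iff, Subtype.forall]
    refine forall₂_congr fun d hd => ?_
    split_ifs with hb
    · rw [hθ]; simp [hb]
    · rw [Formula.realize_not, hθ]; simp [hb]
  obtain ⟨x, hx, hx'⟩ := h.exists_mem Subtype.val (fun k => k.2) χ ((hχ' b).2 fun d _ => Iff.rfl)
  exact ⟨x, hx, (hχ' x).1 hx'⟩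

/-- Types finitely satisfiable in an infinite substructure `N` are determined by their restriction
to `N`. -/
theorem Ambient.eqT_of_fs (h : Ambient T κ E) [Infinite N]
    (hC : (N : Set E) ⊆ Substructure.closure L C) {ι : Type} [Finite ι] {b₁ b₂ : ι → E}
    (h₁ : FS L N C b₁) (h₂ : FS L N C b₂)
    (hb : EqT L (Sum.elim (fun k : N => (k : E)) b₁) (Sum.elim (↑) b₂)) :
    EqT L (Sum.elim (fun k : C => (k : E)) b₁) (Sum.elim (↑) b₂) := by
  classical
  suffices key : ∀ b₁ b₂ : ι → E, FS L N C b₁ → FS L N C b₂ →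
      EqT L (Sum.elim (fun k : N => (k : E)) b₁) (Sum.elim (↑) b₂) →
      ∀ φ : L.Formula (C ⊕ ι), φ.Realize (Sum.elim (↑) b₁) → φ.Realize (Sum.elim (↑) b₂) from
    fun φ => ⟨key b₁ b₂ h₁ h₂ hb φ, key b₂ b₁ h₂ h₁ hb.symm φ⟩
  clear h₁ h₂ hb b₁ b₂
  intro b₁ b₂ h₁ h₂ hb φ hφ₁
  by_contra hφ₂
  obtain ⟨m, g, ψ, hψ⟩ := exists_fin_params φ
  let d₀ : Fin m → E := fun i => (g i : E)
  let R (x : ι → E) (d : Fin m → E) : Prop := ψ.Realize (Sum.elim d x)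
  have hR₁ : R b₁ d₀ := (hψ _ _ _).1 hφ₁
  have hR₂ : ¬ R b₂ d₀ := fun hcon => hφ₂ ((hψ _ _ _).2 hcon)
  have hd₀ : ∀ i, d₀ i ∈ Substructure.closure L C := fun i => Substructure.subset_closure (g i).2
  have hNb : ∀ d : Fin m → E, (∀ i, d i ∈ N) → (R b₁ d ↔ R b₂ d) := fun d hd => by
    have h3 := hb.comp (Sum.map (fun i : Fin m => (⟨d i, hd i⟩ : N)) id) ψ
    rw [Sum.elim_comp_map, Sum.elim_comp_map] at h3
    exact h3
  have hfd : FS L N (N : Set E) d₀ := h.fs_of_subset N le_rfl d₀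
  have hagree : ∀ b : ι → E, FS L N C b → ∀ K : Finset (Fin m → E), (∀ d ∈ K, ∀ i, d i ∈ N) →
      ∃ x : ι → E, (∀ i, x i ∈ N) ∧ (R x d₀ ↔ R b d₀) ∧ ∀ d ∈ K, R x d ↔ R b d := by
    intro b hb K hK
    obtain ⟨x, hx, hx'⟩ := hb.exists_agree ψ (insert d₀ K) (by
      intro d hd
      rcases Finset.mem_insert.1 hd with rfl | hd
      exacts [hd₀, fun i => hC (hK d hd i)])
    exact ⟨x, hx, hx' _ (Finset.mem_insert_self _ _), fun d hd =>
      hx' _ (Finset.mem_insert_of_mem hd)⟩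
  obtain ⟨a, ha, haa⟩ := exists_seq_of_forall_finset_exists
    (fun a : (ι → E) × (ι → E) × (Fin m → E) => (∀ i, a.1 i ∈ N) ∧ (∀ i, a.2.1 i ∈ N) ∧
      (∀ i, a.2.2 i ∈ N) ∧ R a.1 d₀ ∧ ¬ R a.2.1 d₀)
    (fun a a' => R a.1 a'.2.2 ∧ ¬ R a.2.1 a'.2.2 ∧ (R a'.1 a.2.2 ↔ R b₁ a.2.2) ∧
      (R a'.2.1 a.2.2 ↔ R b₂ a.2.2)) (by
    intro s hs
    obtain ⟨d, hdN, hd⟩ := hfd.exists_agree (ψ.relabel Sum.swap)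
      (s.image (fun a => a.1) ∪ s.image (fun a => a.2.1)) (by
        intro x hx i
        refine Substructure.subset_closure ?_
        rcases Finset.mem_union.1 hx with hx | hx <;> obtain ⟨a, ha, rfl⟩ := Finset.mem_image.1 hx
        exacts [(hs a ha).1 i, (hs a ha).2.1 i])
    simp only [Formula.realize_relabel, Sum.elim_swap] at hd
    obtain ⟨x₁, hx₁, hx₁', hx₁''⟩ := hagree b₁ h₁ (s.image fun a => a.2.2) (by
      intro x hx
      obtain ⟨a, ha, rfl⟩ := Finset.mem_image.1 hx
      exact (hs a ha).2.2.1)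
    obtain ⟨x₂, hx₂, hx₂', hx₂''⟩ := hagree b₂ h₂ (s.image fun a => a.2.2) (by
      intro x hx
      obtain ⟨a, ha, rfl⟩ := Finset.mem_image.1 hx
      exact (hs a ha).2.2.1)
    refine ⟨(x₁, x₂, d), ⟨hx₁, hx₂, hdN, hx₁'.2 hR₁, fun hcon => hR₂ (hx₂'.1 hcon)⟩,
      fun a ha => ⟨?_, ?_, hx₁'' _ (Finset.mem_image_of_mem _ ha),
        hx₂'' _ (Finset.mem_image_of_mem _ ha)⟩⟩
    · exact (hd a.1 (Finset.mem_union_left _ (Finset.mem_image_of_mem _ ha))).2 (hs a ha).2.2.2.1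
    · exact fun hcon => (hs a ha).2.2.2.2 ((hd a.2.1 (Finset.mem_union_right _
        (Finset.mem_image_of_mem (fun a => a.2.1) ha))).1 hcon))
  let ψ' : L.Formula (E ⊕ (ι ⊕ Fin m)) :=
    ψ.relabel (Sum.elim (Sum.inr ∘ Sum.inr) (Sum.inr ∘ Sum.inl))
  have hψ' : ∀ x d, ψ'.Realize (Sum.elim id (Sum.elim x d)) ↔ R x d := fun x d => by
    simp only [ψ', R, Formula.realize_relabel]
    congr! 1
    funext k
    rcases k with k | k <;> rfl
  by_cases hfreq : ∃ᶠ n in atTop, R b₁ (a n).2.2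
  · obtain ⟨σ, hσ, hσR⟩ := Filter.extraction_of_frequently_atTop hfreq
    refine h.not_order ψ'.not (fun n => (a (σ n)).2.1) (fun n => (a (σ n)).2.2) fun k n hkn => ?_
    rw [Formula.realize_not, hψ']
    rcases lt_or_gt_of_ne hkn with hlt | hlt
    · exact iff_of_true (haa _ _ (hσ hlt)).2.1 hlt
    · refine iff_of_false (not_not.2 ?_) hlt.asymm
      exact (haa _ _ (hσ hlt)).2.2.2.2 ((hNb _ (ha _).2.2.1).1 (hσR n))
  · rw [Filter.not_frequently] at hfreq
    obtain ⟨σ, hσ, hσR⟩ := Filter.extraction_of_frequently_atTop hfreq.frequently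
    refine h.not_order ψ' (fun n => (a (σ n)).1) (fun n => (a (σ n)).2.2) fun k n hkn => ?_
    rw [hψ']
    rcases lt_or_gt_of_ne hkn with hlt | hlt
    · exact iff_of_true (haa _ _ (hσ hlt)).1 hlt
    · exact iff_of_false (fun hcon => hσR n ((haa _ _ (hσ hlt)).2.2.1.1 hcon)) hlt.asymm

theorem Ambient.fs_symm (h : Ambient T κ E) [Infinite N] {ι ι' : Type} [Finite ι] [Finite ι']
    {d : ι → E} {y : ι' → E} (hy : FS L N (N ∪ range d) y) : FS L N (N ∪ range y) d := by
  classical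
  refine FS.of_family (Sum.elim (Subtype.val : N → E) y) (by simp [Set.Sum.elim_range])
    fun φ hφ => ?_
  by_contra! hcon
  let R (d : ι → E) (y : ι' → E) : Prop := φ.Realize (Sum.elim (Sum.elim (Subtype.val : N → E) y) d)
  let φ₁ : L.Formula ((N ⊕ ι) ⊕ ι') := φ.relabel
    (Sum.elim (Sum.elim (Sum.inl ∘ Sum.inl) Sum.inr) (Sum.inl ∘ Sum.inr))
  have hφ₁ : ∀ d y, φ₁.Realize (Sum.elim (Sum.elim (Subtype.val : N → E) d) y) ↔ R d y :=
    fun d y => by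
      simp only [φ₁, R, Formula.realize_relabel]
      congr! 1
      funext k
      rcases k with (k | k) | k <;> rfl
  have hfd : FS L N (N : Set E) d := h.fs_of_subset N le_rfl d
  obtain ⟨a, ha, haa⟩ := exists_seq_of_forall_finset_exists
    (fun a : (ι → E) × (ι' → E) => (∀ i, a.1 i ∈ N) ∧ (∀ i, a.2 i ∈ N) ∧ R d a.2)
    (fun a a' => ¬ R a.1 a'.2 ∧ R a'.1 a.2) (by
    intro s hs
    obtain ⟨y', hy'N, hy'⟩ := hy.exists_agree φ₁
      (insert (Sum.elim Subtype.val d) (s.image fun a => Sum.elim Subtype.val a.1)) (by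
        intro x hx k
        refine Substructure.subset_closure ?_
        rcases Finset.mem_insert.1 hx with rfl | hx
        · rcases k with k | k
          exacts [Or.inl k.2, Or.inr ⟨k, rfl⟩]
        · obtain ⟨a, ha, rfl⟩ := Finset.mem_image.1 hx
          rcases k with k | k
          exacts [Or.inl k.2, Or.inl ((hs a ha).1 k)])
    obtain ⟨d', hd'N, hd'⟩ := hfd.exists_agree φ
      (s.image fun a => Sum.elim Subtype.val a.2) (by
        intro x hx k
        refine Substructure.subset_closure ?_
        obtain ⟨a, ha, rfl⟩ := Finset.mem_image.1 hx
        rcases k with k | k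
        exacts [k.2, (hs a ha).2.1 k])
    refine ⟨(d', y'), ⟨hd'N, hy'N, ?_⟩, fun a ha => ⟨?_, ?_⟩⟩
    · rw [← hφ₁, hy' _ (Finset.mem_insert_self _ _), hφ₁]
      exact hφ
    · rw [← hφ₁, hy' _ (Finset.mem_insert_of_mem (Finset.mem_image_of_mem
        (fun a : (ι → E) × (ι' → E) => Sum.elim (Subtype.val : N → E) a.1) ha)), hφ₁]
      exact hcon _ (hs a ha).1
    · exact (hd' _ (Finset.mem_image_of_mem
        (fun a : (ι → E) × (ι' → E) => Sum.elim (Subtype.val : N → E) a.2) ha)).2 (hs a ha).2.2)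
  let ψ' : L.Formula (E ⊕ (ι ⊕ ι')) := φ.relabel (Sum.elim (Sum.elim (fun k : N => Sum.inl (k : E))
    (Sum.inr ∘ Sum.inr)) (Sum.inr ∘ Sum.inl))
  have hψ' : ∀ d y, ψ'.Realize (Sum.elim id (Sum.elim d y)) ↔ R d y := fun x d => by
    simp only [ψ', R, Formula.realize_relabel]
    congr! 1
    funext k
    rcases k with (k | k) | k <;> rfl
  refine h.not_order ψ'.not (fun n => (a n).1) (fun n => (a n).2) fun k n hkn => ?_
  rw [Formula.realize_not, hψ']
  rcases lt_or_gt_of_ne hkn with hlt | hlt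
  · exact iff_of_true (haa _ _ hlt).1 hlt
  · exact iff_of_false (not_not.2 (haa _ _ hlt).2) hlt.asymm

/-- Every finite tuple has a finite base in `X` over a countable set. -/
theorem Ambient.exists_finset_base (h : Ambient T κ E) {Z : Set E} (hZ : Z.Countable)
    [Infinite (Substructure.closure L Z)] (X : Set E) {ι : Type} [Finite ι] (b : ι → E) :
    ∃ s : Finset E, (s : Set E) ⊆ X ∧
      FS L (Substructure.closure L (Z ∪ s)) (Substructure.closure L (Z ∪ X) : Set E) b := by
  classical
  by_contra! hcon
  have hnext : ∀ s : {s : Finset E // (s : Set E) ⊆ X}, ∃ s' : {s : Finset E // (s : Set E) ⊆ X},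
      s.1 ⊆ s'.1 ∧ ¬ FS L (Substructure.closure L (Z ∪ s.1)) (Z ∪ s'.1) b := by
    rintro ⟨s, hs⟩
    have h1 := hcon s hs
    unfold FS at h1
    push Not at h1
    obtain ⟨φ, hφ, hφ'⟩ := h1
    obtain ⟨m, g, ψ, hψ⟩ := exists_fin_params φ
    obtain ⟨s', hs', hgs'⟩ := exists_finset_forall_mem_closure (fun i => (g i).2)
    refine ⟨⟨s ∪ s'.filter (· ∈ X), ?_⟩, Finset.subset_union_left, fun hfs => ?_⟩
    · intro x hx
      rcases Finset.mem_union.1 (Finset.mem_coe.1 hx) with hx | hx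
      exacts [hs hx, (Finset.mem_filter.1 hx).2]
    · have hsub : (s' : Set E) ⊆ Z ∪ ↑(s ∪ s'.filter (· ∈ X)) := fun x hx => by
        rcases hs' hx with hxZ | hxX
        · exact Or.inl hxZ
        · exact Or.inr (Finset.mem_coe.2 (Finset.mem_union_right _ (Finset.mem_filter.2 ⟨hx, hxX⟩)))
      obtain ⟨x, hx, hx'⟩ := hfs.exists_mem (fun i => (g i : E))
        (fun i => Substructure.closure_mono hsub (hgs' i)) ψ ((hψ _ _ _).1 hφ)
      exact hφ' x hx ((hψ _ _ _).2 hx')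
  choose nx hnx hnx' using hnext
  let σ : ℕ → {s : Finset E // (s : Set E) ⊆ X} := fun n => nx^[n] ⟨∅, by simp⟩
  have hσ : ∀ n, σ (n + 1) = nx (σ n) := fun n => Function.iterate_succ_apply' _ _ _
  have hσm : Monotone fun n => Z ∪ ((σ n).1 : Set E) := monotone_nat_of_le_succ fun n => by
    rw [hσ]
    exact union_subset_union_right _ (Finset.coe_subset.2 (hnx _))
  have : Infinite (Substructure.closure L (Z ∪ ((σ 0).1 : Set E))) := by
    simpa [σ] using (inferInstance : Infinite (Substructure.closure L Z))
  obtain ⟨n, hn⟩ := h.exists_fs_succ hσm (fun n => hZ.union (Finset.countable_toSet _)) b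
  rw [hσ] at hn
  exact hnx' _ hn

end Independence

theorem nonempty_embedding_of_countable {X : Type u} [Infinite X] {α : Type*} [Countable α] :
    Nonempty (α ↪ X) :=
  let ⟨f, hf⟩ := exists_injective_nat α
  ⟨(⟨f, hf⟩ : α ↪ ℕ).trans (Infinite.natEmbedding X)⟩

theorem FS.exists_ultrafilter {E : Type u} [L.Structure E] {N : L.Substructure E} {C : Set E}
    {ι : Type} {b : ι → E} (h : FS L N C b) :
    ∃ D : Ultrafilter (ι → N), Avg L (Subtype.val : N → E) D C b := by
  classical
  let S : L.Formula (C ⊕ ι) → Set (ι → N) := fun φ =>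
    {x | φ.Realize (Sum.elim (Subtype.val : C → E) b) →
      φ.Realize (Sum.elim Subtype.val (Subtype.val ∘ x))}
  obtain ⟨D, hD⟩ := Ultrafilter.exists_ultrafilter_of_finite_inter_nonempty (S '' univ)
    fun F hF => by
      obtain ⟨s, -, rfl⟩ := Finset.subset_set_image_iff.1 hF
      obtain ⟨χ, hχ, -⟩ := exists_conj (T := (∅ : L.Theory))
        (s.filter fun φ => φ.Realize (Sum.elim (Subtype.val : C → E) b))
      obtain ⟨x, hx, hx'⟩ := h χ ((hχ _ _).2 fun φ hφ => (Finset.mem_filter.1 hφ).2)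
      refine ⟨fun i => ⟨x i, hx i⟩, ?_⟩
      rintro _ hφ
      obtain ⟨φ, hφs, rfl⟩ := Finset.mem_image.1 (Finset.mem_coe.1 hφ)
      exact fun hb => (hχ _ _).1 hx' φ (Finset.mem_filter.2 ⟨hφs, hb⟩)
  have hmem : ∀ φ, S φ ∈ D := fun φ => hD ⟨φ, mem_univ _, rfl⟩
  refine ⟨D, fun φ => ?_⟩
  refine ⟨fun hφ => ?_, fun hφ => ?_⟩
  · filter_upwards [hmem φ] with x hx
    exact hx hφ
  · by_contra hcon
    obtain ⟨x, hx, hx'⟩ := (hφ.and (hmem φ.not)).exists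
    exact Formula.realize_not.1 (hx' (Formula.realize_not.2 hcon)) hx

theorem Avg.fs {E : Type u} [L.Structure E] {N : L.Substructure E} {C : Set E} {ι : Type}
    {b : ι → E} {D : Ultrafilter (ι → N)} (h : Avg L (Subtype.val : N → E) D C b) :
    FS L N C b := fun φ hφ =>
  let ⟨x, hx⟩ := ((h φ).1 hφ).exists
  ⟨_, fun i => (x i).2, hx⟩

/-- An elementary map into another structure extends along the addition of one more average. -/
theorem Avg.eqT_elim {β : Type*} {M N : Type u} [L.Structure M] [L.Structure N] {ι : Type}
    {γ : Type*} {e : β → M} {e' : β → N} {D : Ultrafilter (ι → β)} {c : γ → M} {c' : γ → N}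
    {b : ι → M} {b' : ι → N} (hec : EqT L (Sum.elim e c) (Sum.elim e' c'))
    (hb : Avg L e D (range e ∪ range c) b) (hb' : Avg L e' D (range e' ∪ range c') b') :
    EqT L (Sum.elim (Sum.elim e c) b) (Sum.elim (Sum.elim e' c') b') := by
  intro φ
  rw [hb.iff _ (fun k => Substructure.subset_closure (by rw [← Sum.elim_range]; exact ⟨k, rfl⟩)),
    hb'.iff _ (fun k => Substructure.subset_closure (by rw [← Sum.elim_range]; exact ⟨k, rfl⟩))]
  refine iff_of_eq (congrArg (fun P => ∀ᶠ x in (D : Filter (ι → β)), P x) (funext fun x => ?_))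
  refine propext ?_
  have h1 := hec.comp (Sum.elim id fun k : ι => Sum.inl (x k)) φ
  rw [Sum.comp_elim, Sum.comp_elim] at h1
  exact h1

/-- A coheir sequence is determined by its type over the base. -/
theorem DSeq.of_eqT {β I : Type*} {M N : Type u} [L.Structure M] [L.Structure N] [LinearOrder I]
    {ι : Type} {e : β → M} {e' : β → N} {D : Ultrafilter (ι → β)} {J : I → ι → M}
    {J' : I → ι → N} (h : DSeq L e D J)
    (hJ : EqT L (Sum.elim e (Function.uncurry J)) (Sum.elim e' (Function.uncurry J'))) :
    DSeq L e' D J' := fun i => by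
  let g : β ⊕ (Iio i × ι) → β ⊕ (I × ι) := Sum.map id (Prod.map Subtype.val id)
  have hg : range e' ∪ ⋃ j < i, range (J' j) ⊆ range (Sum.elim e' (Function.uncurry J') ∘ g) := by
    rintro x (⟨k, rfl⟩ | hx)
    · exact ⟨Sum.inl k, rfl⟩
    · simp only [mem_iUnion, mem_range] at hx
      obtain ⟨j, hj, k, rfl⟩ := hx
      exact ⟨Sum.inr (⟨j, hj⟩, k), rfl⟩
  refine Avg.of_family _ hg fun φ => ?_
  have h1 := hJ.comp (Sum.elim g fun k => Sum.inr (i, k)) φ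
  rw [Sum.comp_elim, Sum.comp_elim] at h1
  have h2 : ∀ x : ι → β, φ.Realize (Sum.elim (Sum.elim e (Function.uncurry J) ∘ g) (e ∘ x)) ↔
      φ.Realize (Sum.elim (Sum.elim e' (Function.uncurry J') ∘ g) (e' ∘ x)) := fun x => by
    have h3 := hJ.comp (Sum.elim g fun k => Sum.inl (x k)) φ
    rw [Sum.comp_elim, Sum.comp_elim] at h3
    exact h3
  rw [← (show _ ↔ φ.Realize (Sum.elim (Sum.elim e' (Function.uncurry J') ∘ g) (J' i)) from h1)]
  simp only [← h2]
  refine (h i).iff _ (fun k => Substructure.subset_closure ?_) φ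
  rcases k with k | ⟨j, k⟩
  · exact Or.inl ⟨k, rfl⟩
  · exact Or.inr (mem_biUnion j.2 ⟨k, rfl⟩)

/-- A saturated model. -/
structure Monster (T : L.Theory) (κ : Cardinal.{u}) (X : Type u) (E : Type u) [L.Structure E] :
    Prop extends Ambient T κ E where
  infinite_index : Infinite X
  le_mk : max (max L.card κ) ℵ₀ ≤ #X
  sat : ∀ (Γ : Set (L.Formula (X ⊕ X))) (a : X → E),
    (∀ s : Finset (L.Formula (X ⊕ X)), ↑s ⊆ Γ → ∃ x, ∀ φ ∈ s, φ.Realize (Sum.elim a x)) →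
      ∃ x, ∀ φ ∈ Γ, φ.Realize (Sum.elim a x)

section Monster

variable {T : L.Theory} {κ : Cardinal.{u}} {X E : Type u} [L.Structure E]

theorem Ambient.exists_monster (h : Ambient T κ E) {χ : Cardinal.{u}} :
    ∃ (X : Type u) (M : Type u) (_ : L.Structure M), Monster T κ X M ∧ χ ≤ #X := by
  let X := (max (max L.card κ) (max χ ℵ₀)).out
  have hX : #X = max (max L.card κ) (max χ ℵ₀) := mk_out _
  have hXi : Infinite X := infinite_iff.2 (by rw [hX]; simp)
  have := h.infinite
  obtain ⟨N, _, f, hN, hR⟩ := exists_rich h.universal h.models X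
  have hA : Ambient T κ N := h.of_eqT (h.eqT_of_embedding hN f)
  have := hA.infinite
  refine ⟨X, N, _, { hA with
    infinite_index := hXi
    le_mk := by rw [hX]; exact max_le_max le_rfl (le_max_right _ _)
    sat := fun Γ a hΓ => ?_ }, ?_⟩
  · obtain ⟨M, _, f, v, hf, hv⟩ := exists_elementary_realization (E := N) (α := X)
      ((fun φ : L.Formula (X ⊕ X) => (φ.relabel (Sum.map a id) : L.Formula (N ⊕ X))) '' Γ) (by
        classical
        intro s hs
        obtain ⟨s', hs', rfl⟩ := Finset.subset_set_image_iff.1 hs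
        obtain ⟨x, hx⟩ := hΓ s' hs'
        refine ⟨x, fun φ hφ => ?_⟩
        obtain ⟨ψ, hψ, rfl⟩ := Finset.mem_image.1 hφ
        rw [Formula.realize_relabel, Sum.elim_comp_map]
        exact hx ψ hψ)
    refine hR Γ a (fun φ _ => absolute_of_kUnique h.universal h.uncountable h.unique φ) M
      (hf.models hN) hf.toEmbedding v fun φ hφ => ?_
    have h1 := hv _ (mem_image_of_mem _ hφ)
    rw [Formula.realize_relabel, Sum.elim_comp_map] at h1
    exact h1
  · rw [hX]
    exact (le_max_left _ _).trans (le_max_right _ _)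

theorem Monster.exists_realize (h : Monster T κ X E) {α ι : Type*} (hα : Nonempty (α ↪ X))
    (hι : Nonempty (ι ↪ X)) (Γ : Set (L.Formula (α ⊕ ι))) (a : α → E)
    (hΓ : ∀ s : Finset (L.Formula (α ⊕ ι)), ↑s ⊆ Γ →
      ∃ x, ∀ φ ∈ s, φ.Realize (Sum.elim a x)) :
    ∃ x, ∀ φ ∈ Γ, φ.Realize (Sum.elim a x) := by
  classical
  obtain ⟨f⟩ := hα
  obtain ⟨g⟩ := hι
  have := h.infinite
  let x₀ : E := Classical.arbitrary E
  have key : ∀ (φ : L.Formula (α ⊕ ι)) (x : X → E),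
      (φ.relabel (Sum.map f g)).Realize (Sum.elim (Function.extend f a fun _ => x₀) x) ↔
        φ.Realize (Sum.elim a (x ∘ g)) := fun φ x => by
    rw [Formula.realize_relabel, Sum.elim_comp_map, Function.extend_comp f.injective]
  obtain ⟨x, hx⟩ := h.sat ((fun φ : L.Formula (α ⊕ ι) => φ.relabel (Sum.map f g)) '' Γ)
    (Function.extend f a fun _ => x₀) (by
      intro s hs
      obtain ⟨s', hs', rfl⟩ := Finset.subset_set_image_iff.1 hs
      obtain ⟨x, hx⟩ := hΓ s' hs'
      refine ⟨Function.extend g x fun _ => x₀, fun φ hφ => ?_⟩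
      obtain ⟨ψ, hψ, rfl⟩ := Finset.mem_image.1 hφ
      rw [key, Function.extend_comp g.injective]
      exact hx ψ hψ)
  exact ⟨x ∘ g, fun φ hφ => (key φ x).1 (hx _ (mem_image_of_mem _ hφ))⟩

/-- Elementary maps into a saturated model extend. -/
theorem Monster.exists_extend (h : Monster T κ X E) {α ι : Type*} (hα : Nonempty (α ↪ X))
    (hι : Nonempty (ι ↪ X)) {M : Type u} [L.Structure M] [Nonempty M] {v : α → M} {w : α → E}
    (hvw : EqT L v w) (c : ι → M) : ∃ c' : ι → E, EqT L (Sum.elim v c) (Sum.elim w c') := by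
  classical
  have := h.infinite
  obtain ⟨x, hx⟩ := h.exists_realize hα hι {φ | φ.Realize (Sum.elim v c)} w (by
    intro s hs
    obtain ⟨χ, hχ, -⟩ := exists_conj (T := T) s
    obtain ⟨y, hy⟩ := hvw.exists_realize_of_nonempty χ ⟨c, (hχ _ _).2 fun φ hφ => hs hφ⟩
    exact ⟨y, (hχ _ _).1 hy⟩)
  refine ⟨x, fun φ => ⟨fun hφ => hx φ hφ, fun hφ => ?_⟩⟩
  by_contra hcon
  exact Formula.realize_not.1 (hx φ.not (Formula.realize_not.2 hcon)) hφ

/-- Averages are realized in a saturated model. -/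
theorem Monster.exists_avg (h : Monster T κ X E) {β : Type*} (e : β → E) {ι : Type} [Countable ι]
    (D : Ultrafilter (ι → β)) {C : Set E} (hC : #C ≤ #X) : ∃ b, Avg L e D C b := by
  have := h.infinite_index
  obtain ⟨b, hb⟩ := h.exists_realize ((Cardinal.le_def _ _).1 hC)
    (nonempty_embedding_of_countable (α := ι))
    {φ : L.Formula (C ⊕ ι) | ∀ᶠ x in (D : Filter (ι → β)), φ.Realize (Sum.elim (↑) (e ∘ x))}
    (Subtype.val : C → E) (by
      intro s hs
      obtain ⟨x, hx⟩ := ((s.eventually_all).2 hs).exists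
      exact ⟨_, hx⟩)
  refine ⟨b, fun φ => ⟨fun hφ => ?_, fun hφ => hb φ hφ⟩⟩
  by_contra hcon
  refine Formula.realize_not.1 (hb φ.not ?_) hφ
  filter_upwards [Ultrafilter.eventually_not.2 hcon] with x hx
  exact Formula.realize_not.2 hx

/-- Coheir sequences exist in a saturated model. -/
theorem Monster.exists_dseq (h : Monster T κ X E) {β : Type*} (hβ : Nonempty (β ↪ X)) (e : β → E)
    {ι : Type} [Countable ι] (D : Ultrafilter (ι → β)) (I : Type u) [LinearOrder I]
    (hI : #I ≤ #X) : ∃ J : I → ι → E, DSeq L e D J := by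
  have := h.infinite
  have := h.infinite_index
  obtain ⟨M, _, f, J, hf, hJ⟩ := UniversalCategoricity.exists_dseq (L := L) (D.map (e ∘ ·)) I
  have hJ' := hJ.comp_left
  have : Nonempty M := ⟨f (Classical.arbitrary E)⟩
  obtain ⟨g⟩ := (Cardinal.le_def _ _).1 hI
  obtain ⟨g'⟩ := nonempty_embedding_of_countable (α := ι) (X := X)
  obtain ⟨k⟩ := Cardinal.eq.1
    (show #(X × X) = #X by rw [mk_prod, lift_id, mul_eq_self (aleph0_le_mk X)])
  obtain ⟨K, hK⟩ := h.exists_extend hβ (ι := I × ι) ⟨(g.prodMap g').trans k.toEmbedding⟩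
    (eqT_embedding_iff_comp hf e).symm (Function.uncurry J)
  exact ⟨Function.curry K, hJ'.of_eqT (by rwa [Function.uncurry_curry])⟩

theorem Monster.fs_trans (h : Monster T κ X E) {N₀ N₁ : L.Substructure E} [Infinite N₀]
    (hN : N₀ ≤ N₁) {C : Set E} (hC : #C ≤ #X) (hNC : (N₁ : Set E) ⊆ Substructure.closure L C)
    {ι : Type} [Finite ι] {b : ι → E} (h₀ : FS L N₀ N₁ b) (h₁ : FS L N₁ C b) : FS L N₀ C b := by
  have : Infinite N₁ := Infinite.of_injective _ (Substructure.inclusion hN).injective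
  obtain ⟨D, hD⟩ := h₀.exists_ultrafilter
  obtain ⟨b', hb'⟩ := h.exists_avg (Subtype.val : N₀ → E) D hC
  have h2 : FS L N₀ C b' := hb'.fs
  refine h2.of_eqT (h.eqT_of_fs hNC (h2.mono hN Substructure.subset_closure) h₁ ?_)
  exact (hb'.mono hNC).eqT hD

end Monster

section Transfer

variable {β I I' : Type*} {M : Type u} [L.Structure M] [LinearOrder I] [LinearOrder I']
  {e : β → M} {D : Ultrafilter (Unit → β)} {J : I → Unit → M} {J' : I' → Unit → M}

/-- Finite tuples generated by one coheir sequence are copied by any other infinite one. -/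
theorem DSeq.exists_transfer [Infinite I'] (h : DSeq L e D J) (h' : DSeq L e D J') {ι : Type*}
    [Finite ι] (b : ι → M)
    (hb : ∀ k, b k ∈ Substructure.closure L (range e ∪ range fun i => J i ())) :
    ∃ b' : ι → M, (∀ k, b' k ∈ Substructure.closure L (range e ∪ range fun i => J' i ())) ∧
      EqT L (Sum.elim e b) (Sum.elim e b') := by
  obtain ⟨F, -, hF⟩ := exists_finset_of_forall_mem_closure (S := Set.univ)
    (J := fun i => J i ()) (fun k => by rw [image_univ]; exact hb k)
  obtain ⟨G, hG⟩ := Infinite.exists_subset_card_eq I' F.card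
  have h1 := (h.comp (F.orderEmbOfFin rfl).strictMono).eqT
    (h'.comp (G.orderEmbOfFin hG).strictMono) (EqT.refl e)
  obtain ⟨b', hb', hb''⟩ := h1.extend b (fun k => by
    refine Substructure.closure_mono ?_ (hF k)
    rintro x (⟨k, rfl⟩ | ⟨i, hi, rfl⟩)
    · exact ⟨Sum.inl k, rfl⟩
    · rw [← F.range_orderEmbOfFin rfl] at hi
      obtain ⟨k, rfl⟩ := hi
      exact ⟨Sum.inr (k, ()), rfl⟩)
  refine ⟨b', fun k => ?_, ?_⟩
  · refine Substructure.closure_mono ?_ (hb'' k Set.univ ?_)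
    · rintro x ⟨k | k, -, rfl⟩
      · exact Or.inl ⟨k, rfl⟩
      · exact Or.inr ⟨_, rfl⟩
    · refine Substructure.closure_mono ?_ (hF k)
      rintro x (⟨k, rfl⟩ | ⟨i, hi, rfl⟩)
      · exact ⟨Sum.inl k, mem_univ _, rfl⟩
      · rw [← F.range_orderEmbOfFin rfl] at hi
        obtain ⟨k, rfl⟩ := hi
        exact ⟨Sum.inr (k, ()), mem_univ _, rfl⟩
  · have h2 := hb'.comp (Sum.map Sum.inl id)
    rw [Sum.elim_comp_map, Sum.elim_comp_map] at h2
    exact h2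

end Transfer

theorem countable_setOf_block_mem {A : Type u} [LinearOrder A] {Y : Set A} (hY : Y.Countable) :
    {i : Aᵒᵈ ×ₗ ℕ | block i ∈ Y}.Countable := by
  refine MapsTo.countable_of_injOn (f := fun i => (block i, posn i)) (t := Y ×ˢ Set.univ)
    (fun i hi => ⟨hi, mem_univ _⟩) (fun i _ j _ hij => ?_) (hY.prod countable_univ)
  by_contra hne
  have h1 := congrArg Prod.fst hij
  have h2 := congrArg Prod.snd hij
  simp only at h1 h2
  rcases lt_or_gt_of_ne hne with hlt | hlt <;> rw [index_lt_iff, h1, h2] at hlt <;> simp at hlt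

section Reps

variable {T : L.Theory} {κ : Cardinal.{u}} {E : Type u} [L.Structure E]

/-- In a strictly `κ`-generated model only countably many generators are needed to realize all
types over a countable set which are realized in the model. -/
theorem Ambient.exists_countable_reps (h : Ambient T κ E) {S : L.Substructure E}
    (hS : StrictlyGenerated L S κ) {Z₀ : Set E} (hZ₀ : Z₀.Countable) (hZS : Z₀ ⊆ S) :
    ∃ Z₁ : Set E, Z₁.Countable ∧ Z₁ ⊆ S ∧ ∀ {ι : Type} [Finite ι] (b : ι → E), (∀ k, b k ∈ S) →
      ∃ b' : ι → E, (∀ k, b' k ∈ Substructure.closure L Z₁) ∧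
        EqT L (Sum.elim (fun x : Z₀ => (x : E)) b) (Sum.elim (↑) b') := by
  have := infinite_of_strictlyGenerated h.uncountable hS
  have := h.infinite
  obtain ⟨Z, -, hZ, _⟩ := exists_countable_infinite (L := L) (E := E) countable_empty
  obtain ⟨M₁, _, e, D₁, K, he, hK, hS₁⟩ := exists_strictlyGenerated_blocks (L := L) h.uncountable
    (hZ.le_aleph0.trans h.uncountable.le)
  set S₁ := Substructure.closure L (range e ∪ range fun i => K i ()) with hS₁def
  have hM₁ : Ambient T κ M₁ := (h.substructure _).of_eqT he
  have := infinite_of_strictlyGenerated h.uncountable hS₁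
  obtain ⟨g⟩ := h.unique.2 _ _ _ _ (h.substructure S).models (hM₁.substructure S₁).models hS hS₁
  have hg : EqT L id (fun x : S => (g x : M₁)) := by
    have h1 := (h.substructure S).eqT_of_embedding hM₁.models (S₁.subtype.comp g.toEmbedding)
    exact h1
  have hSE := h.eqT_subtype S
  have hF : ∀ x : Z₀, ∃ F : Finset ((WithTop κ.ord.ToType)ᵒᵈ ×ₗ ℕ), (g ⟨x, hZS x.2⟩ : M₁) ∈
      Substructure.closure L (range e ∪ (fun i => K i ()) '' F) := fun x =>
    exists_finset_of_mem_closure_union (g ⟨x, hZS x.2⟩).2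
  choose F hF using hF
  have : Countable Z₀ := hZ₀.to_subtype
  obtain ⟨Y', hY', hY''⟩ := hK.exists_blocks (Y := {⊤} ∪ ⋃ x, block '' (F x : Set _))
    (Or.inl rfl) ((countable_singleton _).union
      (countable_iUnion fun x => ((F x).countable_toSet.image _)))
  set B : Set M₁ := e '' (Subtype.val ⁻¹' Z) ∪ blocks K Y' with hB
  have hBc : B.Countable := ((hZ.preimage Subtype.val_injective).image _).union
    ((countable_setOf_block_mem hY').image _)
  have hBS : B ⊆ S₁ := by
    refine Subset.trans (union_subset_union (image_subset_range _ _) ?_)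
      Substructure.subset_closure
    exact image_subset_range _ _
  refine ⟨Subtype.val '' ((fun x : S => (g x : M₁)) ⁻¹' B), ?_, ?_, fun {ι} _ b hb => ?_⟩
  · exact (hBc.preimage (hg.injective Function.injective_id)).image _
  · rintro x ⟨x, -, rfl⟩
    exact x.2
  · obtain ⟨b', hb', hbb⟩ := hY'' (fun k => (g ⟨b k, hb k⟩ : M₁)) (fun k => (g ⟨b k, hb k⟩).2)
    rw [closure_range_union he] at hb'
    have hb'S : ∀ k, b' k ∈ S₁ := fun k => Substructure.closure_le.2 hBS (hb' k)
    refine ⟨fun k => g.symm ⟨b' k, hb'S k⟩, fun k => ?_, ?_⟩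
    · refine embedding_mem_closure (S.subtype.comp g.symm.toEmbedding) (x := ⟨b' k, hb'S k⟩) hBS
        (hb' k) fun y hy => Substructure.subset_closure ⟨g.symm y, ?_, rfl⟩
      simpa using hy
    · have h1 := hbb.comp (Sum.map (fun x : Z₀ => ⟨g ⟨x, hZS x.2⟩, by
        refine Substructure.closure_mono (union_subset_union_right _ ?_) (hF x)
        exact image_mono fun i hi => Or.inr (mem_iUnion.2 ⟨x, mem_image_of_mem _ hi⟩)⟩) id)
      have h2 := eqT_embedding_iff_comp hg
        (Sum.elim (fun x : Z₀ => (⟨x, hZS x.2⟩ : S)) fun k => ⟨b k, hb k⟩)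
      have h3 := eqT_embedding_iff_comp hg
        (Sum.elim (fun x : Z₀ => (⟨x, hZS x.2⟩ : S)) fun k => g.symm ⟨b' k, hb'S k⟩)
      have h4 := eqT_embedding_iff_comp hSE
        (Sum.elim (fun x : Z₀ => (⟨x, hZS x.2⟩ : S)) fun k => ⟨b k, hb k⟩)
      have h5 := eqT_embedding_iff_comp hSE
        (Sum.elim (fun x : Z₀ => (⟨x, hZS x.2⟩ : S)) fun k => g.symm ⟨b' k, hb'S k⟩)
      rw [Sum.comp_elim] at h2 h3 h4 h5
      rw [Sum.elim_comp_map, Sum.elim_comp_map] at h1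
      have h6 : EqT L (Sum.elim (fun x : Z₀ => (g ⟨x, hZS x.2⟩ : M₁)) fun k => g ⟨b k, hb k⟩)
        (Sum.elim (fun x : Z₀ => (g ⟨x, hZS x.2⟩ : M₁)) b') := h1
      have h7 : (fun x : S => (g x : M₁)) ∘ (fun k => g.symm ⟨b' k, hb'S k⟩) = b' := by
        funext k
        simp
      rw [h7] at h3
      exact (h4.symm.trans h2).trans (h6.trans (h3.symm.trans h5))

end Reps

section Push

/-- The image of an ultrafilter on tuples of `A` as an ultrafilter on tuples of `B ⊇ A`. -/
def push {E : Type*} {ι : Type} {A B : Set E} (h : A ⊆ B) (D : Ultrafilter (ι → A)) :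
    Ultrafilter (ι → B) :=
  D.map (Set.inclusion h ∘ ·)

theorem push_push {E : Type*} {ι : Type} {A B C : Set E} (h : A ⊆ B) (h' : B ⊆ C)
    (D : Ultrafilter (ι → A)) : push h' (push h D) = push (h.trans h') D := by
  rw [push, push, Ultrafilter.map_map]
  rfl

theorem push_ne {E : Type*} {A B : Set E} (h : A ⊆ B) {D : Ultrafilter (Unit → A)}
    (hD : ∀ a, ∀ᶠ x in (D : Filter (Unit → A)), x () ≠ a) (a : B) :
    ∀ᶠ x in (push h D : Filter (Unit → B)), x () ≠ a := by
  rw [push, Ultrafilter.coe_map, Filter.eventually_map]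
  by_cases ha : (a : E) ∈ A
  · filter_upwards [hD ⟨a, ha⟩] with x hx hxa
    exact hx (Subtype.ext (congrArg (Subtype.val : B → E) hxa))
  · refine Filter.Eventually.of_forall fun x hxa => ha ?_
    rw [← hxa]
    exact (x ()).2

theorem DSeq.of_push {E : Type u} [L.Structure E] {ι : Type} {A B : Set E} {h : A ⊆ B}
    {D : Ultrafilter (ι → A)} {I : Type*} [LinearOrder I] {J : I → ι → E}
    (hJ : DSeq L (Subtype.val : B → E) (push h D) J) : DSeq L (Subtype.val : A → E) D J :=
  DSeq.comp_left (e := (Subtype.val : B → E)) (ρ := Set.inclusion h) hJ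

theorem avg_push_iff {E : Type u} [L.Structure E] {ι : Type} {A B : Set E} {h : A ⊆ B}
    {D : Ultrafilter (ι → A)} {C : Set E} {b : ι → E} :
    Avg L (Subtype.val : B → E) (push h D) C b ↔ Avg L (Subtype.val : A → E) D C b :=
  (avg_map_left_iff (e := (Subtype.val : B → E)) (ρ := Set.inclusion h)).symm

end Push

theorem exists_countable_subset_closure {E : Type u} [L.Structure E] {X Z : Set E}
    (hZ : Z.Countable) (h : Z ⊆ Substructure.closure L X) :
    ∃ Y : Set E, Y.Countable ∧ Y ⊆ X ∧ Z ⊆ Substructure.closure L Y := by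
  choose s hs hsz using fun z : Z =>
    exists_finset_forall_mem_closure (α := Unit) (a := fun _ => (z : E)) fun _ => h z.2
  have := hZ.to_subtype
  exact ⟨⋃ z, s z, countable_iUnion fun z => (s z).countable_toSet, iUnion_subset hs,
    fun z hz => Substructure.closure_mono (subset_iUnion (fun z => (s z : Set E)) ⟨z, hz⟩)
      (hsz ⟨z, hz⟩ ())⟩

section Omega

variable {T : L.Theory} {κ : Cardinal.{u}} {X E : Type u} [L.Structure E]

theorem Monster.kappa_le (h : Monster T κ X E) : κ ≤ #X :=
  ((le_max_right _ _).trans (le_max_left _ _)).trans h.le_mk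

theorem Monster.lang_le (h : Monster T κ X E) : max L.card ℵ₀ ≤ #X :=
  (max_le_max (le_max_left _ _) le_rfl).trans h.le_mk

theorem Monster.mk_closure_le (h : Monster T κ X E) {Z : Set E} (hZ : #Z ≤ #X) :
    #(Substructure.closure L Z) ≤ #X :=
  UniversalCategoricity.mk_closure_le Z h.lang_le hZ

theorem Monster.mk_le_of_countable (h : Monster T κ X E) {Z : Set E} (hZ : Z.Countable) :
    #Z ≤ #X :=
  hZ.le_aleph0.trans ((le_max_right _ _).trans h.lang_le)

theorem Monster.nonempty_embedding_closure (h : Monster T κ X E) {Z : Set E} (hZ : #Z ≤ #X) :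
    Nonempty (Substructure.closure L Z ↪ X) :=
  (Cardinal.le_def _ _).1 (h.mk_closure_le hZ)

/-- Over a countable set, countably many elements suffice to generate a realization of every type
of finite tuples. -/
theorem Monster.exists_countable_reps (h : Monster T κ X E) {Z₀ : Set E} (hZ₀ : Z₀.Countable)
    [Infinite (Substructure.closure L Z₀)] :
    ∃ Z₁ : Set E, Z₁.Countable ∧ Z₀ ⊆ Z₁ ∧ ∀ {n : ℕ} (b : Fin n → E),
      ∃ b' : Fin n → E, (∀ k, b' k ∈ Substructure.closure L Z₁) ∧
        EqT L (Sum.elim (fun x : Z₀ => (x : E)) b) (Sum.elim (↑) b') := by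
  classical
  have hX := h.infinite_index
  let cl : Set E → Set E := fun Z => (Substructure.closure L Z : Set E)
  have hcl : ∀ {A B : Set E}, A ⊆ B → cl A ⊆ cl B := fun hAB => Substructure.closure_mono hAB
  set D₀ := nonprincipal (cl Z₀) with hD₀
  let Bad : Set E → (Σ n, Fin n → E) → Prop := fun Z b => ∃ hZ : Z₀ ⊆ Z,
    ∀ J : κ.ord.ToType → Unit → E,
      DSeq L (Subtype.val : cl Z → E) (push (hcl hZ) D₀) J → ¬ ∃ b' : Fin b.1 → E,
      (∀ k, b' k ∈ Substructure.closure L (cl Z ∪ range fun i => J i ())) ∧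
        EqT L (Sum.elim (fun x : Z₀ => (x : E)) b.2) (Sum.elim (↑) b')
  by_cases hbad : ∀ Z : Set E, Z.Countable → Z₀ ⊆ Z → ∃ b, Bad Z b
  · exfalso
    have : Nonempty (Σ n, Fin n → E) := ⟨⟨0, Fin.elim0⟩⟩
    choose! g hg using hbad
    obtain ⟨Ω, _, hΩ⟩ := exists_isSuccType (θ := ℵ₀) le_rfl
    have := hΩ.wf
    let B : Ω → Set E := (wellFounded_lt (α := Ω)).fix fun a rec =>
      range (g (Z₀ ∪ ⋃ b, ⋃ hb : b < a, rec b hb)).2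
    let Y : Ω → Set E := stage Z₀ B
    have hB : ∀ a, B a = range (g (Y a)).2 := fun a => WellFounded.fix_eq _ _ a
    have hBc : ∀ a, (B a).Countable := fun a => by
      rw [hB]
      exact countable_range _
    have hYc : ∀ a, (Y a).Countable := fun a => by
      refine hZ₀.union ?_
      exact Countable.biUnion (le_aleph0_iff_set_countable.1 (hΩ.mk_Iio_le a)) fun b _ => hBc b
    have hZY : ∀ a, Z₀ ⊆ Y a := fun a => subset_union_left
    have hgY := fun a => hg (Y a) (hYc a) (hZY a)
    set W : Set E := Z₀ ∪ ⋃ b, B b with hW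
    have hYW : ∀ a, Y a ⊆ W := fun a => union_subset_union_right _
      (iUnion_mono fun b => iUnion_subset fun _ => subset_rfl)
    have hZW : Z₀ ⊆ W := subset_union_left
    have hWκ : #W ≤ κ := by
      refine le_trans ?_ (Order.succ_le_of_lt h.uncountable)
      refine (Cardinal.mk_union_le _ _).trans (add_le_of_le (Order.le_succ _) (hZ₀.le_aleph0.trans
        (Order.le_succ _)) ?_)
      refine (Cardinal.mk_iUnion_le _).trans (mul_le_of_le (Order.le_succ _) hΩ.mk_eq.le
        (ciSup_le' fun b => (hBc b).le_aleph0.trans (Order.le_succ _)))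
    obtain ⟨J, hJ⟩ := h.exists_dseq (h.nonempty_embedding_closure (hWκ.trans h.kappa_le))
      (Subtype.val : cl W → E) (push (hcl hZW) D₀) κ.ord.ToType (by simpa using h.kappa_le)
    have hS := hJ.strictlyGenerated Subtype.val_injective (push_ne _ (nonprincipal_ne _))
      h.uncountable (Z := W) (by rw [Subtype.range_coe]; exact Substructure.subset_closure) hWκ
      (mk_ord_toType κ)
    obtain ⟨Z₁, hZ₁, hZ₁S, hb⟩ := h.toAmbient.exists_countable_reps hS hZ₀
      ((hZW.trans subset_union_left).trans Substructure.subset_closure)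
    obtain ⟨Q, hQ, hQW, hZ₁Q⟩ : ∃ Q : Set E, Q.Countable ∧ Q ⊆ W ∧
        Z₁ ⊆ Substructure.closure L (Q ∪ range fun i => J i ()) := by
      obtain ⟨Y', hY', hYW', hZY'⟩ := exists_countable_subset_closure hZ₁ hZ₁S
      refine ⟨Y' ∩ W, hY'.mono inter_subset_left, inter_subset_right, hZY'.trans ?_⟩
      refine Substructure.closure_mono fun y hy => ?_
      rcases hYW' hy with h1 | h1
      · exact Or.inl ⟨hy, h1⟩
      · exact Or.inr h1
    obtain ⟨a, ha⟩ := exists_stage hΩ hQ.le_aleph0 hQW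
    obtain ⟨hZa, hbad⟩ := hgY a
    obtain ⟨b', hb', hbb⟩ := hb (g (Y a)).2 (fun k => by
      refine Substructure.subset_closure (Or.inl (Or.inr (mem_iUnion.2 ⟨a, ?_⟩)))
      rw [hB]
      exact mem_range_self k)
    refine hbad J (DSeq.of_push (h := hcl (hYW a)) (by rwa [push_push])) ⟨b', fun k => ?_, hbb⟩
    refine Substructure.closure_le.2 (hZ₁Q.trans ?_) (hb' k)
    exact Substructure.closure_mono (union_subset_union_left _
      (ha.trans Substructure.subset_closure))
  · push Not at hbad
    obtain ⟨Z, hZ, hZZ, hb⟩ := hbad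
    have hJ := h.exists_dseq (h.nonempty_embedding_closure (h.mk_le_of_countable hZ))
      (Subtype.val : cl Z → E) (push (hcl hZZ) D₀) (ULift ℕ) (by
        simp)
    obtain ⟨K, hK⟩ := hJ
    refine ⟨Z ∪ range fun i => K i (), hZ.union (countable_range _),
      hZZ.trans subset_union_left, fun {n} b => ?_⟩
    have h1 := hb ⟨n, b⟩
    simp only [Bad] at h1
    push Not at h1
    obtain ⟨J, hJ, b', hb', hbb⟩ := h1 hZZ
    obtain ⟨b'', hb'', hbb'⟩ := hJ.exists_transfer hK b' (by
      rwa [Subtype.range_coe])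
    rw [Subtype.range_coe] at hb''
    refine ⟨b'', fun k => ?_, hbb.trans ?_⟩
    · refine Substructure.closure_le.2 (union_subset ?_ ?_) (hb'' k)
      · exact Substructure.closure_mono subset_union_left
      · exact subset_union_right.trans Substructure.subset_closure
    · have h2 := hbb'.comp (Sum.map (Set.inclusion (hZZ.trans Substructure.subset_closure :
        Z₀ ⊆ cl Z)) id)
      rw [Sum.elim_comp_map, Sum.elim_comp_map] at h2
      exact h2

end Omega

section Basics

variable {E : Type u} [L.Structure E] {C : Set E} {ι ι' : Type*} {b : ι → E}

theorem EqT.of_mem_closure {E' : Type u} [L.Structure E'] {α γ : Type*} {v : α → E} {w : α → E'}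
    {b' : ι → E'} (h : EqT L (Sum.elim v b) (Sum.elim w b')) {c : γ → E} {c' : γ → E'}
    (hc : ∀ k, c k ∈ Substructure.closure L (range v))
    (hcc : EqT L (Sum.elim v c) (Sum.elim w c')) :
    EqT L (Sum.elim c b) (Sum.elim c' b') := by
  obtain ⟨t, ht⟩ := exists_terms (range v) v (fun _ h => h) c hc
  have ht' : ∀ k, (t k).realize w = c' k := fun k => by
    have h1 := (hcc.term_eq ((t k).relabel Sum.inl) (Term.var (Sum.inr k))).1 (by
      simpa using ht k)
    simpa using h1
  have h1 := h.terms (Sum.elim (fun k => (t k).relabel Sum.inl) fun i => Term.var (Sum.inr i))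
  convert h1 using 1
  all_goals
    funext k
    rcases k with k | k
    · simp [ht, ht']
    · rfl

theorem EqT.of_coe {b b' : ι → E} (h : EqT L (Sum.elim (fun k : C => (k : E)) b) (Sum.elim (↑) b'))
    {γ : Type*} (c : γ → E) (hc : ∀ k, c k ∈ Substructure.closure L C) :
    EqT L (Sum.elim c b) (Sum.elim c b') :=
  h.of_mem_closure (by rwa [Subtype.range_coe]) (EqT.refl _)

theorem EqT.closure {b b' : ι → E}
    (h : EqT L (Sum.elim (fun k : C => (k : E)) b) (Sum.elim (↑) b')) :
    EqT L (Sum.elim (fun k : Substructure.closure L C => (k : E)) b) (Sum.elim (↑) b') :=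
  h.of_coe _ fun k => k.2

theorem FS.of_mem_closure {N : L.Substructure E} (h : FS L N C b) {c : ι' → E}
    (hc : ∀ k, c k ∈ Substructure.closure L (range b)) : FS L N C c := by
  obtain ⟨t, ht⟩ := exists_terms (range b) b (fun _ h => h) c hc
  intro φ hφ
  let σ : C ⊕ ι' → L.Term (C ⊕ ι) := Sum.elim (fun k => Term.var (Sum.inl k))
    fun k => (t k).relabel Sum.inr
  have h1 : ∀ x : ι → E, Formula.Realize (BoundedFormula.subst φ σ) (Sum.elim Subtype.val x) ↔
      φ.Realize (Sum.elim (fun k : C => (k : E)) fun k => (t k).realize x) := fun x => by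
    rw [realize_subst_formula]
    congr! 1
    funext k
    rcases k with k | k
    · rfl
    · simp [σ]
  obtain ⟨x, hx, hx'⟩ := h _ ((h1 b).2 (by simpa only [ht] using hφ))
  refine ⟨_, fun k => ?_, (h1 x).1 hx'⟩
  have h2 := realize_mem_closure (t k) x (N : Set E) fun i => Substructure.subset_closure (hx i)
  rwa [Substructure.closure_eq] at h2

theorem FS.of_finset {N : L.Substructure E}
    (h : ∀ y : Finset E, (y : Set E) ⊆ C → FS L N (N ∪ y) b) : FS L N (N ∪ C) b := by
  classical
  intro φ hφ
  obtain ⟨F, ψ, hψ, -⟩ := exists_finset_params (T := (∅ : L.Theory)) φ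
  have h1 := h ((F.image Subtype.val).filter (· ∈ C)) (fun x hx => (Finset.mem_filter.1 hx).2)
  obtain ⟨x, hx, hx'⟩ := h1.exists_mem (fun i : F => ((i : ((N : Set E) ∪ C : Set E)) : E))
    (fun k => Substructure.subset_closure (by
      rcases k.1.2 with hk | hk
      · exact Or.inl hk
      · exact Or.inr (Finset.mem_coe.2 (Finset.mem_filter.2
          ⟨Finset.mem_image.2 ⟨_, k.2, rfl⟩, hk⟩)))) ψ ((hψ E _ _).1 hφ)
  exact ⟨x, hx, (hψ E _ _).2 hx'⟩

/-- An enumeration of a finite set by a type in the lowest universe. -/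
theorem exists_range_eq_finset (y : Finset E) : ∃ (n : ℕ) (b : Fin n → E), range b = y :=
  ⟨y.card, fun i => y.equivFin.symm i, by
    change range (Subtype.val ∘ y.equivFin.symm) = _
    rw [range_comp, y.equivFin.symm.surjective.range_eq]
    simp⟩

theorem exists_strictMono_of_infinite {Ω : Type*} [LinearOrder Ω] [WellFoundedLT Ω] {S : Set Ω}
    (hS : S.Infinite) : ∃ ξ : ℕ → Ω, StrictMono ξ ∧ ∀ n, ξ n ∈ S := by
  have := hS.to_subtype
  let f := Infinite.natEmbedding S
  obtain ⟨g, hg | hg⟩ := exists_increasing_or_nonincreasing_subseq (α := S) (· < ·) f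
  · exact ⟨fun n => f (g n), fun m n hmn => hg m n hmn, fun n => (f (g n)).2⟩
  · exfalso
    obtain ⟨_, ⟨n, rfl⟩, hn⟩ := (wellFounded_lt (α := S)).has_min (range (f ∘ g)) (range_nonempty _)
    refine hn _ ⟨n + 1, rfl⟩ (lt_of_le_of_ne (not_lt.1 (hg n (n + 1) n.lt_succ_self)) fun h => ?_)
    have := g.injective (f.injective h)
    omega

end Basics

section Big

variable {T : L.Theory} {κ : Cardinal.{u}} {E : Type u} [L.Structure E] {Z : Set E}
  {D : Ultrafilter (Unit → Substructure.closure L Z)}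

/-- A finite set generates only finitely many members of a coheir sequence over a countable set. -/
theorem Ambient.finite_setOf_mem_closure (h : Ambient T κ E) (hZ : Z.Countable)
    [Infinite (Substructure.closure L Z)]
    (hD : ∀ a, ∀ᶠ x in (D : Filter (Unit → Substructure.closure L Z)), x () ≠ a) {I : Type*}
    [LinearOrder I] {J : I → Unit → E} (hJ : DSeq L Subtype.val D J) (y : Finset E) :
    {i | J i () ∈ Substructure.closure L (y : Set E)}.Finite := by
  by_contra hinf
  have hinf' : {i | J i () ∈ Substructure.closure L (y : Set E)}.Infinite := hinf
  have := hinf'.to_subtype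
  let ξ := Infinite.natEmbedding {i | J i () ∈ Substructure.closure L (y : Set E)}
  obtain ⟨m, b, hb⟩ := exists_range_eq_finset y
  let Y : ℕ → Set E := fun n => Z ∪ (fun k => J (ξ k) ()) '' {k | k < n}
  have hY : Monotone Y := fun n n' hn => union_subset_union_right _
    (image_mono fun k (hk : k < n) => hk.trans_le hn)
  have hY0 : Infinite (Substructure.closure L (Y 0)) := by
    have h1 : (Substructure.closure L Z : Set E) ⊆ Substructure.closure L (Y 0) :=
      Substructure.closure_mono subset_union_left
    exact Infinite.of_injective _ (Set.inclusion_injective h1)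
  obtain ⟨n, hn⟩ := h.exists_fs_succ hY
    (fun n => hZ.union ((Set.to_countable _).image _)) b
  have h1 : J (ξ n) () ∈ Substructure.closure L (range b) := by
    rw [hb]
    exact (ξ n).2
  obtain ⟨t, ht⟩ := exists_terms (range b) b (fun _ h => h) (fun _ : Unit => J (ξ n) ())
    fun _ => h1
  obtain ⟨x, hx, hx'⟩ := hn.exists_mem (fun _ : Unit => J (ξ n) ())
    (fun _ => Substructure.subset_closure (Or.inr ⟨n, Nat.lt_succ_self n, rfl⟩))
    (((t ()).relabel Sum.inr).equal (Term.var (Sum.inl ()))) (by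
      simp [Formula.realize_equal, Term.realize_relabel, ht])
  have h2 : (t ()).realize x = J (ξ n) () := by
    simpa [Formula.realize_equal, Term.realize_relabel] using hx'
  have h3 := realize_mem_closure (t ()) x (Substructure.closure L (Y n) : Set E) fun i =>
    Substructure.subset_closure (hx i)
  rw [Substructure.closure_eq, h2] at h3
  refine hJ.notMem_closure Subtype.val_injective hD (ξ n) (Substructure.closure_mono ?_ h3)
  refine union_subset_union ?_ ?_
  · rw [Subtype.range_coe]
    exact Substructure.subset_closure
  · rintro _ ⟨k, hk, rfl⟩
    refine ⟨ξ k, fun hkn => ?_, rfl⟩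
    exact (ne_of_lt hk) (ξ.injective (Subtype.ext hkn))

theorem Ambient.strictlyGenerated_closure (h : Ambient T κ E) (hZ : Z.Countable)
    [Infinite (Substructure.closure L Z)]
    (hD : ∀ a, ∀ᶠ x in (D : Filter (Unit → Substructure.closure L Z)), x () ≠ a) {I : Type u}
    [LinearOrder I] {J : I → Unit → E} (hJ : DSeq L Subtype.val D J) (hI : #I = κ) {Y : Set E}
    (hY : #Y = κ) (hJY : ∀ i, J i () ∈ Y) : StrictlyGenerated L (Substructure.closure L Y) κ := by
  refine strictlyGenerated_of Y hY fun W hWY hW hYW => ?_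
  choose F hF hJF using fun i => exists_finset_forall_mem_closure (α := Unit)
    (a := fun _ => J i ()) fun _ => hYW (hJY i)
  have hIi : Infinite I := infinite_iff.2 (hI ▸ h.uncountable.le)
  have hFW : #{s : Finset E // (s : Set E) ⊆ W} < #I := by
    rw [hI]
    have h1 : #{s : Finset E // (s : Set E) ⊆ W} ≤ #(Finset W) := by
      classical
      refine mk_le_of_surjective (f := fun s : Finset W =>
        ⟨s.image Subtype.val, by simp⟩) fun ⟨s, hs⟩ => ?_
      rw [← Subtype.range_coe (s := W), ← image_univ] at hs
      obtain ⟨s', -, rfl⟩ := Finset.subset_set_image_iff.1 hs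
      exact ⟨s', rfl⟩
    refine h1.trans_lt ?_
    rcases lt_or_ge #W ℵ₀ with hf | hf
    · have := Cardinal.lt_aleph0_iff_finite.1 hf
      exact (mk_lt_aleph0 (α := Finset W)).trans h.uncountable
    · have := infinite_iff.2 hf
      rwa [mk_finset_of_infinite]
  obtain ⟨s, hs⟩ := exists_infinite_fiber
    (fun i => (⟨F i, hF i⟩ : {s : Finset E // (s : Set E) ⊆ W}))
    hFW
  refine (Set.infinite_coe_iff.1 hs) ((h.finite_setOf_mem_closure hZ hD hJ s.1).subset ?_)
  rintro i rfl
  exact hJF i ()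

end Big

section Sat

variable {T : L.Theory} {κ : Cardinal.{u}} {X E : Type u} [L.Structure E]

/-- All types of finite tuples over countable subsets of `S` are realized in `S`. -/
def SatIn (S : L.Substructure E) : Prop :=
  ∀ Z : Set E, Z.Countable → Z ⊆ S → ∀ {n : ℕ} (d : Fin n → E), ∃ d' : Fin n → E,
    (∀ k, d' k ∈ S) ∧ EqT L (Sum.elim (fun x : Z => (x : E)) d) (Sum.elim (↑) d')

theorem SatIn.of_equiv (h : Monster T κ X E) {S S' : L.Substructure E} [Infinite S] [Infinite S']
    (g : S ≃[L] S') (hS : SatIn S') : SatIn S := by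
  intro Z hZ hZS n d
  have hXi := h.infinite_index
  have := h.infinite
  have hg : EqT L id (fun x : S => (g x : E)) := by
    have h1 := (h.toAmbient.substructure S).eqT_of_embedding h.models
      (S'.subtype.comp g.toEmbedding)
    exact h1
  have hSE := h.eqT_subtype S
  let z : Z → S := fun x => ⟨x, hZS x.2⟩
  have := hZ.to_subtype
  have h1 : EqT L (fun x : Z => (x : E)) (fun x => (g (z x) : E)) :=
    (eqT_embedding_iff_comp hSE z).symm.trans (eqT_embedding_iff_comp hg z)
  obtain ⟨d₁, hd₁⟩ := h.exists_extend nonempty_embedding_of_countable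
    nonempty_embedding_of_countable h1 d
  obtain ⟨d₂, hd₂, hdd⟩ := hS (range fun x => (g (z x) : E)) (countable_range _)
    (by rintro _ ⟨x, rfl⟩; exact (g (z x)).2) d₁
  have h2 := hdd.of_coe (fun x => (g (z x) : E)) fun k => Substructure.subset_closure ⟨k, rfl⟩
  refine ⟨fun k => g.symm ⟨d₂ k, hd₂ k⟩, fun k => (g.symm ⟨d₂ k, hd₂ k⟩).2, ?_⟩
  have h3 := eqT_embedding_iff_comp hg (Sum.elim z fun k => g.symm ⟨d₂ k, hd₂ k⟩)
  have h4 := eqT_embedding_iff_comp hSE (Sum.elim z fun k => g.symm ⟨d₂ k, hd₂ k⟩)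
  rw [Sum.comp_elim] at h3 h4
  have h5 : (fun x : S => (g x : E)) ∘ (fun k => g.symm ⟨d₂ k, hd₂ k⟩) = d₂ := by
    funext k
    simp
  rw [h5] at h3
  exact hd₁.trans (h2.trans (h3.symm.trans h4))

end Sat

section Long

variable {T : L.Theory} {κ : Cardinal.{u}} {X E : Type u} [L.Structure E]

theorem infinite_closure_mono {A B : Set E} [hA : Infinite (Substructure.closure L A)]
    (hAB : A ⊆ B) : Infinite (Substructure.closure L B) := by
  have h1 : (Substructure.closure L A : Set E) ⊆ Substructure.closure L B :=
    Substructure.closure_mono hAB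
  exact Infinite.of_injective _ (Set.inclusion_injective h1)

/-- A long coheir sequence of countable tuples over a countable set `A` that generates all types
over countable sets which are finitely satisfiable in the closure of `A`. -/
theorem Monster.exists_long_dseq (h : Monster T κ X E) {A : Set E} (hA : A.Countable)
    [Infinite (Substructure.closure L A)] {Ω : Type u} [LinearOrder Ω] (hΩ : IsSuccType ℵ₀ Ω) :
    ∃ B : Ω → ℕ → E, ∀ Y : Set E, Y.Countable → A ⊆ Y → ∀ {n : ℕ} (d : Fin n → E),
      FS L (Substructure.closure L A) (Substructure.closure L Y : Set E) d →
      ∃ ξ, ∃ d' : Fin n → E, (∀ k, d' k ∈ Substructure.closure L (range (B ξ))) ∧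
        EqT L (Sum.elim (fun x : Y => (x : E)) d) (Sum.elim (↑) d') := by
  have hXi := h.infinite_index
  have := h.infinite
  have := hΩ.wf
  obtain ⟨Z₁, hZ₁, hAZ, hrep⟩ := h.exists_countable_reps hA
  obtain ⟨ζ, hζ⟩ := (hZ₁.union (countable_singleton (Classical.arbitrary E))).exists_eq_range
    ⟨_, Or.inr rfl⟩
  set N := Substructure.closure L A with hN
  obtain ⟨D, hD⟩ := (h.fs_of_subset N (subset_refl (N : Set E)) ζ).exists_ultrafilter
  have hΩX : #Ω ≤ #X := hΩ.mk_eq.le.trans ((Order.succ_le_of_lt h.uncountable).trans h.kappa_le)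
  obtain ⟨B, hB⟩ := h.exists_dseq (h.nonempty_embedding_closure (h.mk_le_of_countable hA))
    (Subtype.val : N → E) D Ω hΩX
  refine ⟨B, fun Y hY hAY {n} d hd => ?_⟩
  obtain ⟨d₀, hd₀, hdd⟩ := hrep d
  have hBN : ∀ ξ, Avg L (Subtype.val : N → E) D (N : Set E) (B ξ) := fun ξ =>
    (hB ξ).mono (by
      rw [Subtype.range_coe]
      exact subset_union_left.trans Substructure.subset_closure)
  have hex : ∀ ξ, ∃ d' : Fin n → E, (∀ k, d' k ∈ Substructure.closure L (range (B ξ))) ∧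
      EqT L (Sum.elim (fun x : N => (x : E)) d) (Sum.elim (↑) d') := fun ξ => by
    have h1 := hD.eqT (hBN ξ)
    obtain ⟨d', hd', hd''⟩ := h1.extend d₀ (fun k => by
      refine Substructure.closure_mono ?_ (hd₀ k)
      rw [Sum.elim_range, ← hζ]
      exact subset_union_left.trans subset_union_right)
    refine ⟨d', fun k => ?_, ?_⟩
    · refine Substructure.closure_mono ?_ (hd'' k (range Sum.inr) ?_)
      · rintro _ ⟨_, ⟨k, rfl⟩, rfl⟩
        exact ⟨k, rfl⟩
      · refine Substructure.closure_mono ?_ (hd₀ k)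
        rw [← range_comp, Sum.elim_comp_inr, ← hζ]
        exact subset_union_left
    · have h2 := hd'.comp (Sum.map Sum.inl id)
      rw [Sum.elim_comp_map, Sum.elim_comp_map] at h2
      exact hdd.closure.trans h2
  choose d' hd' hdN using hex
  by_cases hgood : ∃ ξ, FS L N (N ∪ Y) (d' ξ)
  · obtain ⟨ξ, hξ⟩ := hgood
    refine ⟨ξ, d' ξ, hd' ξ, ?_⟩
    have h1 := h.eqT_of_fs (C := (N ∪ Y : Set E))
      (subset_union_left.trans Substructure.subset_closure)
      (hd.mono le_rfl (union_subset ((Substructure.closure_mono hAY).trans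
        Substructure.subset_closure) (Substructure.subset_closure.trans
        Substructure.subset_closure))) hξ (hdN ξ)
    exact h1.of_coe _ fun k => Substructure.subset_closure (Or.inr k.2)
  · exfalso
    push Not at hgood
    have hy : ∀ ξ, ∃ y : Finset E, (y : Set E) ⊆ Y ∧ ¬ FS L N (N ∪ y) (d' ξ) := fun ξ => by
      by_contra! hcon
      exact hgood ξ (FS.of_finset hcon)
    choose y hyY hy using hy
    have hcount : #{s : Finset E // (s : Set E) ⊆ Y} < #Ω := by
      rw [hΩ.mk_eq, Order.lt_succ_iff]
      have := hY.to_subtype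
      have h1 : Countable {s : Finset E // (s : Set E) ⊆ Y} := by
        classical
        refine Function.Surjective.countable (f := fun s : Finset Y =>
          (⟨s.image Subtype.val, by simp⟩ : {s : Finset E // (s : Set E) ⊆ Y})) fun ⟨s, hs⟩ => ?_
        rw [← Subtype.range_coe (s := Y), ← image_univ] at hs
        obtain ⟨s', -, rfl⟩ := Finset.subset_set_image_iff.1 hs
        exact ⟨s', rfl⟩
      exact mk_le_aleph0
    have hΩi : Infinite Ω := infinite_iff.2 (hΩ.mk_eq ▸ Order.le_succ _)
    obtain ⟨s, hs⟩ := exists_infinite_fiber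
      (fun ξ => (⟨y ξ, hyY ξ⟩ : {s : Finset E // (s : Set E) ⊆ Y})) hcount
    obtain ⟨ξ, hξ, hξs⟩ := exists_strictMono_of_infinite (Set.infinite_coe_iff.1 hs)
    have hys : ∀ m, y (ξ m) = s := fun m => congrArg Subtype.val (hξs m)
    obtain ⟨p, b, hb⟩ := exists_range_eq_finset s.1
    let W : ℕ → Set E := fun m => A ∪ ⋃ k, ⋃ _ : k < m, range (d' (ξ k))
    have hW : Monotone W := fun m m' hm => union_subset_union_right _
      (iUnion_mono fun k => iUnion_mono' fun hk => ⟨hk.trans_le hm, le_rfl⟩)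
    have hW0 : ∀ m, Infinite (Substructure.closure L (W m)) := fun m =>
      infinite_closure_mono (A := A) subset_union_left
    have := hW0 0
    obtain ⟨m, hm⟩ := h.exists_fs_succ hW (fun m => hA.union
      (countable_iUnion fun k => countable_iUnion fun _ => countable_range _)) b
    have := hW0 m
    have h1 := h.fs_symm (d := d' (ξ m)) (hm.mono le_rfl (union_subset
      (Substructure.closure_mono (hW m.le_succ)) (by
        refine Subset.trans ?_ Substructure.subset_closure
        exact fun x hx => Or.inr (mem_iUnion₂.2 ⟨m, m.lt_succ_self, hx⟩))))
    have h2 : FS L N (Substructure.closure L (W m) : Set E) (d' (ξ m)) := by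
      refine ((hB (ξ m)).fs.of_mem_closure (hd' (ξ m))).mono le_rfl ?_
      refine Substructure.closure_le.2 (union_subset ?_ ?_)
      · refine Subset.trans ?_ Substructure.subset_closure
        rw [Subtype.range_coe]
        exact Substructure.subset_closure.trans subset_union_left
      · refine iUnion₂_subset fun k hk => ?_
        rintro _ ⟨i, rfl⟩
        refine Substructure.closure_mono ?_ (hd' (ξ k) i)
        refine subset_union_of_subset_right ?_ _
        exact subset_iUnion₂_of_subset (ξ k) (hξ hk) subset_rfl
    have hcard : #(Substructure.closure L (W m) ∪ range b : Set E) ≤ #X :=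
      (Cardinal.mk_union_le _ _).trans (add_le_of_le (aleph0_le_mk X) (h.mk_closure_le
        (h.mk_le_of_countable (hA.union
          (countable_iUnion fun k => countable_iUnion fun _ => countable_range _))))
        (h.mk_le_of_countable (countable_range b)))
    have h3 := h.fs_trans (N₀ := N) (Substructure.closure_mono subset_union_left) hcard
      (subset_union_left.trans Substructure.subset_closure) h2 h1
    refine hy (ξ m) (h3.mono le_rfl ?_)
    rw [hys m, ← hb]
    refine Subset.trans (union_subset_union_left _ ?_) Substructure.subset_closure
    exact Substructure.closure_mono subset_union_left

/-- Every strictly `κ`-generated substructure realizes all types of finite tuples over its countable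
subsets. -/
theorem Monster.satIn (h : Monster T κ X E) {S : L.Substructure E}
    (hS : StrictlyGenerated L S κ) : SatIn S := by
  have hXi := h.infinite_index
  have := h.infinite
  obtain ⟨A, -, hA, hAi⟩ := exists_countable_infinite (L := L) (E := E) countable_empty
  obtain ⟨Ω, _, hΩ⟩ := exists_isSuccType (θ := ℵ₀) le_rfl
  have hAs : ∀ s : Finset E, (A ∪ s : Set E).Countable := fun s => hA.union s.countable_toSet
  have hinf : ∀ s : Finset E, Infinite (Substructure.closure L (A ∪ s : Set E)) := fun s =>
    infinite_closure_mono (A := A) subset_union_left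
  choose B hB using fun s : Finset E => h.exists_long_dseq (hAs s) hΩ
  obtain ⟨J, hJ⟩ := h.exists_dseq (h.nonempty_embedding_closure (h.mk_le_of_countable hA))
    (Subtype.val : Substructure.closure L A → E) (nonprincipal _) κ.ord.ToType
    (by simpa using h.kappa_le)
  have hJi : Function.Injective fun i => J i () := fun i j hij => by
    by_contra hne
    refine hJ.notMem_closure Subtype.val_injective (nonprincipal_ne _) i ?_
    exact Substructure.subset_closure (Or.inr ⟨j, Ne.symm hne, hij.symm⟩)
  have hκ : ℵ₀ ≤ κ := h.uncountable.le
  have hΩκ : #Ω ≤ κ := hΩ.mk_eq.le.trans (Order.succ_le_of_lt h.uncountable)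
  obtain ⟨Y, hY, hYκ, hYB⟩ := exists_closed_under hκ
    (fun s => ⋃ ξ, range (B s ξ)) (fun s => by
      refine (Cardinal.mk_iUnion_le _).trans (mul_le_of_le hκ hΩκ
        (ciSup_le' fun ξ => (countable_range _).le_aleph0.trans hκ)))
    (X₀ := A ∪ range fun i => J i ()) (by
      refine (Cardinal.mk_union_le _ _).trans (add_le_of_le hκ (hA.le_aleph0.trans hκ) ?_)
      exact mk_range_le.trans (mk_ord_toType κ).le)
  have hYκ' : #Y = κ := by
    refine le_antisymm hYκ ?_
    rw [← mk_ord_toType κ, ← mk_range_eq _ hJi]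
    exact mk_le_mk_of_subset (subset_union_right.trans hY)
  have hV := h.toAmbient.strictlyGenerated_closure hA (nonprincipal_ne _) hJ (mk_ord_toType κ)
    hYκ' fun i => hY (Or.inr ⟨i, rfl⟩)
  have hVi : Infinite (Substructure.closure L Y) :=
    infinite_of_strictlyGenerated h.uncountable hV
  have hSi := infinite_of_strictlyGenerated h.uncountable hS
  obtain ⟨g⟩ := h.unique.2 _ _ _ _ (h.toAmbient.substructure S).models
    (h.toAmbient.substructure (Substructure.closure L Y)).models hS hV
  refine SatIn.of_equiv h g fun Z hZ hZS n d => ?_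
  obtain ⟨Z', hZ', hZY, hZZ⟩ := exists_countable_subset_closure hZ hZS
  have hA' : (A ∪ Z').Countable := hA.union hZ'
  obtain ⟨s, hs, hd⟩ := h.exists_finset_base hA Z' d
  obtain ⟨ξ, d', hd', hdd⟩ := hB s (A ∪ Z') hA' (union_subset_union_right _ hs) d hd
  have hsY := hYB s (hs.trans hZY)
  refine ⟨d', fun k => Substructure.closure_mono ((subset_iUnion _ ξ).trans hsY) (hd' k), ?_⟩
  exact hdd.of_coe _ fun k => Substructure.closure_mono subset_union_right (hZZ k.2)

end Long

section Sequences

variable {E : Type u} [L.Structure E]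

theorem exists_seq_of_finset {α : Type*} [DecidableEq α] {Y : Set α} (P : Finset α → α → Prop)
    (h : ∀ F : Finset α, (F : Set α) ⊆ Y → ∃ x ∈ Y, P F x) :
    ∃ d : ℕ → α, (∀ n, d n ∈ Y) ∧ ∀ n, P ((Finset.range n).image d) (d n) := by
  choose g hgY hg using fun F : {F : Finset α // (F : Set α) ⊆ Y} => h F.1 F.2
  let F : ℕ → {F : Finset α // (F : Set α) ⊆ Y} := fun n =>
    n.rec ⟨∅, by simp⟩ fun _ F => ⟨insert (g F) F.1, by
      rw [Finset.coe_insert]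
      exact insert_subset (hgY F) F.2⟩
  have hF : ∀ n, (F n).1 = (Finset.range n).image fun n => g (F n) := fun n => by
    induction n with
    | zero => rfl
    | succ n ih =>
      rw [Finset.range_add_one, Finset.image_insert, ← ih]
  refine ⟨fun n => g (F n), fun n => hgY _, fun n => ?_⟩
  rw [← hF]
  exact hg _

theorem Avg.ne {N : L.Substructure E} {D : Ultrafilter (Unit → N)} {C : Set E} {d : Unit → E}
    (h : Avg L (Subtype.val : N → E) D C d) (hC : (N : Set E) ⊆ Substructure.closure L C)
    (hd : d () ∉ N) (a : N) : ∀ᶠ x in (D : Filter (Unit → N)), x () ≠ a := by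
  have h1 := (h.iff (fun _ : Unit => (a : E)) (fun _ => hC a.2)
    ((Term.var (Sum.inr ())).equal (Term.var (Sum.inl ()))).not).1 (by
      simp only [Formula.realize_not, Formula.realize_equal, Term.realize_var, Sum.elim_inl,
        Sum.elim_inr]
      intro hda
      exact hd (hda ▸ a.2))
  filter_upwards [h1] with x hx hxa
  simp only [Formula.realize_not, Formula.realize_equal, Term.realize_var, Sum.elim_inl,
    Sum.elim_inr, Function.comp] at hx
  exact hx (congrArg Subtype.val hxa)

theorem dseq_of_seq [DecidableEq E] {A C : Set E}
    {D : Ultrafilter (Unit → Substructure.closure L A)} {d : Unit → E} {e : ℕ → E}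
    (h : Avg L (Subtype.val : Substructure.closure L A → E) D C d)
    (hC : A ∪ range e ⊆ Substructure.closure L C)
    (he : ∀ i, EqT L (Sum.elim (fun x : (A ∪ (Finset.range i).image e : Set E) => (x : E)) d)
      (Sum.elim (↑) fun _ => e i)) :
    DSeq L (Subtype.val : Substructure.closure L A → E) D (fun i _ => e i) := by
  intro i
  have hsub : range (Subtype.val : Substructure.closure L A → E) ∪
      ⋃ j < i, range (fun _ : Unit => e j) ⊆
      Substructure.closure L (A ∪ (Finset.range i).image e : Set E) := by
    rw [Subtype.range_coe]
    refine union_subset (Substructure.closure_mono subset_union_left) ?_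
    refine iUnion₂_subset fun j hj => ?_
    rintro _ ⟨_, rfl⟩
    exact Substructure.subset_closure (Or.inr (Finset.mem_coe.2 (Finset.mem_image.2
      ⟨j, Finset.mem_range.2 hj, rfl⟩)))
  refine (h.mono (hsub.trans (Substructure.closure_le.2 ?_))).of_eqT
    ((he i).of_coe _ fun k => hsub k.2)
  refine Subset.trans (union_subset_union_right _ ?_) hC
  rw [Finset.coe_image]
  exact image_subset_range _ _

end Sequences

section Sat

variable {T : L.Theory} {κ : Cardinal.{u}} {X E : Type u} [L.Structure E]

/-- A countable set together with an infinite coheir sequence over it generates realizations of all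
types over the set. -/
theorem Monster.exists_realize_of_dseq (h : Monster T κ X E) {Z : Set E} (hZ : Z.Countable)
    {D : Ultrafilter (Unit → Substructure.closure L Z)}
    (hD : ∀ a, ∀ᶠ x in (D : Filter (Unit → Substructure.closure L Z)), x () ≠ a) {I : Type*}
    [LinearOrder I] [Infinite I] {J : I → Unit → E} (hJ : DSeq L Subtype.val D J) {n : ℕ}
    (d : Fin n → E) : ∃ d' : Fin n → E,
      (∀ k, d' k ∈ Substructure.closure L (Z ∪ range fun i => J i ())) ∧
        EqT L (Sum.elim (fun x : Z => (x : E)) d) (Sum.elim (↑) d') := by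
  obtain ⟨K, hK⟩ := h.exists_dseq (h.nonempty_embedding_closure (h.mk_le_of_countable hZ))
    (Subtype.val : Substructure.closure L Z → E) D κ.ord.ToType (by simpa using h.kappa_le)
  have hS := hK.strictlyGenerated Subtype.val_injective hD h.uncountable (Z := Z)
    (by rw [Subtype.range_coe]; exact Substructure.subset_closure)
    (hZ.le_aleph0.trans h.uncountable.le) (mk_ord_toType κ)
  obtain ⟨d₁, hd₁, hdd⟩ := h.satIn hS Z hZ
    (subset_union_left.trans Substructure.subset_closure) d
  obtain ⟨d', hd', hdd'⟩ := hK.exists_transfer hJ d₁ fun k => by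
    refine Substructure.closure_mono (union_subset_union_left _ ?_) (hd₁ k)
    rw [Subtype.range_coe]
    exact Substructure.subset_closure
  refine ⟨d', fun k => ?_, hdd.trans ?_⟩
  · refine Substructure.closure_le.2 (union_subset ?_ ?_) (hd' k)
    · rw [Subtype.range_coe]
      exact Substructure.closure_mono subset_union_left
    · exact subset_union_right.trans Substructure.subset_closure
  · exact hdd'.of_mem_closure (v := Subtype.val) (w := Subtype.val) (fun k => by
      rw [Subtype.range_coe]
      exact Substructure.subset_closure (Substructure.subset_closure k.2)) (EqT.refl _)

theorem Ambient.exists_countable_infinite_subset (h : Ambient T κ E) {S : L.Substructure E}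
    [Infinite S] {Z : Set E} (hZ : Z.Countable) (hZS : Z ⊆ S) :
    ∃ Y : Set E, Z ⊆ Y ∧ Y.Countable ∧ Y ⊆ S ∧ Infinite (Substructure.closure L Y) := by
  obtain ⟨Y, hZY, hY, hYi⟩ := exists_countable_infinite (L := L) (E := S)
    (hZ.preimage (Subtype.val_injective : Function.Injective (Subtype.val : S → E)))
  refine ⟨Subtype.val '' Y, fun z hz => ⟨⟨z, hZS hz⟩, hZY hz, rfl⟩, hY.image _, ?_, ?_⟩
  · rintro _ ⟨y, -, rfl⟩
    exact y.2
  · have h1 := closure_image_eq (h.eqT_subtype S) Y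
    have h2 : ((Substructure.closure L Y : Set S)).Infinite := Set.infinite_coe_iff.1 hYi
    have h3 := h2.image (f := (Subtype.val : S → E)) Subtype.val_injective.injOn
    rw [h1] at h3
    exact Set.infinite_coe_iff.2 h3

/-- Substructures larger than the language realize all types over their countable subsets. -/
theorem Monster.satIn_of_lt_mk (h : Monster T κ X E) {S : L.Substructure E}
    (hS : max L.card ℵ₀ < #S) : SatIn S := by
  classical
  have hSi : Infinite S := infinite_iff.2 ((le_max_right _ _).trans hS.le)
  intro Z₀ hZ₀ hZ₀S n b
  obtain ⟨Z, hZZ, hZ, hZS, _⟩ := h.exists_countable_infinite_subset hZ₀ hZ₀S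
  have hZs : ∀ s : Finset E, (Z ∪ s : Set E).Countable := fun s => hZ.union s.countable_toSet
  have hinf : ∀ s : Finset E, Infinite (Substructure.closure L (Z ∪ s : Set E)) := fun s =>
    infinite_closure_mono (A := Z) subset_union_left
  choose Z₁ hZ₁ _hZZ₁ hrep using fun s : Finset E => h.exists_countable_reps (hZs s)
  have hpick : ∀ (s : Finset E) (c : E), ∃ m ∈ S, (∃ m' ∈ S,
      EqT L (Sum.elim (fun x : (Z ∪ s : Set E) => (x : E)) fun _ : Fin 1 => c)
        (Sum.elim (↑) fun _ => m')) →
      EqT L (Sum.elim (fun x : (Z ∪ s : Set E) => (x : E)) fun _ : Fin 1 => c)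
        (Sum.elim (↑) fun _ => m) := fun s c => by
    by_cases hc : ∃ m' ∈ S, EqT L (Sum.elim (fun x : (Z ∪ s : Set E) => (x : E)) fun _ : Fin 1 => c)
        (Sum.elim (↑) fun _ => m')
    · obtain ⟨m', hm', hcm⟩ := hc
      exact ⟨m', hm', fun _ => hcm⟩
    · exact ⟨_, (Classical.arbitrary S).2, fun hcon => (hc hcon).elim⟩
  choose p hpS hp using hpick
  obtain ⟨Y₀, hZY₀, hY₀, hYR₀⟩ := exists_closed_under (le_max_right L.card ℵ₀)
    (fun s => p s '' Substructure.closure L (Z₁ s))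
    (fun s => mk_image_le.trans (UniversalCategoricity.mk_closure_le _ le_rfl
      ((hZ₁ s).le_aleph0.trans (le_max_right _ _))))
    (hZ.le_aleph0.trans (le_max_right _ _))
  set Y := Y₀ ∩ S with hYdef
  have hZY : Z ⊆ Y := subset_inter hZY₀ hZS
  have hext : ∀ s : Finset E, (s : Set E) ⊆ Y → ∀ d ∈ S, ∃ d' ∈ Y,
      EqT L (Sum.elim (fun x : (Z ∪ s : Set E) => (x : E)) fun _ : Unit => d)
        (Sum.elim (↑) fun _ => d') := fun s hs d hd => by
    obtain ⟨c, hc, hdc⟩ := hrep s (fun _ : Fin 1 => d)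
    have hc' : c = fun _ => c 0 := by
      funext k
      rw [Subsingleton.elim k 0]
    rw [hc'] at hdc
    have h1 := hp s (c 0) ⟨d, hd, hdc.symm⟩
    have h2 := (hdc.trans h1).comp (Sum.map id fun _ : Unit => (0 : Fin 1))
    rw [Sum.elim_comp_map, Sum.elim_comp_map] at h2
    exact ⟨p s (c 0), ⟨hYR₀ s (hs.trans inter_subset_left) ⟨c 0, hc 0, rfl⟩, hpS _ _⟩, h2⟩
  obtain ⟨d, hdS, hdY⟩ : ∃ d ∈ S, d ∉ Substructure.closure L Y := by
    by_contra! hcon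
    have h1 : #S ≤ #(Substructure.closure L Y) := mk_le_mk_of_subset hcon
    exact absurd (h1.trans (UniversalCategoricity.mk_closure_le _ le_rfl
      ((mk_le_mk_of_subset inter_subset_left).trans hY₀))) (not_le.2 hS)
  obtain ⟨s, hsY, hs⟩ := h.exists_finset_base hZ Y (fun _ : Unit => d)
  obtain ⟨D, hD⟩ := hs.exists_ultrafilter
  have hZsY : Z ∪ s ⊆ Y := union_subset hZY hsY
  have hYcl : Y ⊆ Substructure.closure L (Z ∪ Y) :=
    subset_union_right.trans Substructure.subset_closure
  obtain ⟨e, heY, he⟩ := exists_seq_of_finset (Y := Y) (fun F x =>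
    EqT L (Sum.elim (fun x : (Z ∪ s ∪ F : Set E) => (x : E)) fun _ : Unit => d)
        (Sum.elim (↑) fun _ => x)) fun F hF => by
      obtain ⟨d', hd', hdd⟩ := hext (s ∪ F) (by
        rw [Finset.coe_union]
        exact union_subset hsY hF) d hdS
      refine ⟨d', hd', hdd.of_coe _ fun k => Substructure.subset_closure ?_⟩
      rw [Finset.coe_union, ← union_assoc]
      exact k.2
  have hJ := dseq_of_seq (e := e) hD (by
    refine Subset.trans (union_subset hZsY ?_) (hYcl.trans Substructure.subset_closure)
    rintro _ ⟨i, rfl⟩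
    exact heY i) he
  obtain ⟨b', hb', hbb⟩ := h.exists_realize_of_dseq (hZs s) (hD.ne (C := _)
    ((Substructure.closure_mono (hZsY.trans subset_union_right)).trans
      Substructure.subset_closure) fun hd => hdY (Substructure.closure_mono hZsY hd)) hJ b
  refine ⟨b', fun k => ?_, hbb.of_coe _ fun k => Substructure.subset_closure (Or.inl (hZZ k.2))⟩
  refine Substructure.closure_le.2 (union_subset (hZsY.trans inter_subset_right) ?_) (hb' k)
  rintro _ ⟨i, rfl⟩
  exact (heY i).2

end Sat

theorem EqT.of_imp {α : Type*} {M N : Type u} [L.Structure M] [L.Structure N] {v : α → M}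
    {w : α → N} (h : ∀ φ : L.Formula α, φ.Realize v → φ.Realize w) : EqT L v w := fun φ =>
  ⟨h φ, fun hw => by
    by_contra hv
    exact Formula.realize_not.1 (h φ.not (Formula.realize_not.2 hv)) hw⟩

theorem Avg.notMem_closure {E : Type u} [L.Structure E] {β : Type*} {e : β → E}
    (he : Function.Injective e) {D : Ultrafilter (Unit → β)}
    (hD : ∀ a, ∀ᶠ x in (D : Filter (Unit → β)), x () ≠ a) {C : Set E} {b : Unit → E}
    (h : Avg L e D C b) : b () ∉ Substructure.closure L C := by
  intro hb
  have h1 := (h.iff (fun _ : Unit => b ()) (fun _ => hb)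
    ((Term.var (Sum.inr ())).equal (Term.var (Sum.inl ())))).1 (by
      simp only [Formula.realize_equal, Term.realize_var, Sum.elim_inl, Sum.elim_inr])
  simp only [Formula.realize_equal, Term.realize_var, Sum.elim_inl, Sum.elim_inr,
    Function.comp] at h1
  obtain ⟨x, hx⟩ := h1.exists
  obtain ⟨y, hy, hy'⟩ := (h1.and (hD (x ()))).exists
  exact hy' (he (hy.trans hx.symm))

section Minimal

/-- The ultrafilter `D` has exactly one nonalgebraic extension of its average type over `Z` to
every set of size at most `#X`, namely the average type of `D`. -/
structure MinType (X : Type u) {E : Type u} [L.Structure E] {Z : Set E}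
    (D : Ultrafilter (Unit → Substructure.closure L Z)) : Prop where
  countable : Z.Countable
  infinite : Infinite (Substructure.closure L Z)
  ne : ∀ a, ∀ᶠ x in (D : Filter (Unit → Substructure.closure L Z)), x () ≠ a
  avg : ∀ (C : Set E) (b : Unit → E), #C ≤ #X → Avg L Subtype.val D Z b →
    b () ∉ Substructure.closure L (Z ∪ C) → Avg L Subtype.val D (Z ∪ C) b

variable {T : L.Theory} {κ : Cardinal.{u}} {X E : Type u} [L.Structure E]

theorem Monster.exists_limit_type (h : Monster T κ X E) {Z : ℕ → Set E} (hZ : Monotone Z)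
    (hZc : ∀ n, (Z n).Countable) (b : ℕ → Unit → E)
    (hb : ∀ n, EqT L (Sum.elim (fun x : Z n => (x : E)) (b n)) (Sum.elim (↑) (b (n + 1)))) :
    ∃ c : Unit → E, ∀ n, EqT L (Sum.elim (fun x : Z n => (x : E)) (b n)) (Sum.elim (↑) c) := by
  have := h.infinite_index
  have hc : Countable (⋃ n, Z n : Set E) := (countable_iUnion hZc).to_subtype
  have hle : ∀ m n, m ≤ n →
      EqT L (Sum.elim (fun x : Z m => (x : E)) (b m)) (Sum.elim (↑) (b n)) := fun m n hmn => by
    induction n, hmn using Nat.le_induction with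
    | base => exact EqT.refl _
    | succ n hmn ih =>
      exact ih.trans ((hb n).of_coe _ fun k => Substructure.subset_closure (hZ hmn k.2))
  obtain ⟨c, hc⟩ := h.exists_realize nonempty_embedding_of_countable
    nonempty_embedding_of_countable
    {φ : L.Formula ((⋃ n, Z n : Set E) ⊕ Unit) |
      ∀ᶠ n in atTop, φ.Realize (Sum.elim (↑) (b n))} (fun x => (x : E)) fun s hs => by
      obtain ⟨n, hn⟩ := ((Finset.eventually_all s).2 fun φ hφ => hs hφ).exists
      exact ⟨b n, hn⟩
  refine ⟨c, fun n => EqT.of_imp fun φ hφ => ?_⟩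
  have h1 := hc (φ.relabel (Sum.map (inclusion (subset_iUnion Z n)) id)) (by
    refine eventually_atTop.2 ⟨n, fun m hm => ?_⟩
    rw [Formula.realize_relabel, Sum.elim_comp_map]
    exact (hle n m hm φ).1 hφ)
  rw [Formula.realize_relabel, Sum.elim_comp_map] at h1
  exact h1

theorem Monster.exists_avg_notMem (h : Monster T κ X E) {Z : Set E} (hZ : Z.Countable)
    [Infinite (Substructure.closure L Z)] : ∃ b, b ∉ Substructure.closure L Z := by
  obtain ⟨b, hb⟩ := h.exists_avg (Subtype.val : Substructure.closure L Z → E)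
    (nonprincipal _) (h.mk_le_of_countable hZ)
  exact ⟨b (), hb.notMem_closure Subtype.val_injective (nonprincipal_ne _)⟩

theorem Monster.exists_minimal_pair (h : Monster T κ X E) : ∃ (Z : Set E) (b : Unit → E),
    Z.Countable ∧ Infinite (Substructure.closure L Z) ∧ b () ∉ Substructure.closure L Z ∧
    ∀ (b' : Unit → E) (s : Finset E),
      EqT L (Sum.elim (fun x : Z => (x : E)) b) (Sum.elim (↑) b') →
      b' () ∉ Substructure.closure L (Z ∪ s) →
      FS L (Substructure.closure L Z) (Z ∪ s) b' := by
  by_contra! hcon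
  have := h.infinite
  let P := {q : Set E × (Unit → E) // q.1.Countable ∧ Infinite (Substructure.closure L q.1) ∧
    q.2 () ∉ Substructure.closure L q.1}
  have hstep : ∀ q : P, ∃ r : P, q.1.1 ⊆ r.1.1 ∧
      EqT L (Sum.elim (fun x : q.1.1 => (x : E)) q.1.2) (Sum.elim (↑) r.1.2) ∧
      ¬ FS L (Substructure.closure L q.1.1) r.1.1 r.1.2 := fun q => by
    obtain ⟨b', s, hb', hbs, hFS⟩ := hcon q.1.1 q.1.2 q.2.1 q.2.2.1 q.2.2.2
    have := q.2.2.1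
    exact ⟨⟨(q.1.1 ∪ s, b'), q.2.1.union s.countable_toSet,
      infinite_closure_mono (A := q.1.1) subset_union_left, hbs⟩, subset_union_left, hb', hFS⟩
  choose f hfZ hfe hfFS using hstep
  obtain ⟨Z₀, -, hZ₀, hZi⟩ := exists_countable_infinite (L := L) (E := E) countable_empty
  obtain ⟨b₀, hb₀⟩ := h.exists_avg_notMem hZ₀
  let q : ℕ → P := fun n => n.rec ⟨(Z₀, fun _ => b₀), hZ₀, hZi, hb₀⟩ fun _ => f
  have hmono : Monotone fun n => (q n).1.1 := monotone_nat_of_le_succ fun n => hfZ (q n)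
  obtain ⟨c, hc⟩ := h.exists_limit_type hmono (fun n => (q n).2.1) (fun n => (q n).1.2)
    fun n => hfe (q n)
  have : Infinite (Substructure.closure L (q 0).1.1) := hZi
  obtain ⟨n, hn⟩ := h.exists_fs_succ hmono (fun n => (q n).2.1) c
  exact hfFS (q n) (hn.of_eqT (hc (n + 1)).symm)

/-- There is a nonalgebraic type over a countably generated substructure with a unique
nonalgebraic extension to every small set. -/
theorem Monster.exists_minType (h : Monster T κ X E) :
    ∃ (Z : Set E) (D : Ultrafilter (Unit → Substructure.closure L Z)), MinType X D := by
  obtain ⟨Z, b, hZ, hZi, hb, hmin⟩ := h.exists_minimal_pair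
  obtain ⟨D, hD⟩ := (h.fs_of_subset (Substructure.closure L Z) Subset.rfl b).exists_ultrafilter
  have hXi := h.infinite_index
  have hclosed : (Substructure.closure L Z : Set E) ⊆
      Substructure.closure L (Substructure.closure L Z : Set E) := Substructure.subset_closure
  refine ⟨Z, D, hZ, hZi, hD.ne hclosed hb, fun C b' hC hb' hbC => ?_⟩
  have hFS : FS L (Substructure.closure L Z) (Substructure.closure L Z ∪ C) b' :=
    FS.of_finset fun s hs => by
      refine (hmin b' s ((hD.mono (Substructure.subset_closure.trans hclosed)).eqT hb') fun hmem =>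
        hbC (Substructure.closure_mono (union_subset_union_right Z hs) hmem)).mono le_rfl ?_
      exact union_subset (Substructure.closure_mono subset_union_left)
        (subset_union_right.trans Substructure.subset_closure)
  obtain ⟨c, hc⟩ := h.exists_avg (Subtype.val : Substructure.closure L Z → E) D
    (C := Substructure.closure L Z ∪ C) ((mk_union_le _ _).trans (add_le_of_le
      (infinite_iff.1 hXi) (h.mk_closure_le (h.mk_le_of_countable hZ)) hC))
  have hle : (Substructure.closure L Z : Set E) ⊆
      Substructure.closure L (Substructure.closure L Z ∪ C) :=
    subset_union_left.trans Substructure.subset_closure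
  have h1 := h.eqT_of_fs hle hc.fs hFS ((hc.mono hle).eqT hb'.closure)
  exact (hc.of_eqT h1).mono ((union_subset_union_left C Substructure.subset_closure).trans
    Substructure.subset_closure)

end Minimal

theorem exists_seq_of_update {α : Type*} (P : ℕ → (ℕ → α) → Prop)
    (hP : ∀ n a a', (∀ i < n, a i = a' i) → P n a → P n a') (a₀ : ℕ → α) (h₀ : P 0 a₀)
    (h : ∀ n a, P n a → ∃ x, P (n + 1) (Function.update a n x)) : ∃ a, ∀ n, P n a := by
  choose x hx using h
  let S : ∀ n, {a : ℕ → α // P n a} := fun n =>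
    n.rec ⟨a₀, h₀⟩ fun n a => ⟨Function.update a.1 n (x n a.1 a.2), hx n a.1 a.2⟩
  have hstep : ∀ n i, i ≠ n → (S (n + 1)).1 i = (S n).1 i := fun n i hi =>
    Function.update_of_ne hi _ _
  have hstable : ∀ i n, i < n → (S n).1 i = (S (i + 1)).1 i := fun i n hin => by
    induction n, hin using Nat.le_induction with
    | base => rfl
    | succ n hin ih => rw [hstep n i (Nat.ne_of_lt hin), ih]
  exact ⟨fun i => (S (i + 1)).1 i, fun n => hP n _ _ (fun i hi => hstable i n hi) (S n).2⟩

section Embedding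

variable {T : L.Theory} {κ : Cardinal.{u}} {X E : Type u} [L.Structure E]

theorem Ambient.exists_strictlyGenerated (h : Ambient T κ E) :
    ∃ (N : Type u) (_ : L.Structure N), Ambient T κ N ∧ StrictlyGenerated L N κ ∧
      EqT L (Empty.elim : Empty → E) (Empty.elim : Empty → N) := by
  have := h.infinite
  obtain ⟨Z, -, hZ, hZi⟩ := exists_countable_infinite (L := L) (E := E) countable_empty
  obtain ⟨M, _, f, D, J, hf, hJ, -, hD⟩ := exists_dseq_over (L := L) Z κ.ord.ToType
  obtain ⟨S, hS⟩ : ∃ S : L.Substructure M, StrictlyGenerated L S κ :=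
    ⟨_, hJ.strictlyGenerated (hf.injective Function.injective_id)
      hD h.uncountable
    (image_subset_range f Z) (mk_image_le.trans (hZ.le_aleph0.trans h.uncountable.le))
    (mk_ord_toType κ)⟩
  have hinf := infinite_of_strictlyGenerated h.uncountable hS
  refine ⟨_, _, (h.of_eqT hf).substructure _, hS, ?_⟩
  refine EqT.trans (w := (Empty.elim : Empty → M)) ?_ (EqT.symm ?_)
  · convert hf.comp (Empty.elim : Empty → E)
  · convert ((h.of_eqT hf).eqT_subtype S).comp (Empty.elim : Empty → S)

/-- All infinite models are elementarily equivalent. -/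
theorem Ambient.eqT_empty (h : Ambient T κ E) {M : Type u} [L.Structure M] (hM : Ambient T κ M) :
    EqT L (Empty.elim : Empty → E) (Empty.elim : Empty → M) := by
  obtain ⟨N, _, hN, hNκ, hEN⟩ := h.exists_strictlyGenerated
  obtain ⟨N', _, hN', hNκ', hMN⟩ := hM.exists_strictlyGenerated
  obtain ⟨g⟩ := h.unique.2 N N' _ _ hN.models hN'.models hNκ hNκ'
  refine hEN.trans (EqT.trans ?_ hMN.symm)
  convert (hN.eqT_of_embedding hN'.models g.toEmbedding).comp (Empty.elim : Empty → N)

theorem Monster.exists_elementary (h : Monster T κ X E) {M : Type u} [L.Structure M]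
    (hM : Ambient T κ M) (hMX : #M ≤ #X) : ∃ f : M → E, EqT L id f := by
  have := hM.infinite
  have := h.infinite_index
  obtain ⟨f, hf⟩ := h.exists_extend nonempty_embedding_of_countable ((le_def _ _).1 hMX)
    (hM.eqT_empty h.toAmbient) id
  have hf' := hf.comp Sum.inr
  exact ⟨f, hf'⟩

/-- Models larger than the language contain a copy of every countable set. -/
theorem Monster.exists_elementary_over (h : Monster T κ X E) {M : Type u} [L.Structure M]
    (hM : Ambient T κ M) (hMX : #M ≤ #X) (hLM : max L.card ℵ₀ < #M) {Z : Set E}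
    (hZ : Z.Countable) : ∃ f : M → E, EqT L id f ∧ Z ⊆ range f := by
  have := hM.infinite
  have := h.infinite
  have := h.infinite_index
  obtain ⟨f₀, hf₀⟩ := h.exists_elementary hM hMX
  rcases Z.eq_empty_or_nonempty with rfl | hZn
  · exact ⟨f₀, hf₀, empty_subset _⟩
  obtain ⟨z, rfl⟩ := hZ.exists_eq_range hZn
  have hS := h.satIn_of_lt_mk (S := hf₀.toEmbedding.toHom.range) (by
    refine hLM.trans_eq ?_
    have h1 := mk_range_eq f₀ (hf₀.injective Function.injective_id)
    rw [← h1]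
    exact mk_congr (Equiv.setCongr (Set.ext fun _ => Iff.rfl)))
  have hrange : ∀ x, x ∈ hf₀.toEmbedding.toHom.range ↔ x ∈ range f₀ := fun x => Iff.rfl
  obtain ⟨a, ha⟩ := exists_seq_of_update (α := M)
    (fun n a => EqT L (fun i : Fin n => f₀ (a i)) fun i : Fin n => z i)
    (fun n a a' haa hn => by
      convert hn using 3 with i
      exact (haa i i.2).symm) (fun _ => Classical.arbitrary M) (by
      convert (h.eqT_empty h.toAmbient).comp (fun i : Fin 0 => i.elim0) using 1) fun n a hn => by
      obtain ⟨d, hd⟩ := h.exists_extend nonempty_embedding_of_countable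
        nonempty_embedding_of_countable hn.symm fun _ : Fin 1 => z n
      obtain ⟨d', hd', hdd⟩ := hS (range fun i : Fin n => f₀ (a i)) (countable_range _) (by
        rintro _ ⟨i, rfl⟩
        exact (hrange _).2 (mem_range_self _)) d
      obtain ⟨x, hx⟩ := (hrange _).1 (hd' 0)
      refine ⟨x, ?_⟩
      have h1 := hdd.of_coe (fun i : Fin n => f₀ (a i)) fun i =>
        Substructure.subset_closure (mem_range_self i)
      have h2 := (hd.trans h1).symm.comp fun i : Fin (n + 1) =>
        if hi : (i : ℕ) < n then Sum.inl (⟨i, hi⟩ : Fin n) else Sum.inr (0 : Fin 1)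
      convert h2 using 1 <;>
      · funext i
        by_cases hi : (i : ℕ) < n
        · simp [hi, hi.ne]
        · have : (i : ℕ) = n := by omega
          simp [this, hx]
  have haz : EqT L (fun n => f₀ (a n)) z := eqT_of_finset fun s => by
    obtain ⟨n, hn⟩ : ∃ n, ∀ i ∈ s, i < n := ⟨s.sup id + 1, fun i hi =>
      Nat.lt_succ_of_le (Finset.le_sup (f := id) hi)⟩
    exact (ha n).comp fun i : s => ⟨i, hn i i.2⟩
  obtain ⟨f, hf⟩ := h.exists_extend nonempty_embedding_of_countable ((le_def _ _).1 hMX) haz f₀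
  have hf' := hf.comp Sum.inr
  refine ⟨f, hf₀.trans hf', ?_⟩
  rintro _ ⟨n, rfl⟩
  exact ⟨a n, ((hf.term_eq (Term.var (Sum.inr (a n))) (Term.var (Sum.inl n))).1 rfl)⟩

end Embedding

section Basis

variable {T : L.Theory} {κ : Cardinal.{u}} {X E : Type u} [L.Structure E] {Z : Set E}
  {D : Ultrafilter (Unit → Substructure.closure L Z)}

/-- Independent sets of realizations of the average type of `D`. -/
def Indep (D : Ultrafilter (Unit → Substructure.closure L Z)) (J : Set E) : Prop :=
  (∀ j ∈ J, Avg L Subtype.val D Z fun _ => j) ∧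
    ∀ j ∈ J, j ∉ Substructure.closure L (Z ∪ J \ {j})

theorem exists_maximal_indep (D : Ultrafilter (Unit → Substructure.closure L Z)) (M : Set E) :
    ∃ J, Maximal (· ∈ {J : Set E | J ⊆ M ∧ Indep D J}) J := by
  refine zorn_subset _ fun c hcS hc => ?_
  rcases c.eq_empty_or_nonempty with rfl | hcn
  · exact ⟨∅, ⟨empty_subset _, by simp [Indep]⟩, by simp⟩
  refine ⟨⋃₀ c, ⟨sUnion_subset fun J hJ => (hcS hJ).1, ?_, ?_⟩, fun J hJ => subset_sUnion_of_mem hJ⟩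
  · rintro j ⟨J, hJ, hj⟩
    exact (hcS hJ).2.1 j hj
  · rintro j hj hmem
    have h1 : (⋃₀ c \ {j} : Set E) = id '' (⋃₀ c \ {j}) := (image_id _).symm
    rw [h1] at hmem
    obtain ⟨F, hF, hFj⟩ := exists_finset_index hmem
    obtain ⟨J, hJ, hJF⟩ := DirectedOn.exists_mem_subset_of_finite_of_subset_sUnion hcn
      hc.directedOn (F.finite_toSet.insert j)
      (insert_subset hj (hF.trans sdiff_subset))
    refine (hcS hJ).2.2 j (hJF (mem_insert _ _)) (Substructure.closure_mono
      (union_subset_union_right Z ?_) hFj)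
    rw [image_id]
    exact fun x hx => ⟨hJF (mem_insert_of_mem _ hx), (hF hx).2⟩

theorem MinType.dseq (hD : MinType X D) {I : Type*} [LinearOrder I] {J : I → E}
    (hIX : #(range J) ≤ #X) (hJ : ∀ i, Avg L Subtype.val D Z fun _ => J i)
    (hi : ∀ i, J i ∉ Substructure.closure L (Z ∪ J '' {k | k < i})) :
    DSeq L Subtype.val D fun i (_ : Unit) => J i := by
  intro i
  refine (hD.avg (J '' {k | k < i}) (fun _ => J i)
    ((mk_le_mk_of_subset (image_subset_range _ _)).trans hIX) (hJ i) (hi i)).mono ?_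
  rw [Subtype.range_coe]
  refine union_subset (Substructure.closure_mono subset_union_left) ?_
  refine iUnion₂_subset fun j hj => ?_
  rintro _ ⟨_, rfl⟩
  exact Substructure.subset_closure (Or.inr ⟨j, hj, rfl⟩)

theorem Indep.dseq {J : Set E} (hJ : Indep D J) (hD : MinType X D) (hJX : #J ≤ #X)
    [LinearOrder J] : DSeq L Subtype.val D fun (i : J) (_ : Unit) => (i : E) := by
  refine hD.dseq (by rwa [Subtype.range_coe]) (fun i => hJ.1 i i.2) fun i hi => ?_
  refine hJ.2 i i.2 (Substructure.closure_mono (union_subset_union_right Z ?_) hi)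
  rintro _ ⟨k, hk, rfl⟩
  exact ⟨k.2, fun hki => (ne_of_lt hk) (Subtype.ext hki)⟩

theorem exists_linearOrder (α : Type*) : Nonempty (LinearOrder α) :=
  ⟨IsWellOrder.linearOrder WellOrderingRel⟩

theorem Indep.insert_of_notMem {J : Set E} (hJ : Indep D J) (hD : MinType X D) {e : E}
    (hJX : #(insert e J : Set E) ≤ #X) (he : Avg L Subtype.val D Z fun _ => e)
    (heJ : e ∉ Substructure.closure L (Z ∪ J)) : Indep D (insert e J) := by
  obtain ⟨_⟩ := exists_linearOrder J
  let K : WithTop J → E := fun i => WithTop.recTopCoe e (fun j => (j : E)) i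
  have hrange : range K ⊆ insert e J := by
    rintro _ ⟨i, rfl⟩
    induction i using WithTop.recTopCoe with
    | top => exact mem_insert _ _
    | coe j => exact mem_insert_of_mem _ j.2
  have hK : DSeq L Subtype.val D fun i (_ : Unit) => K i := by
    refine hD.dseq ((mk_le_mk_of_subset hrange).trans hJX) (fun i => ?_) fun i hi => ?_
    · induction i using WithTop.recTopCoe with
      | top => exact he
      | coe j => exact hJ.1 j j.2
    · induction i using WithTop.recTopCoe with
      | top =>
        refine heJ (Substructure.closure_mono (union_subset_union_right Z ?_) hi)
        rintro _ ⟨k, hk, rfl⟩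
        lift k to J using hk.ne
        exact k.2
      | coe j =>
        refine hJ.2 j j.2 (Substructure.closure_mono (union_subset_union_right Z ?_) hi)
        rintro _ ⟨k, hk, rfl⟩
        lift k to J using (lt_trans hk (WithTop.coe_lt_top j)).ne
        exact ⟨k.2, fun hkj => (WithTop.coe_lt_coe.1 hk).ne (Subtype.ext hkj)⟩
  have hsurj : ∀ j ∈ insert e J, ∃ i, K i = j := by
    rintro j (rfl | hj)
    · exact ⟨⊤, rfl⟩
    · exact ⟨((⟨j, hj⟩ : J) : WithTop J), rfl⟩
  refine ⟨?_, fun j hj hmem => ?_⟩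
  · rintro j (rfl | hj)
    · exact he
    · exact hJ.1 j hj
  · obtain ⟨i, rfl⟩ := hsurj j hj
    refine hK.notMem_closure Subtype.val_injective hD.ne i (Substructure.closure_mono ?_ hmem)
    rw [Subtype.range_coe]
    refine union_subset_union Substructure.subset_closure ?_
    rintro k ⟨hk, hki⟩
    obtain ⟨k, rfl⟩ := hsurj k hk
    exact ⟨k, fun hk' => hki (hk' ▸ rfl), rfl⟩

/-- Realizations of the type in `M` lie in the closure of a maximal independent subset of `M`. -/
theorem mem_closure_of_maximal (hD : MinType X D) {M J : Set E} (hMX : #M ≤ #X)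
    (hJ : Maximal (· ∈ {J : Set E | J ⊆ M ∧ Indep D J}) J) {e : E} (heM : e ∈ M)
    (he : Avg L Subtype.val D Z fun _ => e) : e ∈ Substructure.closure L (Z ∪ J) := by
  by_contra hcon
  have hsub : insert e J ⊆ M := insert_subset heM hJ.prop.1
  have h1 := hJ.prop.2.insert_of_notMem hD ((mk_le_mk_of_subset hsub).trans hMX) he hcon
  exact hcon (Substructure.subset_closure (Or.inr
    (hJ.le_of_ge ⟨hsub, h1⟩ (subset_insert e J) (mem_insert e J))))

theorem Monster.not_countable_of_maximal (h : Monster T κ X E) (hD : MinType X D)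
    {M : L.Substructure E} {J : Set E} (hMX : #M ≤ #X) (hM : SatIn M) (hZM : Z ⊆ M)
    (hJ : Maximal (· ∈ {J : Set E | J ⊆ M ∧ Indep D J}) J) : ¬ J.Countable := by
  intro hJc
  have hZJ : (Z ∪ J).Countable := hD.countable.union hJc
  obtain ⟨b, hb⟩ := h.exists_avg (Subtype.val : Substructure.closure L Z → E) D
    (h.mk_le_of_countable hZJ)
  obtain ⟨b', hb', hbb⟩ := hM (Z ∪ J) hZJ (union_subset hZM hJ.prop.1) fun _ : Fin 1 => b ()
  have h1 := hbb.comp (Sum.map id fun _ : Unit => (0 : Fin 1))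
  rw [Sum.elim_comp_map, Sum.elim_comp_map] at h1
  have h2 := hb.of_eqT h1
  exact h2.notMem_closure Subtype.val_injective hD.ne (mem_closure_of_maximal hD hMX hJ (hb' 0)
    (h2.mono (subset_union_left.trans Substructure.subset_closure)))

/-- The closure of an infinite independent set realizes all types over closures of finite
subsets. -/
theorem Monster.exists_realize_of_indep (h : Monster T κ X E) (hD : MinType X D) {J : Set E}
    (hJ : Indep D J) (hJX : #J ≤ #X) (hJi : J.Infinite) (F : Finset E) (hF : (F : Set E) ⊆ J)
    {n : ℕ} (d : Fin n → E) : ∃ d' : Fin n → E,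
      (∀ k, d' k ∈ Substructure.closure L (Z ∪ J)) ∧
        EqT L (Sum.elim (fun x : (Z ∪ F : Set E) => (x : E)) d) (Sum.elim (↑) d') := by
  obtain ⟨_⟩ := exists_linearOrder (J \ F : Set E)
  have : Infinite (J \ F : Set E) := (hJi.sdiff F.finite_toSet).to_subtype
  have hsub : (Substructure.closure L Z : Set E) ⊆ Substructure.closure L (Z ∪ F) :=
    Substructure.closure_mono subset_union_left
  have hdseq : DSeq L (Subtype.val : Substructure.closure L (Z ∪ F) → E) (push hsub D)
      fun (i : (J \ F : Set E)) (_ : Unit) => (i : E) := fun i => by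
    refine avg_push_iff.2 ((hD.avg (J \ {(i : E)}) _ ((mk_le_mk_of_subset sdiff_subset).trans hJX)
      (hJ.1 i i.2.1) (hJ.2 i i.2.1)).mono ?_)
    rw [Subtype.range_coe]
    refine union_subset (Substructure.closure_mono (union_subset_union_right Z fun x hx =>
      ⟨hF hx, fun hxi => i.2.2 (hxi ▸ hx)⟩)) ?_
    refine iUnion₂_subset fun j hj => ?_
    rintro _ ⟨_, rfl⟩
    exact Substructure.subset_closure (Or.inr ⟨j.2.1, fun hji => hj.ne (Subtype.ext hji)⟩)
  obtain ⟨d', hd', hdd⟩ := h.exists_realize_of_dseq (hD.countable.union F.countable_toSet)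
    (push_ne hsub hD.ne) hdseq d
  refine ⟨d', fun k => Substructure.closure_mono (union_subset (union_subset_union_right Z hF) ?_)
    (hd' k), hdd⟩
  rw [Subtype.range_coe]
  exact sdiff_subset.trans subset_union_right

end Basis

section Generation

variable {T : L.Theory} {κ : Cardinal.{u}} {X E : Type u} [L.Structure E] {Z : Set E}
  {D : Ultrafilter (Unit → Substructure.closure L Z)}

theorem FS.mem_closure_of_term {N : L.Substructure E} {C : Set E} {d : Unit → E}
    (hd : FS L N C d) {γ : Type*} (c : γ → E) (hc : ∀ k, c k ∈ Substructure.closure L C)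
    (t : L.Term (γ ⊕ Unit)) (ht : t.realize (Sum.elim c d) ∈ Substructure.closure L C) :
    t.realize (Sum.elim c d) ∈ Substructure.closure L (N ∪ range c) := by
  obtain ⟨x, hx, hxt⟩ := hd.exists_mem
    (Sum.elim c fun _ : Unit => t.realize (Sum.elim c d))
    (by
      rintro (k | k)
      · exact hc k
      · exact ht)
    ((t.relabel (Sum.map Sum.inl id)).equal (Term.var (Sum.inl (Sum.inr ())))) (by
      simp only [Formula.realize_equal, Term.realize_relabel, Term.realize_var, Sum.elim_inl,
        Sum.elim_inr, Sum.elim_comp_map, Sum.elim_comp_inl, Function.comp_id])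
  simp only [Formula.realize_equal, Term.realize_relabel, Term.realize_var, Sum.elim_inl,
    Sum.elim_inr, Sum.elim_comp_map, Sum.elim_comp_inl, Function.comp_id] at hxt
  rw [← hxt]
  refine realize_mem_closure t _ _ ?_
  rintro (k | k)
  · exact Substructure.subset_closure (Or.inr (mem_range_self k))
  · exact Substructure.subset_closure (Or.inl (hx k))

theorem exists_split_of_mem_closure {A : Set E} {d : ℕ → E} {e : E}
    (he : e ∈ Substructure.closure L (A ∪ range d)) (heA : e ∉ Substructure.closure L A) :
    ∃ m, e ∈ Substructure.closure L (A ∪ d '' {i | i < m + 1}) ∧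
      e ∉ Substructure.closure L (A ∪ d '' {i | i < m}) := by
  classical
  have hex : ∃ m, e ∈ Substructure.closure L (A ∪ d '' {i | i < m}) := by
    obtain ⟨F, hF⟩ := exists_finset_of_mem_closure_union he
    refine ⟨F.sup id + 1, Substructure.closure_mono (union_subset_union_right A
      (image_mono fun i hi => ?_)) hF⟩
    exact Nat.lt_succ_of_le (Finset.le_sup (f := id) hi)
  have h0 : Nat.find hex ≠ 0 := fun h0 => by
    have h1 := Nat.find_spec hex
    rw [h0] at h1
    simp only [not_lt_zero, ofPred_false, image_empty, union_empty] at h1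
    exact heA h1
  obtain ⟨m, hm⟩ := Nat.exists_eq_succ_of_ne_zero h0
  refine ⟨m, ?_, Nat.find_min hex (by omega)⟩
  have h1 := Nat.find_spec hex
  rwa [hm] at h1

theorem FS.exists_notMem_closure {N : L.Substructure E} {C : Set E} {γ : Type*} {c c' : γ → E}
    {b d : Unit → E} {e : E} (hd : FS L N C d) (hNC : (N : Set E) ⊆ Substructure.closure L C)
    (hc' : ∀ k, c' k ∈ Substructure.closure L C)
    (h : EqT L (Sum.elim (Sum.elim (Subtype.val : N → E) c) b) (Sum.elim (Sum.elim (↑) c') d))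
    (he : e ∈ Substructure.closure L (N ∪ range c ∪ range b))
    (hec : e ∉ Substructure.closure L (N ∪ range c)) :
    ∃ e' ∈ Substructure.closure L (N ∪ range c' ∪ range d), e' ∉ Substructure.closure L C ∧
      EqT L (Sum.elim (Subtype.val : N → E) fun _ : Unit => e) (Sum.elim (↑) fun _ => e') := by
  have hrange : ∀ y : γ → E, range (Sum.elim (Subtype.val : N → E) y) =
      (N : Set E) ∪ range y := fun y => by
    rw [Sum.elim_range, Subtype.range_coe]
  obtain ⟨t, ht⟩ := exists_terms (L := L) (N ∪ range c ∪ range b : Set E)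
    (Sum.elim (Sum.elim (Subtype.val : N → E) c) b) (fun x hx => by
      rwa [Sum.elim_range, hrange]) (fun _ : Unit => e) fun _ => he
  have hec' := ht ()
  have hterms := h.terms (Sum.elim (fun x : N => Term.var (Sum.inl (Sum.inl x)))
    fun _ : Unit => t ())
  refine ⟨(t ()).realize (Sum.elim (Sum.elim (↑) c') d), ?_, fun hmem => hec ?_, ?_⟩
  · refine realize_mem_closure _ _ _ fun k => Substructure.subset_closure ?_
    rw [← hrange, ← Sum.elim_range]
    exact mem_range_self k
  · have h1 := hd.mem_closure_of_term (Sum.elim (Subtype.val : N → E) c') (by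
      rintro (k | k)
      · exact hNC k.2
      · exact hc' k) (t ()) hmem
    obtain ⟨r, hr⟩ := exists_terms (L := L) (N ∪ range (Sum.elim (Subtype.val : N → E) c') : Set E)
      (Sum.elim (Subtype.val : N → E) c') (by
        rintro x (hx | hx)
        · exact ⟨Sum.inl ⟨x, hx⟩, rfl⟩
        · exact hx) (fun _ : Unit => (t ()).realize (Sum.elim (Sum.elim (↑) c') d)) fun _ => h1
    have h2 := (h.term_eq ((r ()).relabel Sum.inl) (t ())).2 (by
      rw [Term.realize_relabel, Sum.elim_comp_inl]
      exact hr ())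
    rw [Term.realize_relabel, Sum.elim_comp_inl, hec'] at h2
    rw [← h2]
    refine realize_mem_closure _ _ _ fun k => Substructure.subset_closure ?_
    rw [← hrange]
    exact mem_range_self k
  · convert hterms using 1 <;>
    · funext k
      rcases k with k | k
      · rfl
      · first | exact hec'.symm | rfl

/-- A sufficiently saturated substructure is generated by any of its maximal independent sets. -/
theorem Monster.subset_closure_of_maximal (h : Monster T κ X E) (hD : MinType X D)
    {M : L.Substructure E} {J : Set E} (hMX : #M ≤ #X) (hM : SatIn M) (hZM : Z ⊆ M)
    (hJ : Maximal (· ∈ {J : Set E | J ⊆ M ∧ Indep D J}) J) :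
    (M : Set E) ⊆ Substructure.closure L (Z ∪ J) := by
  intro d hdM
  by_contra hd
  have hZi := hD.infinite
  have hJM := hJ.prop.1
  have hJX : #J ≤ #X := (mk_le_mk_of_subset hJM).trans hMX
  have hJi : J.Infinite := fun hfin => h.not_countable_of_maximal hD hMX hM hZM hJ hfin.countable
  obtain ⟨s, hsJ, hs⟩ := h.exists_finset_base hD.countable J fun _ : Unit => d
  have hZs : (Z ∪ s : Set E).Countable := hD.countable.union s.countable_toSet
  have hsub : (Substructure.closure L (Z ∪ s) : Set E) ⊆
      Substructure.closure L (Substructure.closure L (Z ∪ J) : Set E) :=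
    subset_trans (Substructure.closure_mono (union_subset_union_right Z hsJ))
      Substructure.subset_closure
  obtain ⟨D', hD'⟩ := hs.exists_ultrafilter
  have hne := hD'.ne hsub fun hdN => hd (Substructure.closure_mono
    (union_subset_union_right Z hsJ) hdN)
  obtain ⟨K, hK⟩ := h.exists_dseq (h.nonempty_embedding_closure (h.mk_le_of_countable hZs))
    (Subtype.val : Substructure.closure L (Z ∪ s) → E) D' (ULift.{u} ℕ)
    (by
      rw [mk_uLift, mk_nat, lift_aleph0]
      exact (le_max_right _ _).trans h.le_mk)
  have hK' := hK.comp (π := fun n : ℕ => ULift.up n) fun _ _ hab => hab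
  obtain ⟨p, hp⟩ := h.exists_avg (Subtype.val : Substructure.closure L Z → E) D
    (h.mk_le_of_countable hZs)
  obtain ⟨e, he, hpe⟩ := h.exists_realize_of_dseq hZs hne hK' fun _ : Fin 1 => p ()
  have hpe' := hpe.comp (Sum.map id fun _ : Unit => (0 : Fin 1))
  rw [Sum.elim_comp_map, Sum.elim_comp_map] at hpe'
  have hep := hp.of_eqT hpe'
  obtain ⟨m, hem, hem'⟩ := exists_split_of_mem_closure (he 0)
    (hep.notMem_closure Subtype.val_injective hD.ne)
  obtain ⟨c, hc⟩ : ∃ c : Fin m → E, c = fun i : Fin m => K (ULift.up i) () := ⟨_, rfl⟩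
  have hrc : range c = (fun i => (K ∘ fun n : ℕ => ULift.up n) i ()) '' {i | i < m} := by
    rw [hc]
    ext x
    constructor
    · rintro ⟨i, rfl⟩
      exact ⟨i, i.2, rfl⟩
    · rintro ⟨i, hi, rfl⟩
      exact ⟨⟨i, hi⟩, rfl⟩
  obtain ⟨c', hc', hcc⟩ := h.exists_realize_of_indep hD hJ.prop.2 hJX hJi s hsJ c
  have hcd : Avg L (Subtype.val : Substructure.closure L (Z ∪ s) → E) D'
      (range (Subtype.val : Substructure.closure L (Z ∪ s) → E) ∪ range c) (K (ULift.up m)) := by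
    refine (hK' m).mono (subset_trans ?_ Substructure.subset_closure)
    refine union_subset_union_right _ ?_
    rw [hrc]
    rintro _ ⟨i, hi, rfl⟩
    exact mem_iUnion₂.2 ⟨i, hi, (), rfl⟩
  have hcd' : Avg L (Subtype.val : Substructure.closure L (Z ∪ s) → E) D'
      (range (Subtype.val : Substructure.closure L (Z ∪ s) → E) ∪ range c') fun _ => d := by
    refine hD'.mono ?_
    rw [Subtype.range_coe]
    refine union_subset hsub ?_
    rintro _ ⟨i, rfl⟩
    exact Substructure.subset_closure (hc' i)
  have hle : (Z ∪ s : Set E) ⊆ Substructure.closure L (Z ∪ s) := Substructure.subset_closure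
  obtain ⟨e', he', heJ, hee⟩ := hs.exists_notMem_closure (e := e 0) hsub
    (fun k => Substructure.subset_closure (hc' k)) (Avg.eqT_elim (EqT.closure hcc) hcd hcd')
    (by
      refine Substructure.closure_mono ?_ hem
      rw [hrc, union_assoc (Substructure.closure L (Z ∪ s) : Set E)]
      refine union_subset_union hle ?_
      rintro _ ⟨i, hi, rfl⟩
      rcases Nat.lt_succ_iff_lt_or_eq.1 hi with hi | rfl
      · exact Or.inl ⟨i, hi, rfl⟩
      · exact Or.inr ⟨(), rfl⟩) fun hmem => hem' (by
      refine Substructure.closure_le.2 (union_subset ?_ ?_) hmem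
      · exact Substructure.closure_mono subset_union_left
      · rw [hrc]
        exact subset_union_right.trans Substructure.subset_closure)
  have heM : e' ∈ M := by
    refine Substructure.closure_le.2 (union_subset (union_subset ?_ ?_) ?_) he'
    · exact Substructure.closure_le.2 (union_subset hZM (hsJ.trans hJM))
    · rintro _ ⟨i, rfl⟩
      exact Substructure.closure_le.2 (union_subset hZM hJM) (hc' i)
    · rintro _ ⟨_, rfl⟩
      exact hdM
  have hep' := hep.of_eqT (hee.of_mem_closure (v := Subtype.val) (w := Subtype.val) (fun k => by
    rw [Subtype.range_coe]
    exact Substructure.subset_closure (hle k.2)) (EqT.refl _))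
  exact heJ (Substructure.subset_closure (mem_closure_of_maximal hD hMX hJ heM
    (hep'.mono (subset_union_left.trans Substructure.subset_closure))))

end Generation

section Categoricity

variable {T : L.Theory} {κ : Cardinal.{u}} {X E : Type u} [L.Structure E] {Z : Set E}
  {D : Ultrafilter (Unit → Substructure.closure L Z)}

/-- Models larger than the language are generated by `Z` and an independent set. -/
theorem Monster.exists_indep_equiv (h : Monster T κ X E) (hD : MinType X D) {M : Type u}
    [L.Structure M] (hM : Ambient T κ M) (hMX : #M ≤ #X) (hLM : max L.card ℵ₀ < #M) :
    ∃ J : Set E, Indep D J ∧ #J = #M ∧ Nonempty (M ≃[L] Substructure.closure L (Z ∪ J)) := by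
  obtain ⟨f, hf, hZf⟩ := h.exists_elementary_over hM hMX hLM hD.countable
  obtain ⟨S, ⟨g⟩, hZS⟩ : ∃ S : L.Substructure E, Nonempty (M ≃[L] S) ∧ Z ⊆ S :=
    ⟨hf.toEmbedding.toHom.range, ⟨hf.toEmbedding.equivRange⟩, hZf⟩
  have hSM : #S = #M := (mk_congr g.toEquiv).symm
  obtain ⟨J, hJ⟩ := exists_maximal_indep D (S : Set E)
  have hle := h.subset_closure_of_maximal hD (hSM.le.trans hMX)
    (h.satIn_of_lt_mk (hLM.trans_eq hSM.symm)) hZS hJ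
  have hS : S = Substructure.closure L (Z ∪ J) :=
    le_antisymm hle (Substructure.closure_le.2 (union_subset hZS hJ.prop.1))
  refine ⟨J, hJ.prop.2, le_antisymm ((mk_le_mk_of_subset hJ.prop.1).trans_eq hSM) ?_, ?_⟩
  · by_contra! hlt
    have h1 : #(Z ∪ J : Set E) ≤ max (max L.card ℵ₀) #J := by
      refine (mk_union_le _ _).trans (add_le_of_le ((le_max_right _ _).trans (le_max_left _ _))
        ?_ (le_max_right _ _))
      exact hD.countable.le_aleph0.trans ((le_max_right _ _).trans (le_max_left _ _))
    have h2 := UniversalCategoricity.mk_closure_le (Z ∪ J) (le_max_left _ _) h1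
    rw [← hS, hSM] at h2
    exact not_lt.2 h2 (max_lt hLM hlt)
  · rw [← hS]
    exact ⟨g⟩

theorem Indep.nonempty_equiv (hD : MinType X D) {J J' : Set E} (hJ : Indep D J)
    (hJ' : Indep D J') (hJX : #J ≤ #X) (hJJ : #J = #J') :
    Nonempty (Substructure.closure L (Z ∪ J) ≃[L] Substructure.closure L (Z ∪ J')) := by
  obtain ⟨_⟩ := exists_linearOrder J
  obtain ⟨σ⟩ := Cardinal.eq.1 hJJ
  have hrange : range (fun i : J => (σ i : E)) = J' := by
    rw [range_comp' Subtype.val σ, σ.surjective.range_eq, image_univ, Subtype.range_coe]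
  have h' : DSeq L (Subtype.val : Substructure.closure L Z → E) D
      fun (i : J) (_ : Unit) => (σ i : E) := by
    refine hD.dseq ?_ (fun i => hJ'.1 _ (σ i).2) fun i hi => ?_
    · rw [hrange, ← hJJ]
      exact hJX
    · refine hJ'.2 _ (σ i).2 (Substructure.closure_mono (union_subset_union_right Z ?_) hi)
      rintro _ ⟨k, hk, rfl⟩
      exact ⟨(σ k).2, fun hki => (ne_of_lt hk) (σ.injective (Subtype.ext hki))⟩
  obtain ⟨g, -⟩ := ((hJ.dseq hD hJX).eqT h' (EqT.refl _)).exists_equiv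
  have hcl : ∀ (K : J → E), Substructure.closure L (range (Sum.elim
      (Subtype.val : Substructure.closure L Z → E) (Function.uncurry fun i (_ : Unit) => K i))) =
      Substructure.closure L (Z ∪ range K) := fun K => by
    have h1 : range (Function.uncurry fun i (_ : Unit) => K i) = range K := by
      ext x
      constructor
      · rintro ⟨⟨i, -⟩, rfl⟩
        exact ⟨i, rfl⟩
      · rintro ⟨i, rfl⟩
        exact ⟨(i, ()), rfl⟩
    rw [Sum.elim_range, Subtype.range_coe, h1, Substructure.closure_union,
      Substructure.closure_union, Substructure.closure_eq]
  rw [hcl, hcl, hrange, Subtype.range_coe] at g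
  exact ⟨g⟩

end Categoricity

end UniversalCategoricity

open UniversalCategoricity

/-- A universal theory that is `κ`-unique for some uncountable `κ` is categorical in every
cardinality `μ > max(|L|, ℵ₀)`: it has a model of cardinality `μ` and any two models of
cardinality `μ` are isomorphic. -/
theorem stmt3 {L : FirstOrder.Language.{u, u}} (T : L.Theory)
    (hTuniv : IsUniversalTheory T)
    (κ : Cardinal.{u}) (hκ : ℵ₀ < κ) (hTκ : KUnique T κ) :
    ∀ μ : Cardinal.{u}, max L.card ℵ₀ < μ →
      (∃ (M : Type u) (_ : L.Structure M), M ⊨ T ∧ #M = μ) ∧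
      (∀ (M N : Type u) (_ : L.Structure M) (_ : L.Structure N),
        M ⊨ T → N ⊨ T → #M = μ → #N = μ → Nonempty (M ≃[L] N)) := by
  intro μ hμ
  refine ⟨?_, fun M N _ _ hM hN hMμ hNμ => ?_⟩
  · obtain ⟨M, _, hM, hMκ⟩ := hTκ.1
    have := infinite_of_strictlyGenerated hκ hMκ
    exact exists_model_card hM hμ.le
  · have hamb : ∀ (K : Type u) [L.Structure K], K ⊨ T → #K = μ → Ambient T κ K :=
      fun K _ hK hKμ => ⟨hTuniv, hκ, hTκ, hK,
        Cardinal.infinite_iff.2 (hKμ ▸ (le_max_right _ _).trans hμ.le)⟩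
    obtain ⟨X, E, _, hE, hX⟩ := (hamb M hM hMμ).exists_monster (χ := μ)
    obtain ⟨Z, D, hD⟩ := hE.exists_minType
    obtain ⟨J, hJ, hJM, ⟨f⟩⟩ := hE.exists_indep_equiv hD (hamb M hM hMμ) (hMμ.trans_le hX)
      (hμ.trans_eq hMμ.symm)
    obtain ⟨J', hJ', hJN, ⟨g⟩⟩ := hE.exists_indep_equiv hD (hamb N hN hNμ) (hNμ.trans_le hX)
      (hμ.trans_eq hNμ.symm)
    obtain ⟨e⟩ := hJ.nonempty_equiv hD hJ' ((hJM.trans hMμ).trans_le hX)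
      ((hJM.trans hMμ).trans (hJN.trans hNμ).symm)
    exact ⟨g.symm.comp (e.comp f)⟩
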